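/- Every tiling of the Euclidean plane by convex polygons that is monocoronal up to rigid motions has a center of rotational symmetry of order at least 2: its symmetry group contains an orientation-preserving isometry that is not the identity and has a fixed point. -/

import Mathlib

noncomputable section

open Set

abbrev E2 := EuclideanSpace ℝ (Fin 2)

/-- A convex polygon: a compact convex subset of the plane with nonempty interior
and finitely many extreme points. -/
def IsConvexPolygon (P : Set E2) : Prop :=
  IsCompact P ∧ Convex ℝ P ∧ (interior P).Nonempty ∧ (Set.extremePoints ℝ P).Finite

/-- A tiling of the plane by convex polygons. -/
def IsTiling (T : Set (Set E2)) : Prop :=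
  T.Countable ∧ (∀ P ∈ T, IsConvexPolygon P) ∧ (⋃₀ T = Set.univ) ∧
    T.Pairwise fun P Q => Disjoint (interior P) (interior Q)

/-- A vertex of a tiling: an extreme point of at least one tile. -/
def IsVertex (T : Set (Set E2)) (x : E2) : Prop :=
  ∃ P ∈ T, x ∈ Set.extremePoints ℝ P

/-- An isometry of the plane is orientation preserving if its linear part has
determinant `1`. -/
def OrientationPreserving (f : E2 ≃ᵃⁱ[ℝ] E2) : Prop :=
  LinearMap.det (f.linearIsometryEquiv.toLinearEquiv : E2 →ₗ[ℝ] E2) = 1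

/-- Monocoronal up to rigid motions: any two vertex coronae are directly congruent. -/
def MonocoronalRM (T : Set (Set E2)) : Prop :=
  ∀ x y : E2, IsVertex T x → IsVertex T y →
    ∃ f : E2 ≃ᵃⁱ[ℝ] E2, OrientationPreserving f ∧ f x = y ∧
      (fun P => f '' P) '' {P | P ∈ T ∧ x ∈ P} = {P | P ∈ T ∧ y ∈ P}

/-- Monocoronal up to congruence: any two vertex coronae are congruent
(mirror images allowed). -/
def MonocoronalC (T : Set (Set E2)) : Prop :=
  ∀ x y : E2, IsVertex T x → IsVertex T y →
    ∃ f : E2 ≃ᵃⁱ[ℝ] E2, f x = y ∧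
      (fun P => f '' P) '' {P | P ∈ T ∧ x ∈ P} = {P | P ∈ T ∧ y ∈ P}

/-- A symmetry of a tiling: an isometry mapping the set of tiles onto itself. -/
def IsSymmetry (T : Set (Set E2)) (f : E2 ≃ᵃⁱ[ℝ] E2) : Prop :=
  (fun P => f '' P) '' T = T

/-- The set of translation vectors of a tiling. -/
def periodVectors (T : Set (Set E2)) : Set E2 :=
  {v | IsSymmetry T (AffineIsometryEquiv.constVAdd ℝ E2 v)}


section SecAux
open scoped Pointwise
open MeasureTheory
variable {T : Set (Set ℂ)}


/-- Orientation preserving motions of the complex plane. -/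
@[ext] structure Mo where
  a : Circle
  b : ℂ

namespace Mo

instance : Mul Mo := ⟨fun g h => ⟨g.a * h.a, g.a * h.b + g.b⟩⟩
instance : One Mo := ⟨⟨1, 0⟩⟩
instance : Inv Mo := ⟨fun g => ⟨g.a⁻¹, -((g.a⁻¹ : Circle) * g.b)⟩⟩

theorem mul_a (g h : Mo) : (g * h).a = g.a * h.a := rfl
theorem mul_b (g h : Mo) : (g * h).b = g.a * h.b + g.b := rfl
theorem one_a : (1 : Mo).a = 1 := rfl
theorem one_b : (1 : Mo).b = 0 := rfl
theorem inv_a (g : Mo) : (g⁻¹).a = g.a⁻¹ := rfl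
theorem inv_b (g : Mo) : (g⁻¹).b = -((g.a⁻¹ : Circle) * g.b) := rfl

instance : Group Mo where
  mul_assoc x y z := by
    ext
    · simp [mul_a, mul_assoc]
    · simp [mul_a, mul_b]; ring
  one_mul x := by ext <;> simp [mul_a, mul_b, one_a, one_b]
  mul_one x := by ext <;> simp [mul_a, mul_b, one_a, one_b]
  inv_mul_cancel x := by ext <;> simp [mul_a, mul_b, one_a, one_b, inv_a, inv_b]

instance : MulAction Mo ℂ where
  smul g z := g.a * z + g.b
  one_smul z := by
    change ((1 : Circle) : ℂ) * z + 0 = z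
    simp
  mul_smul g h z := by
    change ((g.a * h.a : Circle) : ℂ) * z + (g.a * h.b + g.b) = g.a * (h.a * z + h.b) + g.b
    push_cast; ring

theorem smul_def (g : Mo) (z : ℂ) : g • z = g.a * z + g.b := rfl

instance : ContinuousConstSMul Mo ℂ where
  continuous_const_smul g := by
    change Continuous (fun z : ℂ => (g.a : ℂ) * z + g.b)
    fun_prop

theorem norm_a (g : Mo) : ‖(g.a : ℂ)‖ = 1 := Circle.norm_coe g.a

theorem smul_sub' (g : Mo) (z w : ℂ) : g • z - g • w = g.a * (z - w) := by
  simp only [smul_def]; ring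

theorem dist_smul (g : Mo) (z w : ℂ) : dist (g • z) (g • w) = dist z w := by
  rw [dist_eq_norm, smul_sub', norm_mul, norm_a, one_mul, dist_eq_norm]

/-- The action as an affine equivalence. -/
def aff (g : Mo) : ℂ →ᵃ[ℝ] ℂ where
  toFun z := g • z
  linear := LinearMap.mulLeft ℝ (g.a : ℂ)
  map_vadd' p v := by simp [smul_def]; ring

theorem aff_apply (g : Mo) (z : ℂ) : g.aff z = g • z := rfl

theorem aff_image (g : Mo) (Q : Set ℂ) : g.aff '' Q = g • Q := rfl

theorem smul_segment (g : Mo) (x y : ℂ) : g • segment ℝ x y = segment ℝ (g • x) (g • y) := by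
  rw [← aff_image, image_segment]; rfl

theorem smul_openSegment (g : Mo) (x y : ℂ) :
    g • openSegment ℝ x y = openSegment ℝ (g • x) (g • y) := by
  rw [← aff_image, image_openSegment]; rfl

theorem smul_convex (g : Mo) {Q : Set ℂ} (h : Convex ℝ Q) : Convex ℝ (g • Q) := by
  rw [← aff_image]; exact h.affine_image _

theorem smul_extremePoints (g : Mo) (Q : Set ℂ) :
    g • extremePoints ℝ Q = extremePoints ℝ (g • Q) := by
  have key : ∀ (g : Mo) (Q : Set ℂ), g • extremePoints ℝ Q ⊆ extremePoints ℝ (g • Q) := by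
    rintro g Q _ ⟨x, hx, rfl⟩
    rw [mem_extremePoints] at hx
    change g • x ∈ _
    rw [mem_extremePoints]
    refine ⟨smul_mem_smul_set hx.1, ?_⟩
    rintro _ ⟨p, hp, rfl⟩ _ ⟨q, hq, rfl⟩ h
    change g • x ∈ openSegment ℝ (g • p) (g • q) at h
    rw [← smul_openSegment, smul_mem_smul_set_iff] at h
    have := hx.2 p hp q hq h
    simp [this.1, this.2]
  apply Subset.antisymm (key g Q)
  have := key g⁻¹ (g • Q)
  rw [inv_smul_smul] at this
  rwa [Set.smul_set_subset_iff_subset_inv_smul_set, inv_inv] at this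

theorem smul_convexHull (g : Mo) (Q : Set ℂ) : g • convexHull ℝ Q = convexHull ℝ (g • Q) := by
  rw [← aff_image, ← aff_image, AffineMap.image_convexHull]

/-- translation -/
def tr (v : ℂ) : Mo := ⟨1, v⟩
theorem tr_smul (v z : ℂ) : tr v • z = z + v := by simp [smul_def, tr]

/-- point reflection -/
def refl (x : ℂ) : Mo := ⟨-1, 2 * x⟩
theorem refl_smul (x z : ℂ) : refl x • z = 2 * x - z := by
  simp [smul_def, refl]; ring

/-- rotation about a point -/
def rot (x : ℂ) (a : Circle) : Mo := ⟨a, x - a * x⟩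
theorem rot_smul (x z : ℂ) (a : Circle) : rot x a • z = x + a * (z - x) := by
  simp [smul_def, rot]; ring

theorem eq_rot {g : Mo} {x : ℂ} (h : g • x = x) : g = rot x g.a := by
  rw [smul_def] at h
  ext
  · rfl
  · simp only [rot]; linear_combination h

theorem eq_one {g : Mo} {x : ℂ} (h : g • x = x) (ha : g.a = 1) : g = 1 := by
  rw [smul_def, ha] at h
  ext
  · rw [ha]; rfl
  · simp at h; simp [h, one_b]

theorem eq_one_of_two {g : Mo} {x y : ℂ} (h : g • x = x) (h' : g • y = y) (hn : x ≠ y) :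
    g = 1 := by
  apply eq_one h
  have := smul_sub' g x y
  rw [h, h'] at this
  have h1 : (g.a : ℂ) = 1 := by
    have h2 : x - y ≠ 0 := sub_ne_zero.2 hn
    field_simp at this
    exact this.symm
  ext; simpa using h1

theorem ext_two {g h : Mo} {x y : ℂ} (h1 : g • x = h • x) (h2 : g • y = h • y) (hn : x ≠ y) :
    g = h := by
  have := eq_one_of_two (g := h⁻¹ * g) (x := x) (y := y) (by rw [mul_smul, h1, inv_smul_smul])
    (by rw [mul_smul, h2, inv_smul_smul]) hn
  rwa [inv_mul_eq_one, eq_comm] at this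

end Mo

/-- convex polygons in the complex plane -/
structure Pgon (P : Set ℂ) : Prop where
  comp : IsCompact P
  conv : Convex ℝ P
  ne : (interior P).Nonempty
  fin : (extremePoints ℝ P).Finite

theorem Pgon.smul {P : Set ℂ} (h : Pgon P) (g : Mo) : Pgon (g • P) where
  comp := h.comp.smul g
  conv := g.smul_convex h.conv
  ne := by rw [interior_smul]; exact h.ne.smul_set
  fin := by rw [← Mo.smul_extremePoints]; exact h.fin.smul_set

theorem Pgon.hull {P : Set ℂ} (h : Pgon P) : convexHull ℝ (extremePoints ℝ P) = P := by
  have := closure_convexHull_extremePoints h.comp h.conv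
  rwa [(h.fin.isCompact_convexHull (𝕜 := ℝ)).isClosed.closure_eq] at this

/-- corona -/
def Co (T : Set (Set ℂ)) (x : ℂ) : Set (Set ℂ) := {P | P ∈ T ∧ x ∈ P}

/-- vertex set -/
def Vx (T : Set (Set ℂ)) : Set ℂ := {x | ∃ P ∈ T, x ∈ extremePoints ℝ P}

structure Mono (T : Set (Set ℂ)) : Prop where
  poly : ∀ P ∈ T, Pgon P
  cov : ∀ z, ∃ P ∈ T, z ∈ P
  dis : ∀ P ∈ T, ∀ Q ∈ T, ∀ z, z ∈ interior P → z ∈ interior Q → P = Q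
  mono : ∀ x ∈ Vx T, ∀ y ∈ Vx T, ∃ g : Mo, g • x = y ∧ g • Co T x = Co T y


/-- cross product -/
def cr (a b : ℂ) : ℝ := a.re * b.im - a.im * b.re

theorem cr_add_right (a b c : ℂ) : cr a (b + c) = cr a b + cr a c := by simp [cr]; ring
theorem cr_add_left (a b c : ℂ) : cr (a + b) c = cr a c + cr b c := by simp [cr]; ring
theorem cr_sub_right (a b c : ℂ) : cr a (b - c) = cr a b - cr a c := by simp [cr]; ring
theorem cr_sub_left (a b c : ℂ) : cr (a - b) c = cr a c - cr b c := by simp [cr]; ring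
theorem cr_real_right (a b : ℂ) (t : ℝ) : cr a (t * b) = t * cr a b := by simp [cr]; ring
theorem cr_real_left (a b : ℂ) (t : ℝ) : cr (t * a) b = t * cr a b := by simp [cr]; ring
theorem cr_neg_right (a b : ℂ) : cr a (-b) = - cr a b := by simp [cr]; ring
theorem cr_neg_left (a b : ℂ) : cr (-a) b = - cr a b := by simp [cr]; ring
theorem cr_swap (a b : ℂ) : cr a b = - cr b a := by simp [cr]; ring
theorem cr_self (a : ℂ) : cr a a = 0 := by simp [cr]; ring
theorem cr_zero_right (a : ℂ) : cr a 0 = 0 := by simp [cr]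
theorem cr_zero_left (a : ℂ) : cr 0 a = 0 := by simp [cr]

theorem cr_mul (c a b : ℂ) : cr (c * a) (c * b) = Complex.normSq c * cr a b := by
  simp [cr, Complex.normSq_apply]; ring

theorem cr_circle (c : Circle) (a b : ℂ) : cr (c * a) (c * b) = cr a b := by
  rw [cr_mul, Complex.normSq_eq_norm_sq, Circle.norm_coe]; simp

theorem cr_I (a : ℂ) : cr a (Complex.I * a) = Complex.normSq a := by
  simp [cr, Complex.normSq_apply]

theorem cr_I_pos {a : ℂ} (h : a ≠ 0) : 0 < cr a (Complex.I * a) := by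
  rw [cr_I]; exact Complex.normSq_pos.2 h

theorem continuous_cr_right (a : ℂ) : Continuous (fun d => cr a d) := by
  unfold cr; fun_prop

theorem continuous_cr_left (a : ℂ) : Continuous (fun d => cr d a) := by
  unfold cr; fun_prop

/-- parallel vectors -/
theorem cr_eq_zero {a b : ℂ} (ha : a ≠ 0) (h : cr a b = 0) : ∃ t : ℝ, b = t * a := by
  have hn : Complex.normSq a ≠ 0 := by simpa using ha
  refine ⟨(a.re * b.re + a.im * b.im) / Complex.normSq a, ?_⟩
  unfold cr at h
  rw [Complex.normSq_apply] at *
  apply Complex.ext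
  · rw [Complex.re_ofReal_mul, div_mul_eq_mul_div, eq_div_iff hn]
    linear_combination (-a.im) * h
  · rw [Complex.im_ofReal_mul, div_mul_eq_mul_div, eq_div_iff hn]
    linear_combination (a.re) * h

theorem cr_decomp {r l : ℂ} (h : cr r l ≠ 0) (d : ℂ) :
    d = ((cr d l / cr r l : ℝ) : ℂ) * r + ((cr r d / cr r l : ℝ) : ℂ) * l := by
  unfold cr at *
  apply Complex.ext
  · rw [Complex.add_re, Complex.re_ofReal_mul, Complex.re_ofReal_mul, div_mul_eq_mul_div,
      div_mul_eq_mul_div, ← add_div, eq_div_iff h]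
    ring
  · rw [Complex.add_im, Complex.im_ofReal_mul, Complex.im_ofReal_mul, div_mul_eq_mul_div,
      div_mul_eq_mul_div, ← add_div, eq_div_iff h]
    ring

theorem cr_norm_eq {a b : ℂ} (ha : ‖a‖ = 1) (hb : ‖b‖ = 1) (h : cr a b = 0) : b = a ∨ b = -a := by
  have ha0 : a ≠ 0 := by intro h; simp [h] at ha
  obtain ⟨t, rfl⟩ := cr_eq_zero ha0 h
  rw [norm_mul, ha, mul_one, Complex.norm_real, Real.norm_eq_abs] at hb
  rcases eq_or_eq_neg_of_abs_eq hb with h | h <;> simp [h]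

theorem cr_ne_of_interior {Q : Set ℂ} (hQ : (interior Q).Nonempty) {a : ℂ} (ha : a ≠ 0) (x : ℂ) :
    ∃ q ∈ Q, cr a (q - x) ≠ 0 := by
  obtain ⟨q, hq⟩ := hQ
  by_contra! hcon
  have h1 : ∀ᶠ t : ℝ in nhds 0, q + t * (Complex.I * a) ∈ interior Q := by
    have : Continuous (fun t : ℝ => q + t * (Complex.I * a)) := by fun_prop
    apply this.continuousAt
    simpa using isOpen_interior.mem_nhds hq
  obtain ⟨ε, hε, h2⟩ := Metric.eventually_nhds_iff.1 h1
  have h3 := hcon _ (interior_subset (h2 (y := ε / 2) (by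
    simp [abs_of_pos hε]; linarith)))
  have h4 := hcon _ (interior_subset hq)
  rw [add_sub_right_comm, cr_add_right, h4, cr_real_right] at h3
  have := cr_I_pos ha
  have : ε / 2 ≠ 0 := by positivity
  simp_all

/-- tangent cone -/
def Kc (Q : Set ℂ) (x : ℂ) : Set ℂ := {d | ∃ ε : ℝ, 0 < ε ∧ x + ε * d ∈ Q}

/-- sector -/
def Sec (r l : ℂ) : Set ℂ := {d | 0 ≤ cr r d ∧ 0 ≤ cr d l}

theorem Kc_real {Q : Set ℂ} {x d : ℂ} (h : d ∈ Kc Q x) {t : ℝ} (ht : 0 < t) : (t : ℂ) * d ∈ Kc Q x := by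
  obtain ⟨ε, hε, h⟩ := h
  refine ⟨ε / t, by positivity, ?_⟩
  have : (t : ℂ) ≠ 0 := by exact_mod_cast ht.ne'
  convert h using 2
  push_cast; field_simp

theorem Kc_zero {Q : Set ℂ} {x : ℂ} (h : x ∈ Q) : (0 : ℂ) ∈ Kc Q x := ⟨1, one_pos, by simpa⟩

theorem Kc_sub {Q : Set ℂ} {x q : ℂ} (h : q ∈ Q) : q - x ∈ Kc Q x := ⟨1, one_pos, by simpa⟩

theorem Kc_small {Q : Set ℂ} (hQ : Convex ℝ Q) {x d : ℂ} (hx : x ∈ Q) {ε δ : ℝ} (hδ : 0 ≤ δ)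
    (hle : δ ≤ ε) (h : x + ε * d ∈ Q) : x + δ * d ∈ Q := by
  rcases hδ.eq_or_lt with rfl | hδ
  · simpa using hx
  have hε : 0 < ε := by linarith
  have := hQ.add_smul_mem (t := δ / ε) hx h ⟨by positivity, by rw [div_le_one hε]; exact hle⟩
  convert this using 2
  simp only [Complex.real_smul]
  have : (ε : ℂ) ≠ 0 := by exact_mod_cast hε.ne'
  push_cast; field_simp

theorem Kc_add {Q : Set ℂ} (hQ : Convex ℝ Q) {x d e : ℂ} (hx : x ∈ Q) (h : d ∈ Kc Q x)
    (h' : e ∈ Kc Q x) : d + e ∈ Kc Q x := by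
  obtain ⟨ε, hε, h⟩ := h
  obtain ⟨δ, hδ, h'⟩ := h'
  have h1 := Kc_small hQ hx (le_min hε.le hδ.le) (min_le_left _ _) h
  have h2 := Kc_small hQ hx (le_min hε.le hδ.le) (min_le_right _ _) h'
  refine ⟨min ε δ / 2, by positivity, ?_⟩
  have := hQ h1 h2 (a := 1 / 2) (b := 1 / 2) (by norm_num) (by norm_num) (by norm_num)
  convert this using 1
  simp only [Complex.real_smul]
  push_cast; ring

theorem Kc_nonneg {Q : Set ℂ} {x d : ℂ} (hx : x ∈ Q) (h : d ∈ Kc Q x) {t : ℝ} (ht : 0 ≤ t) :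
    (t : ℂ) * d ∈ Kc Q x := by
  rcases ht.eq_or_lt with rfl | ht
  · simpa using Kc_zero hx
  · exact Kc_real h ht

theorem Kc_convex {Q : Set ℂ} (hQ : Convex ℝ Q) {x : ℂ} (hx : x ∈ Q) : Convex ℝ (Kc Q x) := by
  intro d hd e he a b ha hb _
  simp only [Complex.real_smul]
  exact Kc_add hQ hx (Kc_nonneg hx hd ha) (Kc_nonneg hx he hb)

theorem Sec_convex (r l : ℂ) : Convex ℝ (Sec r l) := by
  intro d hd e he a b ha hb _
  simp only [Complex.real_smul, Sec, mem_ofPred_eq, cr_add_right, cr_add_left, cr_real_left,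
    cr_real_right] at *
  exact ⟨add_nonneg (mul_nonneg ha hd.1) (mul_nonneg hb he.1),
    add_nonneg (mul_nonneg ha hd.2) (mul_nonneg hb he.2)⟩

theorem Sec_real {r l d : ℂ} {t : ℝ} (ht : 0 < t) : (t : ℂ) * d ∈ Sec r l ↔ d ∈ Sec r l := by
  simp only [Sec, mem_ofPred_eq, cr_real_left, cr_real_right, mul_nonneg_iff_of_pos_left ht]

structure IsSec (Q : Set ℂ) (x r l : ℂ) : Prop where
  nr : ‖r‖ = 1
  nl : ‖l‖ = 1
  pos : 0 < cr r l ∨ l = -r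
  eq : Kc Q x = Sec r l
  er : ∃ t : ℝ, 0 < t ∧ x + t * r ∈ extremePoints ℝ Q
  el : ∃ t : ℝ, 0 < t ∧ x + t * l ∈ extremePoints ℝ Q

theorem arg_sep {a b : ℂ} (ha : 0 ≤ a.im) (_ : 0 ≤ b.im) (h : a.arg ≤ b.arg) : 0 ≤ cr a b := by
  have h1 := Complex.norm_mul_cos_arg a
  have h2 := Complex.norm_mul_sin_arg a
  have h3 := Complex.norm_mul_cos_arg b
  have h4 := Complex.norm_mul_sin_arg b
  have h5 : 0 ≤ Real.sin (b.arg - a.arg) := by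
    apply Real.sin_nonneg_of_nonneg_of_le_pi (by linarith)
    have := Complex.arg_nonneg_iff.2 ha
    have := Complex.arg_le_pi b
    linarith
  have : cr a b = ‖a‖ * ‖b‖ * Real.sin (b.arg - a.arg) := by
    rw [cr, ← h1, ← h2, ← h3, ← h4, Real.sin_sub]; ring
  rw [this]; positivity

/-- rightmost and leftmost vectors in a half plane -/
theorem exists_rl {S : Set ℂ} (hS : S.Finite) (hne : S.Nonempty) {e : ℂ} (he : e ≠ 0)
    (h : ∀ s ∈ S, 0 ≤ cr e s) : ∃ r ∈ S, ∃ l ∈ S, ∀ s ∈ S, 0 ≤ cr r s ∧ 0 ≤ cr s l := by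
  have hn : 0 < Complex.normSq e := Complex.normSq_pos.2 he
  have key : ∀ s ∈ S, 0 ≤ (s / e).im := by
    intro s hs
    have h1 : cr e s = Complex.normSq e * (s / e).im := by
      have : cr e s = cr (e * 1) (e * (s / e)) := by congr 1 <;> field_simp
      rw [this, cr_mul]; simp [cr]
    have := h s hs
    rw [h1] at this
    exact nonneg_of_mul_nonneg_right this hn
  have key2 : ∀ s ∈ S, ∀ t ∈ S, (s / e).arg ≤ (t / e).arg → 0 ≤ cr s t := by
    intro s hs t ht hst
    have h1 : cr s t = Complex.normSq e * cr (s / e) (t / e) := by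
      rw [← cr_mul]; congr 1 <;> field_simp
    rw [h1]
    exact mul_nonneg hn.le (arg_sep (key s hs) (key t ht) hst)
  obtain ⟨r, hr, hr'⟩ := Set.exists_min_image S (fun s => (s / e).arg) hS hne
  obtain ⟨l, hl, hl'⟩ := Set.exists_max_image S (fun s => (s / e).arg) hS hne
  exact ⟨r, hr, l, hl, fun s hs => ⟨key2 _ hr _ hs (hr' s hs), key2 _ hs _ hl (hl' s hs)⟩⟩

theorem exists_support {Q : Set ℂ} (hQ : Pgon Q) {x : ℂ} (hx : x ∉ interior Q) :
    ∃ e : ℂ, e ≠ 0 ∧ ∀ q ∈ Q, 0 ≤ cr e (q - x) := by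
  obtain ⟨f, hf⟩ := geometric_hahn_banach_open_point hQ.conv.interior isOpen_interior hx
  have hcl : ∀ q ∈ Q, f q ≤ f x := by
    have h1 : Q ⊆ closure (interior Q) := by
      rw [hQ.conv.closure_interior_eq_closure_of_nonempty_interior hQ.ne]; exact subset_closure
    intro q hq
    have : closure (interior Q) ⊆ {q | f q ≤ f x} := by
      apply closure_minimal
      · intro q hq; exact (hf q hq).le
      · exact isClosed_le f.continuous continuous_const
    exact this (h1 hq)
  have hfd : ∀ d, cr ⟨-f Complex.I, f 1⟩ d = - f d := by
    intro d
    have : d = d.re • (1 : ℂ) + d.im • Complex.I := by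
      simp only [Complex.real_smul, mul_one]; exact (Complex.re_add_im d).symm
    conv_rhs => rw [this, map_add, map_smul, map_smul]
    simp [cr]; ring
  refine ⟨⟨-f Complex.I, f 1⟩, ?_, ?_⟩
  · intro h0
    obtain ⟨q, hq⟩ := hQ.ne
    have h1 := hfd (q - x)
    rw [h0, cr_zero_left, map_sub] at h1
    have := hf q hq
    linarith
  · intro q hq
    rw [hfd, map_sub]
    have := hcl q hq
    linarith

theorem hull_half {S : Set ℂ} {x a : ℂ} (h : ∀ s ∈ S, 0 ≤ cr a (s - x)) :
    ∀ q ∈ convexHull ℝ S, 0 ≤ cr a (q - x) := by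
  intro q hq
  have : convexHull ℝ S ⊆ {q | 0 ≤ cr a (q - x)} := by
    refine convexHull_min (fun s hs => h s hs) ?_
    intro d hd e he s t hs ht hst
    rw [mem_ofPred_eq] at hd he ⊢
    simp only [Complex.real_smul]
    have : (s : ℂ) * d + t * e - x = s * (d - x) + t * (e - x) := by
      have : (s : ℂ) + t = 1 := by exact_mod_cast hst
      linear_combination x * this
    rw [this, cr_add_right, cr_real_right, cr_real_right]
    positivity
  exact this hq

theorem exists_sec {Q : Set ℂ} (hQ : Pgon Q) {x : ℂ} (hxQ : x ∈ Q) (hx : x ∉ interior Q) :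
    ∃ r l, IsSec Q x r l := by
  obtain ⟨e, he, hsup⟩ := exists_support hQ hx
  set S : Set ℂ := (fun v => v - x) '' (extremePoints ℝ Q \ {x}) with hS
  have hfin : S.Finite := (hQ.fin.subset sdiff_subset).image _
  have hSK : ∀ s ∈ S, s ∈ Kc Q x := by
    rintro _ ⟨v, hv, rfl⟩
    exact Kc_sub (extremePoints_subset hv.1)
  have hS0 : ∀ s ∈ S, s ≠ 0 := by
    rintro _ ⟨v, hv, rfl⟩
    exact sub_ne_zero.2 hv.2
  have hex : ∀ a : ℂ, a ≠ 0 → ∃ s ∈ S, cr a s ≠ 0 := by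
    intro a ha
    by_contra! hcon
    obtain ⟨q, hq, hq'⟩ := cr_ne_of_interior hQ.ne ha x
    have h0 : ∀ v ∈ extremePoints ℝ Q, cr a (v - x) = 0 := by
      intro v hv
      by_cases h : v = x
      · simp [h, cr_zero_right]
      · exact hcon _ ⟨v, ⟨hv, h⟩, rfl⟩
    rw [← hQ.hull] at hq
    have h1 := hull_half (a := a) (x := x) (fun v hv => (h0 v hv).ge) q hq
    have h2 := hull_half (a := -a) (x := x) (fun v hv => by rw [cr_neg_left, h0 v hv]; simp) q hq
    rw [cr_neg_left] at h2
    exact hq' (by linarith)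
  have hne : S.Nonempty := by
    obtain ⟨s, hs, _⟩ := hex e he
    exact ⟨s, hs⟩
  obtain ⟨r, hr, l, hl, hrl⟩ := exists_rl hfin hne he (by
    rintro _ ⟨v, hv, rfl⟩
    exact hsup v (extremePoints_subset hv.1))
  have hr0 := hS0 r hr
  have hl0 := hS0 l hl
  have hnr : 0 < ‖r‖ := norm_pos_iff.2 hr0
  have hnl : 0 < ‖l‖ := norm_pos_iff.2 hl0
  have hsub : Kc Q x ⊆ Sec r l := by
    rintro d ⟨ε, hε, hd⟩
    rw [← hQ.hull] at hd
    have h0 : ∀ v ∈ extremePoints ℝ Q, 0 ≤ cr r (v - x) ∧ 0 ≤ cr (v - x) l := by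
      intro v hv
      by_cases h : v = x
      · simp [h, cr_zero_right, cr_zero_left]
      · exact hrl _ ⟨v, ⟨hv, h⟩, rfl⟩
    have h1 := hull_half (a := r) (x := x) (fun v hv => (h0 v hv).1) _ hd
    have h2 := hull_half (a := -l) (x := x) (fun v hv => by
      rw [cr_neg_left, ← cr_swap]; exact (h0 v hv).2) _ hd
    rw [cr_neg_left, ← cr_swap] at h2
    rw [add_sub_cancel_left] at h1 h2
    exact (Sec_real hε).1 ⟨h1, h2⟩
  have hpos : 0 < cr r l ∨ ∃ k : ℝ, 0 < k ∧ l = -(k * r) := by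
    rcases (hrl r hr).2.lt_or_eq with h | h
    · exact Or.inl h
    · right
      obtain ⟨k, hk⟩ := cr_eq_zero hr0 h.symm
      rcases lt_trichotomy k 0 with h' | h' | h'
      · exact ⟨-k, by linarith, by rw [hk]; push_cast; ring⟩
      · simp [h'] at hk; exact absurd hk hl0
      · exfalso
        obtain ⟨s, hs, hs'⟩ := hex r hr0
        have h1 := hrl s hs
        rw [hk, cr_real_right, cr_swap s r] at h1
        have h2 : 0 < cr r s := lt_of_le_of_ne h1.1 (Ne.symm hs')
        nlinarith [h1.2, mul_pos h' h2]
  have hsup2 : Sec r l ⊆ Kc Q x := by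
    intro d hd
    rcases hpos with h | ⟨k, hk, hl'⟩
    · rw [cr_decomp h.ne' d]
      exact Kc_add hQ.conv hxQ (Kc_nonneg hxQ (hSK r hr) (div_nonneg hd.2 h.le))
        (Kc_nonneg hxQ (hSK l hl) (div_nonneg hd.1 h.le))
    · obtain ⟨s, hs, hs'⟩ := hex r hr0
      have h2 : 0 < cr r s := lt_of_le_of_ne (hrl s hs).1 (Ne.symm hs')
      have h3 : cr r (d - ((cr r d / cr r s : ℝ) : ℂ) * s) = 0 := by
        rw [cr_sub_right, cr_real_right]; field_simp; simp
      obtain ⟨t, ht⟩ := cr_eq_zero hr0 h3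
      have hd' : d = ((cr r d / cr r s : ℝ) : ℂ) * s + t * r := by rw [← ht]; ring
      rw [hd']
      apply Kc_add hQ.conv hxQ (Kc_nonneg hxQ (hSK s hs) (div_nonneg hd.1 h2.le))
      rcases le_total 0 t with h | h
      · exact Kc_nonneg hxQ (hSK r hr) h
      · have : (t : ℂ) * r = ((-t / k : ℝ) : ℂ) * l := by
          have : (k : ℂ) ≠ 0 := by exact_mod_cast hk.ne'
          rw [hl']; push_cast; field_simp
        rw [this]
        exact Kc_nonneg hxQ (hSK l hl) (div_nonneg (by linarith) hk.le)
  have hr1 : (‖r‖ : ℂ) ≠ 0 := by exact_mod_cast hnr.ne'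
  have hl1 : (‖l‖ : ℂ) ≠ 0 := by exact_mod_cast hnl.ne'
  have e1 : ((‖r‖⁻¹ : ℝ) : ℂ) * r = r / ‖r‖ := by push_cast; field_simp
  have e2 : ((‖l‖⁻¹ : ℝ) : ℂ) * l = l / ‖l‖ := by push_cast; field_simp
  refine ⟨((‖r‖⁻¹ : ℝ) : ℂ) * r, ((‖l‖⁻¹ : ℝ) : ℂ) * l, ?_, ?_, ?_, ?_, ?_, ?_⟩
  · rw [norm_mul, Complex.norm_real, Real.norm_eq_abs, abs_of_pos (by positivity)]; field_simp
  · rw [norm_mul, Complex.norm_real, Real.norm_eq_abs, abs_of_pos (by positivity)]; field_simp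
  · rcases hpos with h | ⟨k, hk, hl'⟩
    · left; rw [cr_real_left, cr_real_right]; positivity
    · right
      have : ‖l‖ = k * ‖r‖ := by rw [hl', norm_neg, norm_mul, Complex.norm_real,
        Real.norm_eq_abs, abs_of_pos hk]
      have hk0 : (k : ℂ) ≠ 0 := by exact_mod_cast hk.ne'
      rw [e1, e2, this, hl']; push_cast; field_simp
  · rw [Subset.antisymm hsub hsup2]
    ext d
    simp only [Sec, mem_ofPred_eq, cr_real_left, cr_real_right]
    rw [mul_nonneg_iff_of_pos_left (inv_pos.2 hnr), mul_nonneg_iff_of_pos_left (inv_pos.2 hnl)]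
  · obtain ⟨v, hv, hv'⟩ := hr
    refine ⟨‖r‖, hnr, ?_⟩
    rw [e1, mul_div_cancel₀ _ hr1, ← hv']; simpa using hv.1
  · obtain ⟨v, hv, hv'⟩ := hl
    refine ⟨‖l‖, hnl, ?_⟩
    rw [e2, mul_div_cancel₀ _ hl1, ← hv']; simpa using hv.1

theorem IsSec.r0 {Q : Set ℂ} {x r l : ℂ} (h : IsSec Q x r l) : r ≠ 0 := by
  rintro rfl; simpa using h.nr
theorem IsSec.l0 {Q : Set ℂ} {x r l : ℂ} (h : IsSec Q x r l) : l ≠ 0 := by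
  rintro rfl; simpa using h.nl

theorem IsSec.le {Q : Set ℂ} {x r l : ℂ} (h : IsSec Q x r l) : 0 ≤ cr r l := by
  rcases h.pos with h | h
  · exact h.le
  · rw [h, cr_neg_right, cr_self]; simp

theorem IsSec.r_mem {Q : Set ℂ} {x r l : ℂ} (h : IsSec Q x r l) : r ∈ Kc Q x := by
  rw [h.eq]; exact ⟨by rw [cr_self], h.le⟩
theorem IsSec.l_mem {Q : Set ℂ} {x r l : ℂ} (h : IsSec Q x r l) : l ∈ Kc Q x := by
  rw [h.eq]; exact ⟨h.le, by rw [cr_self]⟩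

theorem Sec_inj_aux {r l r' l' : ℂ} (hr : ‖r‖ = 1) (hr' : ‖r'‖ = 1) 
    (hp : 0 < cr r l ∨ l = -r) (hp' : 0 < cr r' l' ∨ l' = -r')
    (h : Sec r l = Sec r' l') : r = r' := by
  have r0 : r ≠ 0 := by rintro rfl; simp at hr
  have hm : r ∈ Sec r l := by
    refine ⟨by rw [cr_self], ?_⟩
    rcases hp with h | h
    · exact h.le
    · rw [h, cr_neg_right, cr_self]; simp
  have hm' : r' ∈ Sec r' l' := by
    refine ⟨by rw [cr_self], ?_⟩
    rcases hp' with h | h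
    · exact h.le
    · rw [h, cr_neg_right, cr_self]; simp
  rw [h] at hm; rw [← h] at hm'
  have h0 : cr r r' = 0 := by
    have := hm.1; have h2 := hm'.1; rw [cr_swap] at this; linarith
  rcases cr_norm_eq hr hr' h0 with h1 | h1
  · exact h1.symm
  · exfalso
    have h2 := hm.2; have h3 := hm'.2
    rw [h1, cr_neg_left] at h3
    rw [h1] at hp'
    have hl : l = -r := by rcases hp with h | h; linarith; exact h
    have hl' : l' = r := by
      rcases hp' with h | h
      · rw [cr_neg_left] at h; linarith
      · simpa using h
    have : Complex.I * r ∈ Sec r l := by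
      have := cr_I_pos r0
      refine ⟨this.le, ?_⟩
      rw [hl, cr_neg_right, ← cr_swap]; exact this.le
    rw [h, h1, hl'] at this
    have h4 := this.1
    rw [cr_neg_left] at h4
    have := cr_I_pos r0
    linarith

theorem IsSec.unique {Q Q' : Set ℂ} {x x' r l r' l' : ℂ} (h : IsSec Q x r l) (h' : IsSec Q' x' r' l')
    (he : Kc Q x = Kc Q' x') : r = r' ∧ l = l' := by
  rw [h.eq, h'.eq] at he
  have hr := Sec_inj_aux h.nr h'.nr h.pos h'.pos he
  refine ⟨hr, ?_⟩
  subst hr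
  have hm : l ∈ Sec r l' := by rw [← he]; exact ⟨h.le, by rw [cr_self]⟩
  have hm' : l' ∈ Sec r l := by rw [he]; exact ⟨h'.le, by rw [cr_self]⟩
  have h0 : cr l l' = 0 := by
    have := hm.2; have h2 := hm'.2; rw [cr_swap] at h2; linarith
  rcases cr_norm_eq h.nl h'.nl h0 with h1 | h1
  · exact h1.symm
  · have h2 := h.le; have h3 := h'.le
    rw [h1, cr_neg_right] at h3
    rcases h.pos with h4 | h4
    · linarith
    · rcases h'.pos with h5 | h5
      · rw [h1, cr_neg_right] at h5; linarith
      · rw [h4, h5]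

theorem Kc_smul (g : Mo) (Q : Set ℂ) (x d : ℂ) : (g.a : ℂ) * d ∈ Kc (g • Q) (g • x) ↔ d ∈ Kc Q x := by
  have : ∀ ε : ℝ, g • x + ε * (g.a * d) = g • (x + ε * d) := by
    intro ε; simp only [Mo.smul_def]; ring
  simp only [Kc, mem_ofPred_eq, this, smul_mem_smul_set_iff]

theorem IsSec.smul {Q : Set ℂ} {x r l : ℂ} (h : IsSec Q x r l) (g : Mo) :
    IsSec (g • Q) (g • x) (g.a * r) (g.a * l) where
  nr := by rw [norm_mul, Mo.norm_a, h.nr, one_mul]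
  nl := by rw [norm_mul, Mo.norm_a, h.nl, one_mul]
  pos := by
    rw [cr_circle]
    rcases h.pos with h | h
    · exact Or.inl h
    · right; rw [h]; ring
  eq := by
    ext d
    have : d = g.a * ((g.a⁻¹ : Circle) * d) := by
      rw [← mul_assoc, ← Circle.coe_mul]; simp
    rw [this, Kc_smul, h.eq]
    simp only [Sec, mem_ofPred_eq, cr_circle]
  er := by
    obtain ⟨t, ht, h⟩ := h.er
    refine ⟨t, ht, ?_⟩
    rw [← Mo.smul_extremePoints]
    convert smul_mem_smul_set (a := g) h using 1
    simp only [Mo.smul_def]; ring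
  el := by
    obtain ⟨t, ht, h⟩ := h.el
    refine ⟨t, ht, ?_⟩
    rw [← Mo.smul_extremePoints]
    convert smul_mem_smul_set (a := g) h using 1
    simp only [Mo.smul_def]; ring

theorem ext_notMem_interior {Q : Set ℂ} {x : ℂ} (h : x ∈ extremePoints ℝ Q) : x ∉ interior Q := by
  intro hx
  have h1 : ∀ᶠ t : ℝ in nhds 0, x + t * 1 ∈ Q ∧ x - t * 1 ∈ Q := by
    apply Filter.Eventually.and
    · have : Continuous (fun t : ℝ => x + t * 1) := by fun_prop
      apply this.continuousAt
      simpa using mem_interior_iff_mem_nhds.1 hx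
    · have : Continuous (fun t : ℝ => x - t * 1) := by fun_prop
      apply this.continuousAt
      simpa using mem_interior_iff_mem_nhds.1 hx
  obtain ⟨ε, hε, h2⟩ := Metric.eventually_nhds_iff.1 h1
  have h3 := h2 (y := ε / 2) (by simp [abs_of_pos hε]; linarith)
  rw [mem_extremePoints] at h
  have h4 := (h.2 _ h3.1 _ h3.2 ⟨1/2, 1/2, by norm_num, by norm_num, by norm_num, by
    simp only [Complex.real_smul]; push_cast; ring⟩).1
  have : (ε : ℂ) ≠ 0 := by exact_mod_cast hε.ne'
  simp [this] at h4

theorem IsSec.ext_iff {Q : Set ℂ} (hQ : Convex ℝ Q) {x r l : ℂ} (hx : x ∈ Q) (h : IsSec Q x r l) :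
    x ∈ extremePoints ℝ Q ↔ 0 < cr r l := by
  constructor
  · intro he
    rcases h.pos with h' | h'
    · exact h'
    · exfalso
      obtain ⟨ε, hε, h1⟩ := h.r_mem
      obtain ⟨δ, hδ, h2⟩ := h.l_mem
      have h1 := Kc_small hQ hx (le_min hε.le hδ.le) (min_le_left _ _) h1
      have h2 := Kc_small hQ hx (le_min hε.le hδ.le) (min_le_right _ _) h2
      rw [mem_extremePoints] at he
      have h4 := (he.2 _ h1 _ h2 ⟨1/2, 1/2, by norm_num, by norm_num, by norm_num, by
        simp only [Complex.real_smul]; rw [h']; push_cast; ring⟩).1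
      have : (min ε δ : ℝ) ≠ 0 := by positivity
      have : ((min ε δ : ℝ) : ℂ) ≠ 0 := by exact_mod_cast this
      have h5 := h.r0
      simp_all
  · intro hp
    rw [mem_extremePoints]
    refine ⟨hx, ?_⟩
    rintro p hp' q hq ⟨s, t, hs, ht, hst, hx'⟩
    have h1 : p - x ∈ Sec r l := by rw [← h.eq]; exact Kc_sub hp'
    have h2 : q - x ∈ Sec r l := by rw [← h.eq]; exact Kc_sub hq
    have h3 : (s : ℂ) * (p - x) + t * (q - x) = 0 := by
      simp only [Complex.real_smul] at hx'
      have : (s : ℂ) + t = 1 := by exact_mod_cast hst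
      linear_combination hx' - x * this
    have h4 := congrArg (cr r) h3
    have h5 := congrArg (fun d => cr d l) h3
    simp only [cr_add_right, cr_add_left, cr_real_left, cr_real_right, cr_zero_left,
      cr_zero_right] at h4 h5
    have a1 := h1.1; have a2 := h1.2; have a3 := h2.1; have a4 := h2.2
    have b1 : cr r (p - x) = 0 := by nlinarith [mul_nonneg hs.le a1, mul_nonneg ht.le a3]
    have b2 : cr (p - x) l = 0 := by nlinarith [mul_nonneg hs.le a2, mul_nonneg ht.le a4]
    have b3 : cr r (q - x) = 0 := by nlinarith [mul_nonneg hs.le a1, mul_nonneg ht.le a3]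
    have b4 : cr (q - x) l = 0 := by nlinarith [mul_nonneg hs.le a2, mul_nonneg ht.le a4]
    have c1 := cr_decomp hp.ne' (p - x)
    have c2 := cr_decomp hp.ne' (q - x)
    rw [b1, b2] at c1
    rw [b3, b4] at c2
    simp at c1 c2
    exact ⟨sub_eq_zero.1 c1, sub_eq_zero.1 c2⟩

theorem IsSec.not_ext {Q : Set ℂ} (hQ : Convex ℝ Q) {x r l : ℂ} (hx : x ∈ Q) (h : IsSec Q x r l)
    (he : x ∉ extremePoints ℝ Q) : l = -r := by
  rcases h.pos with h' | h'
  · exact absurd ((h.ext_iff hQ hx).2 h') he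
  · exact h'

theorem interior_Kc {Q : Set ℂ} (hQ : Pgon Q) {x d : ℂ} (hx : x ∈ Q) (hd : d ∈ interior (Kc Q x)) :
    ∃ ε : ℝ, 0 < ε ∧ ∀ δ : ℝ, 0 < δ → δ ≤ ε → x + δ * d ∈ interior Q := by
  obtain ⟨q, hq⟩ := hQ.ne
  have h1 : ∀ᶠ t : ℝ in nhds 0, d - t * (q - x) ∈ interior (Kc Q x) := by
    have : Continuous (fun t : ℝ => d - t * (q - x)) := by fun_prop
    apply this.continuousAt
    simpa using isOpen_interior.mem_nhds hd
  obtain ⟨τ, hτ, h2⟩ := Metric.eventually_nhds_iff.1 h1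
  obtain ⟨ε, hε, h3⟩ := interior_subset (h2 (y := τ / 2) (by simp [abs_of_pos hτ]; linarith))
  have hm : 0 < min ε (2 / τ) := by positivity
  refine ⟨min ε (2 / τ) / 2, by positivity, ?_⟩
  intro δ hδ hle
  have e1 := min_le_left ε (2 / τ)
  have e2 := min_le_right ε (2 / τ)
  have h4 : x + (2 * δ : ℝ) * (d - (τ / 2 : ℝ) * (q - x)) ∈ Q :=
    Kc_small hQ.conv hx (by positivity) (by linarith) h3
  have h6 : 2 * δ * (τ / 2) ≤ 1 := by
    have : 2 * δ ≤ 2 / τ := by linarith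
    calc 2 * δ * (τ / 2) ≤ 2 / τ * (τ / 2) := by gcongr
      _ = 1 := by field_simp
  have h5 : x + (2 * δ * (τ / 2) : ℝ) • (q - x) ∈ interior Q :=
    hQ.conv.add_smul_sub_mem_interior hx hq ⟨by positivity, h6⟩
  have := hQ.conv.combo_self_interior_mem_interior h4 h5 (a := 1/2) (b := 1/2) (by norm_num) (by norm_num)
    (by norm_num)
  convert this using 1
  simp only [Complex.real_smul]
  push_cast; ring


/-- angular measure -/
def am (A : Set ℂ) : ℝ := 2 * (volume : Measure ℂ).real (A ∩ Metric.ball 0 1)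

theorem fin_ball (A : Set ℂ) : (volume : Measure ℂ) (A ∩ Metric.ball 0 1) ≠ ⊤ :=
  ne_top_of_le_ne_top measure_ball_lt_top.ne (measure_mono inter_subset_right)

theorem null_ball {A : Set ℂ} (h : Convex ℝ A) :
    NullMeasurableSet (A ∩ Metric.ball 0 1) (volume : Measure ℂ) :=
  (h.inter (convex_ball 0 1)).nullMeasurableSet _

theorem am_nonneg (A : Set ℂ) : 0 ≤ am A := by unfold am; positivity

theorem am_univ : am univ = 2 * Real.pi := by
  simp [am, Measure.real, Complex.volume_ball]

theorem am_cover {ι : Type*} (s : Finset ι) (f : ι → Set ℂ) (hc : ∀ i ∈ s, Convex ℝ (f i))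
    (hd : ∀ i ∈ s, ∀ j ∈ s, i ≠ j → (volume : Measure ℂ) (f i ∩ f j) = 0) :
    am (⋃ i ∈ s, f i) = ∑ i ∈ s, am (f i) := by
  unfold am
  rw [iUnion₂_inter, measureReal_biUnion_finset₀, Finset.mul_sum]
  · intro i hi j hj hij
    exact measure_mono_null (by intro x hx; exact ⟨hx.1.1, hx.2.1⟩) (hd i hi j hj hij)
  · intro i hi; exact null_ball (hc i hi)

theorem am_union {A B : Set ℂ} (hB : Convex ℝ B)
    (h : (volume : Measure ℂ) (A ∩ B) = 0) : am (A ∪ B) = am A + am B := by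
  unfold am
  rw [union_inter_distrib_right, measureReal_union₀ (null_ball hB) _ (fin_ball _) (fin_ball _),
    mul_add]
  exact measure_mono_null (by intro x hx; exact ⟨hx.1.1, hx.2.1⟩) h

theorem am_rot (a : Circle) {A B : Set ℂ} (h : ∀ d : ℂ, (a : ℂ) * d ∈ B ↔ d ∈ A) : am B = am A := by
  unfold am
  have h1 := (rotation a).measurePreserving
  have h2 : (rotation a) ⁻¹' (B ∩ Metric.ball 0 1) = A ∩ Metric.ball 0 1 := by
    ext d
    rw [mem_preimage, mem_inter_iff, mem_inter_iff, rotation_apply, h, mem_ball_zero_iff,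
      mem_ball_zero_iff, norm_mul, Circle.norm_coe, one_mul]
  have h3 := h1.measure_preimage_equiv (f := (rotation a).toHomeomorph.toMeasurableEquiv) (B ∩ Metric.ball 0 1)
  have h4 : (volume : Measure ℂ) (A ∩ Metric.ball 0 1) = volume (B ∩ Metric.ball 0 1) := by
    rw [← h2]; exact h3
  simp [Measure.real, h4]

theorem am_pos {A : Set ℂ} (h : ∃ d ∈ interior A, ‖d‖ < 1) : 0 < am A := by
  obtain ⟨d, hd, hd'⟩ := h
  unfold am
  apply mul_pos two_pos
  rw [measureReal_def]
  apply ENNReal.toReal_pos _ (fin_ball _)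
  apply ne_of_gt
  apply lt_of_lt_of_le _ (measure_mono (inter_subset_inter_left _ interior_subset))
  exact (isOpen_interior.inter Metric.isOpen_ball).measure_pos _ ⟨d, hd, by simpa using hd'⟩

theorem null_line {a : ℂ} (ha : a ≠ 0) : (volume : Measure ℂ) {d | cr a d = 0} = 0 := by
  let s : Submodule ℝ ℂ :=
    { carrier := {d | cr a d = 0}
      zero_mem' := cr_zero_right a
      add_mem' := by
        intro x y hx hy
        rw [mem_ofPred_eq] at *
        rw [cr_add_right, hx, hy, add_zero]
      smul_mem' := by
        intro t x hx
        rw [mem_ofPred_eq] at *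
        rw [Complex.real_smul, cr_real_right, hx, mul_zero] }
  have := Measure.addHaar_submodule (volume : Measure ℂ) s (by
    intro h
    have h1 : Complex.I * a ∈ s := by rw [h]; trivial
    have h2 : cr a (Complex.I * a) = 0 := h1
    exact (cr_I_pos ha).ne' h2)
  exact this

theorem half_convex (a : ℂ) : Convex ℝ {d | 0 ≤ cr a d} := by
  intro d hd e he s t hs ht hst
  rw [mem_ofPred_eq] at *
  rw [Complex.real_smul, Complex.real_smul, cr_add_right, cr_real_right, cr_real_right]
  positivity

theorem am_half {a : ℂ} (ha : a ≠ 0) : am {d | 0 ≤ cr a d} = Real.pi := by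
  have h1 : am {d | 0 ≤ cr (-a) d} = am {d | 0 ≤ cr a d} := by
    apply am_rot (-1)
    intro d
    simp only [mem_ofPred_eq]
    have : ((-1 : Circle) : ℂ) * d = -d := by simp
    rw [this, cr_neg_left, cr_neg_right, neg_neg]
  have h2 : am ({d | 0 ≤ cr a d} ∪ {d | 0 ≤ cr (-a) d}) = 2 * Real.pi := by
    rw [← am_univ]; congr 1
    ext d
    simp only [mem_union, mem_ofPred_eq, cr_neg_left, mem_univ, iff_true]
    rcases le_total 0 (cr a d) with h | h
    · left; exact h
    · right; linarith
  rw [am_union (half_convex _), h1] at h2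
  · linarith
  · apply measure_mono_null _ (null_line ha)
    rintro d ⟨h, h'⟩
    rw [mem_ofPred_eq] at *
    rw [cr_neg_left] at h'
    linarith

/-- angle of a tile at a point -/
def th (Q : Set ℂ) (x : ℂ) : ℝ := am (Kc Q x)

theorem th_smul (g : Mo) (Q : Set ℂ) (x : ℂ) : th (g • Q) (g • x) = th Q x :=
  am_rot g.a (Kc_smul g Q x)

theorem th_interior {Q : Set ℂ} {x : ℂ} (h : x ∈ interior Q) : th Q x = 2 * Real.pi := by
  rw [th, ← am_univ]; congr 1
  ext d
  simp only [mem_univ, iff_true]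
  have h1 : ∀ᶠ t : ℝ in nhds 0, x + t * d ∈ interior Q := by
    have : Continuous (fun t : ℝ => x + t * d) := by fun_prop
    apply this.continuousAt
    simpa using isOpen_interior.mem_nhds h
  obtain ⟨τ, hτ, h2⟩ := Metric.eventually_nhds_iff.1 h1
  exact ⟨τ / 2, by positivity, interior_subset (h2 (by simp [abs_of_pos hτ]; linarith))⟩

theorem th_pos {Q : Set ℂ} (hQ : Pgon Q) {x : ℂ} (hx : x ∈ Q) : 0 < th Q x := by
  by_cases hi : x ∈ interior Q
  · rw [th_interior hi]; positivity
  obtain ⟨q, hq⟩ := hQ.ne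
  apply am_pos
  have h0 : 0 < ‖q - x‖ := norm_pos_iff.2 (sub_ne_zero.2 (by rintro rfl; exact hi hq))
  have h1 : q - x ∈ interior (Kc Q x) := by
    apply mem_interior.2
    refine ⟨(fun d => x + d) ⁻¹' (interior Q), ?_, ?_, ?_⟩
    · intro d hd
      have := Kc_sub (x := x) (interior_subset hd)
      simpa using this
    · exact isOpen_interior.preimage (by fun_prop)
    · simpa using hq
  refine ⟨((2 * ‖q - x‖)⁻¹ : ℝ) * (q - x), ?_, ?_⟩
  · have hc : 0 < (2 * ‖q - x‖)⁻¹ := by positivity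
    have hK := Kc_zero hx
    rw [mem_interior] at h1 ⊢
    obtain ⟨U, hU, hUo, hm⟩ := h1
    refine ⟨(fun d : ℂ => ((2 * ‖q - x‖ : ℝ) : ℂ) * d) ⁻¹' U, ?_, hUo.preimage (by fun_prop), ?_⟩
    · intro d hd
      have := Kc_real (hU hd) hc
      rwa [← mul_assoc, ← Complex.ofReal_mul, inv_mul_cancel₀ (by positivity), Complex.ofReal_one,
        one_mul] at this
    · rw [mem_preimage, ← mul_assoc, ← Complex.ofReal_mul, mul_inv_cancel₀ (by positivity),
        Complex.ofReal_one, one_mul]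
      exact hm
  · rw [norm_mul, Complex.norm_real, Real.norm_eq_abs, abs_of_pos (by positivity)]
    field_simp; norm_num

theorem Sec_flat {r l : ℂ} (h : l = -r) : Sec r l = {d | 0 ≤ cr r d} := by
  ext d
  simp only [Sec, mem_ofPred_eq, h, cr_neg_right, ← cr_swap, and_self]

theorem IsSec.th_flat {Q : Set ℂ} {x r l : ℂ} (h : IsSec Q x r l) (hl : l = -r) :
    th Q x = Real.pi := by
  rw [th, h.eq, Sec_flat hl, am_half h.r0]

theorem th_flat {Q : Set ℂ} (hQ : Pgon Q) {x : ℂ} (hx : x ∈ Q) (he : x ∉ extremePoints ℝ Q) :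
    Real.pi ≤ th Q x := by
  by_cases hi : x ∈ interior Q
  · rw [th_interior hi]; linarith [Real.pi_pos]
  · obtain ⟨r, l, h⟩ := exists_sec hQ hx hi
    rw [h.th_flat (h.not_ext hQ.conv hx he)]

theorem am_compl {r l : ℂ} (h : 0 < cr r l) : am (Sec l (-r)) = Real.pi - am (Sec r l) := by
  have r0 : r ≠ 0 := by rintro rfl; simp [cr_zero_left] at h
  have l0 : l ≠ 0 := by rintro rfl; simp [cr_zero_right] at h
  have h1 : {d | 0 ≤ cr r d} = Sec r l ∪ Sec l (-r) := by
    ext d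
    simp only [Sec, mem_union, mem_ofPred_eq, cr_neg_right, ← cr_swap]
    rw [cr_swap d l]
    constructor
    · intro h
      rcases le_total 0 (cr l d) with h' | h'
      · right; exact ⟨h', h⟩
      · left; exact ⟨h, by linarith⟩
    · rintro (h | h)
      · exact h.1
      · exact h.2
  have h2 := am_half r0
  rw [h1, am_union (Sec_convex _ _)] at h2
  · linarith
  · apply measure_mono_null _ (null_line l0)
    rintro d ⟨h, h'⟩
    rw [mem_ofPred_eq]
    have h3 := h.2; have h4 := h'.1
    rw [cr_swap] at h3
    linarith

/-- The angle sum of a convex polygon. -/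
theorem angle_sum {Q : Set ℂ} (hQ : Pgon Q) :
    ∑ v ∈ hQ.fin.toFinset, th Q v = ((extremePoints ℝ Q).ncard - 2) * Real.pi := by
  let M : ℂ → Set ℂ := fun v => {m | ∀ q ∈ Q, 0 ≤ cr (q - v) m}
  have hM : ∀ v ∈ hQ.fin.toFinset, am (M v) = Real.pi - th Q v := by
    intro v hv
    have hv : v ∈ extremePoints ℝ Q := by simpa using hv
    have hvQ := extremePoints_subset hv
    obtain ⟨r, l, h⟩ := exists_sec hQ hvQ (ext_notMem_interior hv)
    have hp := (h.ext_iff hQ.conv hvQ).1 hv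
    rw [th, h.eq, ← am_compl hp]
    congr 1
    ext m
    simp only [M, mem_ofPred_eq, Sec, cr_neg_right, ← cr_swap]
    constructor
    · intro hm
      obtain ⟨t, ht, h1⟩ := h.er
      obtain ⟨s, hs, h2⟩ := h.el
      have h1 := hm _ (extremePoints_subset h1)
      have h2 := hm _ (extremePoints_subset h2)
      rw [add_sub_cancel_left, cr_real_left] at h1 h2
      exact ⟨nonneg_of_mul_nonneg_right h2 hs, nonneg_of_mul_nonneg_right h1 ht⟩
    · rintro ⟨h1, h2⟩ q hq
      have h3 : q - v ∈ Sec r l := by rw [← h.eq]; exact Kc_sub hq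
      rw [cr_decomp hp.ne' (q - v), cr_add_left, cr_real_left, cr_real_left]
      have h4 := h3.1; have h5 := h3.2
      positivity
  have hc : ∀ v ∈ hQ.fin.toFinset, Convex ℝ (M v) := by
    intro v _ d hd e he s t hs ht hst q hq
    have h1 := hd q hq
    have h2 := he q hq
    rw [Complex.real_smul, Complex.real_smul, cr_add_right, cr_real_right, cr_real_right]
    positivity
  have hd : ∀ i ∈ hQ.fin.toFinset, ∀ j ∈ hQ.fin.toFinset, i ≠ j →
      (volume : Measure ℂ) (M i ∩ M j) = 0 := by
    intro i hi j hj hij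
    have hi : i ∈ extremePoints ℝ Q := by simpa using hi
    have hj : j ∈ extremePoints ℝ Q := by simpa using hj
    apply measure_mono_null _ (null_line (sub_ne_zero.2 hij))
    rintro d ⟨h, h'⟩
    have h1 := h j (extremePoints_subset hj)
    have h2 := h' i (extremePoints_subset hi)
    rw [mem_ofPred_eq]
    rw [← neg_sub, cr_neg_left] at h1
    linarith
  have key := am_cover _ M hc hd
  have hne : (extremePoints ℝ Q).Nonempty := by
    by_contra hcon
    rw [not_nonempty_iff_eq_empty] at hcon
    have h1 := hQ.hull
    rw [hcon, convexHull_empty] at h1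
    obtain ⟨q, hq⟩ := hQ.ne
    rw [← h1] at hq; simp at hq
  have hcov : (⋃ i ∈ hQ.fin.toFinset, M i) = univ := by
    ext m
    simp only [mem_iUnion, mem_univ, iff_true, Finite.mem_toFinset, exists_prop]
    obtain ⟨v, hv, hmin⟩ := Set.exists_min_image _ (fun q => cr q m) hQ.fin hne
    refine ⟨v, hv, fun q hq => ?_⟩
    rw [← hQ.hull] at hq
    have := hull_half (a := -m) (x := v) (fun s hs => by
      rw [cr_neg_left, ← cr_swap, cr_sub_left]
      have := hmin s hs
      linarith) q hq
    rwa [cr_neg_left, ← cr_swap] at this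
  rw [hcov, am_univ, Finset.sum_congr rfl hM, Finset.sum_sub_distrib, Finset.sum_const,
    ← Set.ncard_eq_toFinset_card _ hQ.fin, nsmul_eq_mul] at key
  linarith

/-- number of corners -/
def nc (Q : Set ℂ) : ℕ := (extremePoints ℝ Q).ncard

theorem nc_smul (g : Mo) (Q : Set ℂ) : nc (g • Q) = nc Q := by
  unfold nc
  rw [← Mo.smul_extremePoints]
  exact Set.ncard_image_of_injective _ (MulAction.injective g)

theorem Pgon.ext_ne {Q : Set ℂ} (hQ : Pgon Q) : (extremePoints ℝ Q).Nonempty := by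
  by_contra hcon
  rw [not_nonempty_iff_eq_empty] at hcon
  have h1 := hQ.hull
  rw [hcon, convexHull_empty] at h1
  obtain ⟨q, hq⟩ := hQ.ne
  rw [← h1] at hq; simp at hq

theorem nc_ge {Q : Set ℂ} (hQ : Pgon Q) : 3 ≤ nc Q := by
  have h := angle_sum hQ
  have h1 : 0 < ∑ v ∈ hQ.fin.toFinset, th Q v := by
    apply Finset.sum_pos
    · intro v hv
      have hv : v ∈ extremePoints ℝ Q := by simpa using hv
      exact th_pos hQ (extremePoints_subset hv)
    · simpa using hQ.ext_ne
  rw [h] at h1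
  have h2 : 0 < ((extremePoints ℝ Q).ncard : ℝ) - 2 := pos_of_mul_pos_left h1 Real.pi_pos.le
  have h3 : (2 : ℝ) < (nc Q : ℝ) := by unfold nc; linarith
  have : 2 < nc Q := by exact_mod_cast h3
  omega

theorem exists_large {Q : Set ℂ} (hQ : Pgon Q) : ∃ v ∈ extremePoints ℝ Q, Real.pi / 3 ≤ th Q v := by
  by_contra! hcon
  have h := angle_sum hQ
  have h3 : (3 : ℝ) ≤ (nc Q : ℝ) := by exact_mod_cast nc_ge hQ
  have h1 : ∑ v ∈ hQ.fin.toFinset, th Q v ≤ ∑ v ∈ hQ.fin.toFinset, (Real.pi / 3) := by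
    apply Finset.sum_le_sum
    intro v hv
    exact (hcon v (by simpa using hv)).le
  have h2 : ∑ v ∈ hQ.fin.toFinset, th Q v < ∑ v ∈ hQ.fin.toFinset, (Real.pi / 3) := by
    apply Finset.sum_lt_sum_of_nonempty
    · simpa using hQ.ext_ne
    · intro v hv
      exact (hcon v (by simpa using hv))
  rw [h, Finset.sum_const, ← Set.ncard_eq_toFinset_card _ hQ.fin, nsmul_eq_mul] at h2
  change ((nc Q : ℝ) - 2) * Real.pi < (nc Q : ℝ) * _ at h2
  nlinarith [Real.pi_pos]

/-- tangent cones of different tiles are almost disjoint -/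
theorem Kc_disj {P Q : Set ℂ} (hP : Pgon P) (hQ : Pgon Q) (hd : ∀ z, z ∈ interior P → z ∉ interior Q)
    {x : ℂ} (h1 : x ∈ P) (h2 : x ∈ Q) : Disjoint (interior (Kc P x)) (interior (Kc Q x)) := by
  rw [Set.disjoint_left]
  intro d hd1 hd2
  obtain ⟨ε, hε, h3⟩ := interior_Kc hP h1 hd1
  obtain ⟨δ, hδ, h4⟩ := interior_Kc hQ h2 hd2
  exact hd _ (h3 (min ε δ) (by positivity) (min_le_left _ _))
    (h4 (min ε δ) (by positivity) (min_le_right _ _))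

theorem Kc_null {P Q : Set ℂ} (hP : Pgon P) (hQ : Pgon Q) (hd : ∀ z, z ∈ interior P → z ∉ interior Q)
    {x : ℂ} (h1 : x ∈ P) (h2 : x ∈ Q) : (volume : Measure ℂ) (Kc P x ∩ Kc Q x) = 0 := by
  have h := Kc_disj hP hQ hd h1 h2
  have n1 := (Kc_convex hP.conv h1).addHaar_frontier volume
  have n2 := (Kc_convex hQ.conv h2).addHaar_frontier volume
  apply measure_mono_null _ (measure_union_null n1 n2)
  rintro d ⟨hd1, hd2⟩
  by_cases hi : d ∈ interior (Kc P x)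
  · right
    refine ⟨subset_closure hd2, fun h' => Set.disjoint_left.1 h hi h'⟩
  · left; exact ⟨subset_closure hd1, hi⟩


theorem vol_inter {P Q : Set ℂ} (hP : Pgon P) (hQ : Pgon Q) (hd : ∀ z, z ∈ interior P → z ∉ interior Q) :
    (volume : Measure ℂ) (P ∩ Q) = 0 := by
  have n1 := hP.conv.addHaar_frontier volume
  have n2 := hQ.conv.addHaar_frontier volume
  refine measure_mono_null ?_ (measure_union_null n1 n2)
  rintro z ⟨h1, h2⟩
  by_cases hi : z ∈ interior P
  · exact Or.inr ⟨subset_closure h2, hd z hi⟩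
  · exact Or.inl ⟨subset_closure h1, hi⟩


theorem Mono.dj (hT : Mono T) {P Q : Set ℂ} (hP : P ∈ T) (hQ : Q ∈ T) (hne : P ≠ Q) :
    ∀ z, z ∈ interior P → z ∉ interior Q := fun z h1 h2 => hne (hT.dis P hP Q hQ z h1 h2)

theorem Mono.sum_le (hT : Mono T) {x : ℂ} (s : Finset (Set ℂ)) (hs : ∀ Q ∈ s, Q ∈ Co T x) :
    ∑ Q ∈ s, th Q x ≤ 2 * Real.pi := by
  have h := am_cover s (fun Q => Kc Q x) (fun Q hQ => Kc_convex (hT.poly Q (hs Q hQ).1).conv (hs Q hQ).2)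
    (fun P hP Q hQ hne => Kc_null (hT.poly P (hs P hP).1) (hT.poly Q (hs Q hQ).1)
      (hT.dj (hs P hP).1 (hs Q hQ).1 hne) (hs P hP).2 (hs Q hQ).2)
  unfold th
  rw [← h, ← am_univ]
  unfold am
  have := measureReal_mono (μ := (volume : Measure ℂ)) (inter_subset_inter_left (Metric.ball (0:ℂ) 1) (subset_univ (⋃ Q ∈ s, Kc Q x))) (fin_ball _)
  linarith

theorem Mono.fin_large (hT : Mono T) (x : ℂ) {c : ℝ} (hc : 0 < c) :
    {Q | Q ∈ Co T x ∧ c ≤ th Q x}.Finite := by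
  by_contra hinf
  obtain ⟨n, hn⟩ := exists_nat_gt (2 * Real.pi / c)
  obtain ⟨s, hs, hcard⟩ := Set.Infinite.exists_subset_card_eq hinf n
  have h := hT.sum_le s (fun Q hQ => (hs hQ).1)
  have h2 : ∑ Q ∈ s, c ≤ ∑ Q ∈ s, th Q x := Finset.sum_le_sum (fun Q hQ => (hs hQ).2)
  rw [Finset.sum_const, hcard, nsmul_eq_mul] at h2
  rw [div_lt_iff₀ hc] at hn
  linarith

theorem Mono.vx_ne (hT : Mono T) : (Vx T).Nonempty := by
  obtain ⟨P, hP, -⟩ := hT.cov 0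
  obtain ⟨v, hv⟩ := (hT.poly P hP).ext_ne
  exact ⟨v, P, hP, hv⟩

theorem Mono.bounds (hT : Mono T) : ∃ d r : ℝ, 0 < d ∧ 0 < r ∧ ∀ Q ∈ T,
    (∀ z ∈ Q, ∀ w ∈ Q, dist z w ≤ d) ∧ ∃ c, Metric.ball c r ⊆ Q := by
  obtain ⟨x, hx⟩ := hT.vx_ne
  have hfin := hT.fin_large x (c := Real.pi / 3) (by positivity)
  set S := {Q | Q ∈ Co T x ∧ Real.pi / 3 ≤ th Q x} with hS
  have h1 : ∃ d r : ℝ, 0 < d ∧ 0 < r ∧ ∀ Q ∈ S,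
      (∀ z ∈ Q, ∀ w ∈ Q, dist z w ≤ d) ∧ ∃ c, Metric.ball c r ⊆ Q := by
    have hall : ∀ Q ∈ S, Pgon Q := fun Q hQ => hT.poly Q hQ.1.1
    clear_value S
    clear hS
    induction S, hfin using Set.Finite.induction_on with
    | empty => exact ⟨1, 1, one_pos, one_pos, by simp⟩
    | @insert Q S hQ hS ih =>
      obtain ⟨d, r, hd, hr, h⟩ := ih (fun Q hQ => hall Q (mem_insert_of_mem _ hQ))
      have hp := hall Q (mem_insert _ _)
      obtain ⟨c, hc⟩ := hp.ne
      obtain ⟨r', hr', hb⟩ := Metric.isOpen_iff.1 isOpen_interior c hc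
      obtain ⟨d', hd'⟩ := Metric.isBounded_iff.1 hp.comp.isBounded
      refine ⟨max d d', min r r', lt_max_of_lt_left hd, lt_min hr hr', ?_⟩
      intro P hP
      rcases mem_insert_iff.1 hP with rfl | hP
      · refine ⟨fun z hz w hw => (hd' hz hw).trans (le_max_right _ _), c, ?_⟩
        exact (Metric.ball_subset_ball (min_le_right _ _)).trans (hb.trans interior_subset)
      · obtain ⟨h2, c, h3⟩ := h P hP
        refine ⟨fun z hz w hw => (h2 z hz w hw).trans (le_max_left _ _), c, ?_⟩
        exact (Metric.ball_subset_ball (min_le_left _ _)).trans h3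
  obtain ⟨d, r, hd, hr, h⟩ := h1
  refine ⟨d, r, hd, hr, ?_⟩
  intro P hP
  obtain ⟨v, hv, hth⟩ := exists_large (hT.poly P hP)
  obtain ⟨g, hg, hgC⟩ := hT.mono v ⟨P, hP, hv⟩ x hx
  have hvP : v ∈ P := hv.1
  have hgP : g • P ∈ Co T x := by
    rw [← hgC]; exact Set.smul_mem_smul_set ⟨hP, hvP⟩
  obtain ⟨h2, c, h3⟩ := h (g • P) ⟨hgP, by rw [← hg, th_smul]; exact hth⟩
  refine ⟨?_, g⁻¹ • c, ?_⟩
  · intro z hz w hw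
    have := h2 (g • z) (Set.smul_mem_smul_set hz) (g • w) (Set.smul_mem_smul_set hw)
    rwa [Mo.dist_smul] at this
  · intro z hz
    have : g • z ∈ g • P := by
      apply h3
      rw [Metric.mem_ball, ← Mo.dist_smul g⁻¹, inv_smul_smul]
      exact hz
    exact Set.smul_mem_smul_set_iff.1 this

theorem Mono.count (hT : Mono T) : ∃ d r : ℝ, 0 < d ∧ 0 < r ∧
    (∀ Q ∈ T, ∀ z ∈ Q, ∀ w ∈ Q, dist z w ≤ d) ∧
    ∀ (c : ℂ) (R : ℝ), 0 ≤ R → ∀ s : Finset (Set ℂ),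
      (∀ Q ∈ s, Q ∈ T ∧ ∃ z ∈ Q, dist z c ≤ R) → s.card * r ^ 2 ≤ (R + d) ^ 2 := by
  obtain ⟨d, r, hd, hr, h⟩ := hT.bounds
  refine ⟨d, r, hd, hr, fun Q hQ => (h Q hQ).1, ?_⟩
  intro c R hR s hs
  have h1 : ∀ Q ∈ s, Q ⊆ Metric.closedBall c (R + d) := by
    intro Q hQ w hw
    obtain ⟨hQT, z, hz, hzc⟩ := hs Q hQ
    have := (h Q hQT).1 w hw z hz
    rw [Metric.mem_closedBall]
    linarith [dist_triangle w z c]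
  have h2 : (volume : Measure ℂ).real (⋃ Q ∈ s, Q) = ∑ Q ∈ s, (volume : Measure ℂ).real Q := by
    refine measureReal_biUnion_finset₀ (f := fun Q => Q) ?_ ?_ ?_
    · intro P hP Q hQ hne
      exact vol_inter (hT.poly P (hs P hP).1) (hT.poly Q (hs Q hQ).1) (hT.dj (hs P hP).1 (hs Q hQ).1 hne)
    · intro Q hQ
      exact (hT.poly Q (hs Q hQ).1).conv.nullMeasurableSet _
    · intro Q hQ
      exact (hT.poly Q (hs Q hQ).1).comp.measure_lt_top.ne
  have h3 : ∑ Q ∈ s, r ^ 2 * Real.pi ≤ ∑ Q ∈ s, (volume : Measure ℂ).real Q := by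
    apply Finset.sum_le_sum
    intro Q hQ
    obtain ⟨b, hb⟩ := (h Q (hs Q hQ).1).2
    have := measureReal_mono (μ := (volume : Measure ℂ)) hb (hT.poly Q (hs Q hQ).1).comp.measure_lt_top.ne
    have e : (volume : Measure ℂ).real (Metric.ball b r) = r ^ 2 * Real.pi := by
      simp [Measure.real, Complex.volume_ball, hr.le]
    linarith
  have h4 : (volume : Measure ℂ).real (⋃ Q ∈ s, Q) ≤ (R + d) ^ 2 * Real.pi := by
    have e : (volume : Measure ℂ).real (Metric.closedBall c (R + d)) = (R + d) ^ 2 * Real.pi := by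
      simp [Measure.real, Complex.volume_closedBall, (by positivity : 0 ≤ R + d)]
    rw [← e]
    exact measureReal_mono (iUnion₂_subset h1) (isCompact_closedBall _ _).measure_lt_top.ne
  rw [Finset.sum_const, nsmul_eq_mul, ← h2] at h3
  have := h3.trans h4
  rw [← mul_assoc] at this
  exact le_of_mul_le_mul_right this Real.pi_pos

theorem Mono.fin_meet (hT : Mono T) (c : ℂ) (R : ℝ) : {Q | Q ∈ T ∧ ∃ z ∈ Q, dist z c ≤ R}.Finite := by
  obtain ⟨d, r, hd, hr, -, h⟩ := hT.count
  by_cases hR : 0 ≤ R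
  · by_contra hinf
    obtain ⟨n, hn⟩ := exists_nat_gt ((R + d) ^ 2 / r ^ 2)
    obtain ⟨s, hs, hcard⟩ := Set.Infinite.exists_subset_card_eq hinf n
    have h1 := h c R hR s (fun Q hQ => hs hQ)
    rw [hcard] at h1
    rw [div_lt_iff₀ (by positivity)] at hn
    linarith
  · convert Set.finite_empty
    apply eq_empty_of_forall_notMem
    rintro Q ⟨-, z, -, hz⟩
    exact hR (dist_nonneg.trans hz)

theorem Mono.finCo (hT : Mono T) (x : ℂ) : (Co T x).Finite := by
  refine (hT.fin_meet x 0).subset ?_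
  rintro Q ⟨h1, h2⟩
  exact ⟨h1, x, h2, by simp⟩

/-- finset of the corona tiles -/
def Mono.cof (hT : Mono T) (x : ℂ) : Finset (Set ℂ) := (hT.finCo x).toFinset

theorem Mono.mem_cof (hT : Mono T) {x : ℂ} {Q : Set ℂ} : Q ∈ hT.cof x ↔ Q ∈ Co T x := by
  simp [Mono.cof]

theorem Mono.near (hT : Mono T) (p : ℂ) : ∃ ε > 0, ∀ Q ∈ T, ∀ z ∈ Q, dist z p < ε → p ∈ Q := by
  have hfin := hT.fin_meet p 1
  have h1 : ∀ Q ∈ {Q | Q ∈ T ∧ ∃ z ∈ Q, dist z p ≤ 1}, ∀ᶠ z in nhds p, z ∈ Q → p ∈ Q := by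
    intro Q hQ
    by_cases hp : p ∈ Q
    · exact Filter.Eventually.of_forall (fun _ _ => hp)
    · have := (hT.poly Q hQ.1).comp.isClosed.isOpen_compl.mem_nhds hp
      filter_upwards [this] with z hz hz'
      exact absurd hz' hz
  have h2 := (Filter.eventually_all_finite hfin).2 h1
  obtain ⟨ε, hε, h⟩ := Metric.eventually_nhds_iff.1 h2
  refine ⟨min ε 1, lt_min hε one_pos, ?_⟩
  intro Q hQ z hz hd
  exact h (hd.trans_le (min_le_left _ _)) Q ⟨hQ, z, hz, (hd.trans_le (min_le_right _ _)).le⟩ hz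

theorem Mono.cone_cover (hT : Mono T) (p d : ℂ) : ∃ Q ∈ Co T p, d ∈ Kc Q p := by
  obtain ⟨ε, hε, h⟩ := hT.near p
  set t : ℝ := ε / (2 * (‖d‖ + 1)) with ht
  have ht0 : 0 < t := by positivity
  obtain ⟨Q, hQ, hz⟩ := hT.cov (p + t * d)
  refine ⟨Q, ⟨hQ, h Q hQ _ hz ?_⟩, t, ht0, hz⟩
  rw [dist_eq_norm]
  have : p + t * d - p = t * d := by ring
  rw [this, norm_mul, Complex.norm_real, Real.norm_of_nonneg ht0.le, ht, div_mul_eq_mul_div,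
    div_lt_iff₀ (by positivity)]
  nlinarith [norm_nonneg d]

theorem Mono.sum_eq (hT : Mono T) (x : ℂ) : ∑ Q ∈ hT.cof x, th Q x = 2 * Real.pi := by
  have h := am_cover (hT.cof x) (fun Q => Kc Q x)
    (fun Q hQ => Kc_convex (hT.poly Q (hT.mem_cof.1 hQ).1).conv (hT.mem_cof.1 hQ).2)
    (fun P hP Q hQ hne => Kc_null (hT.poly P (hT.mem_cof.1 hP).1) (hT.poly Q (hT.mem_cof.1 hQ).1)
      (hT.dj (hT.mem_cof.1 hP).1 (hT.mem_cof.1 hQ).1 hne) (hT.mem_cof.1 hP).2 (hT.mem_cof.1 hQ).2)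
  unfold th
  rw [← h, ← am_univ]
  congr 1
  apply eq_univ_of_forall
  intro d
  obtain ⟨Q, hQ, hd⟩ := hT.cone_cover x d
  exact mem_iUnion₂.2 ⟨Q, hT.mem_cof.2 hQ, hd⟩

theorem Mono.pos (hT : Mono T) {x : ℂ} {Q : Set ℂ} (hQ : Q ∈ Co T x) : 0 < th Q x :=
  th_pos (hT.poly Q hQ.1) hQ.2

/-- a subfamily of the corona filling the angle is everything -/
theorem Mono.full (hT : Mono T) {x : ℂ} (s : Finset (Set ℂ)) (hs : ∀ Q ∈ s, Q ∈ Co T x)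
    (h : 2 * Real.pi ≤ ∑ Q ∈ s, th Q x) : ∀ Q ∈ Co T x, Q ∈ s := by
  classical
  intro Q hQ
  by_contra hn
  have := hT.sum_le (insert Q s) (by
    intro P hP
    rcases Finset.mem_insert.1 hP with rfl | hP
    · exact hQ
    · exact hs P hP)
  rw [Finset.sum_insert hn] at this
  linarith [hT.pos hQ]

theorem Mono.two_le (hT : Mono T) {x : ℂ} {P Q : Set ℂ} (hP : P ∈ Co T x) (hQ : Q ∈ Co T x) (hne : P ≠ Q) :
    th P x + th Q x ≤ 2 * Real.pi := by
  classical
  have := hT.sum_le {P, Q} (by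
    intro P' hP'
    rcases Finset.mem_insert.1 hP' with rfl | hP'
    · exact hP
    · rw [Finset.mem_singleton] at hP'; rwa [hP'])
  rwa [Finset.sum_pair hne] at this

theorem Mono.three_le (hT : Mono T) {x : ℂ} {P Q R : Set ℂ} (hP : P ∈ Co T x) (hQ : Q ∈ Co T x)
    (hR : R ∈ Co T x) (h1 : P ≠ Q) (h2 : P ≠ R) (h3 : Q ≠ R) :
    th P x + th Q x + th R x ≤ 2 * Real.pi := by
  classical
  have := hT.sum_le {P, Q, R} (by
    intro P' hP'
    simp only [Finset.mem_insert, Finset.mem_singleton] at hP'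
    rcases hP' with rfl | rfl | rfl <;> assumption)
  rw [Finset.sum_insert (by simp [h1, h2]), Finset.sum_pair h3] at this
  linarith

theorem Mono.not_int (hT : Mono T) {x : ℂ} {P Q : Set ℂ} (hP : P ∈ Co T x) (hQ : Q ∈ Co T x) (hne : P ≠ Q) :
    x ∉ interior P := by
  intro h
  have := hT.two_le hP hQ hne
  rw [th_interior h] at this
  linarith [hT.pos hQ]

theorem Mono.vx_three (hT : Mono T) {x : ℂ} {P Q R : Set ℂ} (hP : P ∈ Co T x) (hQ : Q ∈ Co T x)
    (hR : R ∈ Co T x) (h1 : P ≠ Q) (h2 : P ≠ R) (h3 : Q ≠ R) : x ∈ Vx T := by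
  by_contra hn
  have a : ∀ S ∈ Co T x, Real.pi ≤ th S x := fun S hS =>
    th_flat (hT.poly S hS.1) hS.2 (fun h => hn ⟨S, hS.1, h⟩)
  have := hT.three_le hP hQ hR h1 h2 h3
  linarith [a P hP, a Q hQ, a R hR, Real.pi_pos]

theorem Mono.ext_or (hT : Mono T) {x : ℂ} (hx : x ∈ Vx T) {P Q : Set ℂ} (hP : P ∈ Co T x)
    (hQ : Q ∈ Co T x) (hne : P ≠ Q) : x ∈ extremePoints ℝ P ∨ x ∈ extremePoints ℝ Q := by
  by_contra! hn
  obtain ⟨R, hR, hxR⟩ := hx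
  have hRC : R ∈ Co T x := ⟨hR, hxR.1⟩
  have := hT.three_le hP hQ hRC hne (by rintro rfl; exact hn.1 hxR) (by rintro rfl; exact hn.2 hxR)
  linarith [th_flat (hT.poly P hP.1) hP.2 hn.1, th_flat (hT.poly Q hQ.1) hQ.2 hn.2, hT.pos hRC]

theorem Mono.sec (hT : Mono T) {x : ℂ} (hx : x ∈ Vx T) {Q : Set ℂ} (hQ : Q ∈ Co T x) :
    ∃ r l, IsSec Q x r l := by
  refine exists_sec (hT.poly Q hQ.1) hQ.2 ?_
  obtain ⟨P, hP, hxP⟩ := hx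
  by_cases h : Q = P
  · subst h; exact ext_notMem_interior hxP
  · exact hT.not_int hQ ⟨hP, hxP.1⟩ h

theorem th_lt {Q : Set ℂ} {x r l : ℂ} (h : IsSec Q x r l) (hp : 0 < cr r l) : th Q x < Real.pi := by
  have h1 := am_compl hp
  have : 0 < am (Sec l (-r)) := by
    apply am_pos
    have l0 := h.l0
    have e : ∀ c : ℝ, cr l (c * (l - r)) = c * cr r l := by
      intro c; rw [cr_real_right, cr_sub_right, cr_self, cr_swap l r]; ring
    have e' : ∀ c : ℝ, cr (c * (l - r)) (-r) = c * cr r l := by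
      intro c; rw [cr_real_left, cr_sub_left, cr_neg_right, cr_neg_right, cr_self, cr_swap l r]; ring
    refine ⟨((1/4 : ℝ) : ℂ) * (l - r), ?_, ?_⟩
    · have ho : IsOpen {d : ℂ | 0 < cr l d ∧ 0 < cr d (-r)} :=
        (isOpen_lt continuous_const (continuous_cr_right _)).inter (isOpen_lt continuous_const (continuous_cr_left _))
      refine interior_maximal (t := {d : ℂ | 0 < cr l d ∧ 0 < cr d (-r)}) ?_ ho ?_
      · intro d hd; exact ⟨hd.1.le, hd.2.le⟩
      · refine ⟨?_, ?_⟩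
        · rw [e]; positivity
        · rw [e']; positivity
    · rw [norm_mul, Complex.norm_real]
      have := norm_sub_le l r
      rw [h.nr, h.nl] at this
      norm_num; linarith
  rw [th, h.eq]; linarith

theorem Mono.frontier_other (hT : Mono T) {x : ℂ} {Q : Set ℂ} (hQ : Q ∈ Co T x) (hx : x ∉ interior Q) :
    ∃ P ∈ Co T x, P ≠ Q := by
  classical
  by_contra! hn
  obtain ⟨r, l, h⟩ := exists_sec (hT.poly Q hQ.1) hQ.2 hx
  have h1 := hT.sum_eq x
  have : hT.cof x = {Q} := by
    ext P; rw [hT.mem_cof, Finset.mem_singleton]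
    exact ⟨hn P, by rintro rfl; exact hQ⟩
  rw [this, Finset.sum_singleton] at h1
  rcases h.pos with hp | hf
  · linarith [th_lt h hp, Real.pi_pos]
  · linarith [h.th_flat hf, Real.pi_pos]



theorem IsSec.ne {Q : Set ℂ} {x r l : ℂ} (h : IsSec Q x r l) : l ≠ r := by
  intro e
  rcases h.pos with hp | hf
  · rw [e, cr_self] at hp; exact lt_irrefl _ hp
  · rw [e] at hf
    have : r = 0 := by linear_combination (1/2 : ℂ) * hf
    exact h.r0 this

theorem open_sec {Q : Set ℂ} {x r l d : ℂ} (h : IsSec Q x r l) (h1 : 0 < cr r d) (h2 : 0 < cr d l) :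
    d ∈ interior (Kc Q x) := by
  have ho : IsOpen {d : ℂ | 0 < cr r d ∧ 0 < cr d l} :=
    (isOpen_lt continuous_const (continuous_cr_right _)).inter (isOpen_lt continuous_const (continuous_cr_left _))
  refine interior_maximal (t := {d : ℂ | 0 < cr r d ∧ 0 < cr d l}) ?_ ho ⟨h1, h2⟩
  rw [h.eq]
  intro d hd; exact ⟨hd.1.le, hd.2.le⟩

theorem IsSec.bdry {Q : Set ℂ} {x r l d : ℂ} (h : IsSec Q x r l) (hd : d ∈ Kc Q x) (hn : ‖d‖ = 1)
    (hi : d ∉ interior (Kc Q x)) : d = r ∨ d = l := by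
  rw [h.eq] at hd
  by_cases h1 : 0 < cr r d
  · by_cases h2 : 0 < cr d l
    · exact absurd (open_sec h h1 h2) hi
    · have h3 : cr l d = 0 := by rw [cr_swap]; linarith [hd.2]
      rcases cr_norm_eq h.nl hn h3 with e | e
      · exact Or.inr e
      · rcases h.pos with hp | hf
        · rw [e, cr_neg_right] at h1; linarith
        · left; rw [e, hf]; ring
  · have h3 : cr r d = 0 := le_antisymm (not_lt.1 h1) hd.1
    rcases cr_norm_eq h.nr hn h3 with e | e
    · exact Or.inl e
    · have := hd.2
      rw [e, cr_neg_left] at this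
      rcases h.pos with hp | hf
      · linarith
      · right; rw [e, hf]

theorem IsSec.right_near {Q : Set ℂ} {x r l : ℂ} (h : IsSec Q x r l) :
    ∀ᶠ ε : ℝ in nhdsWithin 0 (Ioi 0), r + ε * (Complex.I * r) ∈ interior (Kc Q x) := by
  have hr := cr_I_pos h.r0
  have h1 : ∀ᶠ ε : ℝ in nhdsWithin 0 (Ioi 0), 0 < cr (r + ε * (Complex.I * r)) l := by
    rcases h.pos with hp | hf
    · have hc : Continuous (fun ε : ℝ => cr (r + ε * (Complex.I * r)) l) :=
        (continuous_cr_left l).comp (by fun_prop)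
      have : 0 < cr (r + (0:ℝ) * (Complex.I * r)) l := by simpa using hp
      exact nhdsWithin_le_nhds (hc.continuousAt.eventually (lt_mem_nhds this))
    · filter_upwards [self_mem_nhdsWithin] with ε hε
      rw [hf, cr_add_left, cr_real_left, cr_neg_right, cr_neg_right, cr_self, cr_swap]
      have := mul_pos (show (0:ℝ) < ε from hε) hr
      linarith
  filter_upwards [h1, self_mem_nhdsWithin] with ε h2 hε
  refine open_sec h ?_ h2
  rw [cr_add_right, cr_self, cr_real_right, zero_add]
  exact mul_pos hε hr

theorem IsSec.left_near {Q : Set ℂ} {x r l : ℂ} (h : IsSec Q x r l) :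
    ∀ᶠ ε : ℝ in nhdsWithin 0 (Ioi 0), l - ε * (Complex.I * l) ∈ interior (Kc Q x) := by
  have hr := cr_I_pos h.l0
  have h1 : ∀ᶠ ε : ℝ in nhdsWithin 0 (Ioi 0), 0 < cr r (l - ε * (Complex.I * l)) := by
    rcases h.pos with hp | hf
    · have hc : Continuous (fun ε : ℝ => cr r (l - ε * (Complex.I * l))) :=
        (continuous_cr_right r).comp (by fun_prop)
      have : 0 < cr r (l - (0:ℝ) * (Complex.I * l)) := by simpa using hp
      exact nhdsWithin_le_nhds (hc.continuousAt.eventually (lt_mem_nhds this))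
    · filter_upwards [self_mem_nhdsWithin] with ε hε
      have e : r = -l := by rw [hf]; ring
      rw [e, cr_sub_right, cr_real_right, cr_neg_left, cr_neg_left, cr_self]
      have := mul_pos (show (0:ℝ) < ε from hε) hr
      linarith
  filter_upwards [h1, self_mem_nhdsWithin] with ε h2 hε
  refine open_sec h h2 ?_
  rw [cr_sub_left, cr_self, cr_real_left, cr_swap (Complex.I * l)]
  have := mul_pos (show (0:ℝ) < ε from hε) hr
  linarith

theorem Kc_interior_ne {Q : Set ℂ} (hQ : Pgon Q) (x : ℂ) : (interior (Kc Q x)).Nonempty := by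
  obtain ⟨q, hq⟩ := hQ.ne
  refine ⟨q - x, ?_⟩
  have ho : IsOpen ((fun z : ℂ => z + x) ⁻¹' interior Q) := isOpen_interior.preimage (by fun_prop)
  refine interior_maximal (t := (fun z : ℂ => z + x) ⁻¹' interior Q) ?_ ho (by simpa using hq)
  intro d hd
  have := Kc_sub (x := x) (interior_subset hd)
  simpa using this

theorem Mono.Kc_dj (hT : Mono T) {x : ℂ} {P Q : Set ℂ} (hP : P ∈ Co T x) (hQ : Q ∈ Co T x) (hne : P ≠ Q)
    {d : ℂ} (h1 : d ∈ interior (Kc P x)) (h2 : d ∈ Kc Q x) : False := by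
  have hdj := Kc_disj (hT.poly P hP.1) (hT.poly Q hQ.1) (hT.dj hP.1 hQ.1 hne) hP.2 hQ.2
  have hc := (Kc_convex (hT.poly Q hQ.1).conv hQ.2).closure_interior_eq_closure_of_nonempty_interior
    (Kc_interior_ne (hT.poly Q hQ.1) x)
  have : d ∈ closure (interior (Kc Q x)) := by rw [hc]; exact subset_closure h2
  obtain ⟨e, he1, he2⟩ := mem_closure_iff.1 this _ isOpen_interior h1
  exact Set.disjoint_left.1 hdj he1 he2

theorem Mono.r_inj (hT : Mono T) {x : ℂ} {P Q : Set ℂ} (hP : P ∈ Co T x) (hQ : Q ∈ Co T x)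
    {r l l' : ℂ} (h1 : IsSec P x r l) (h2 : IsSec Q x r l') : P = Q := by
  by_contra hne
  obtain ⟨ε, h3, h4⟩ := (h1.right_near.and h2.right_near).exists
  exact hT.Kc_dj hP hQ hne h3 (interior_subset h4)

theorem Mono.l_inj (hT : Mono T) {x : ℂ} {P Q : Set ℂ} (hP : P ∈ Co T x) (hQ : Q ∈ Co T x)
    {r r' l : ℂ} (h1 : IsSec P x r l) (h2 : IsSec Q x r' l) : P = Q := by
  by_contra hne
  obtain ⟨ε, h3, h4⟩ := (h1.left_near.and h2.left_near).exists
  exact hT.Kc_dj hP hQ hne h3 (interior_subset h4)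

theorem Mono.adj_dir (hT : Mono T) {x : ℂ} {P Q : Set ℂ} (hP : P ∈ Co T x) (hQ : Q ∈ Co T x) (hne : P ≠ Q)
    {r l r' l' d : ℂ} (h1 : IsSec P x r l) (h2 : IsSec Q x r' l') (hd1 : d ∈ Kc P x) (hd2 : d ∈ Kc Q x)
    (hn : ‖d‖ = 1) : (d = l ∧ d = r') ∨ (d = r ∧ d = l') := by
  have h3 := h1.bdry hd1 hn (fun h => hT.Kc_dj hP hQ hne h hd2)
  have h4 := h2.bdry hd2 hn (fun h => hT.Kc_dj hQ hP hne.symm h hd1)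
  rcases h3 with rfl | rfl <;> rcases h4 with rfl | rfl
  · exact absurd (hT.r_inj hP hQ h1 h2) hne
  · exact Or.inr ⟨rfl, rfl⟩
  · exact Or.inl ⟨rfl, rfl⟩
  · exact absurd (hT.l_inj hP hQ h1 h2) hne

theorem Sec_closed (r l : ℂ) : IsClosed (Sec r l) :=
  (isClosed_le continuous_const (continuous_cr_right _)).inter (isClosed_le continuous_const (continuous_cr_left _))

theorem Mono.Kc_closed (hT : Mono T) {x : ℂ} (hx : x ∈ Vx T) {Q : Set ℂ} (hQ : Q ∈ Co T x) :
    IsClosed (Kc Q x) := by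
  obtain ⟨r, l, h⟩ := hT.sec hx hQ
  rw [h.eq]; exact Sec_closed _ _

theorem Mono.limit_dir (hT : Mono T) {x : ℂ} (hx : x ∈ Vx T) {Q : Set ℂ} (f : ℝ → ℂ)
    (hf : Continuous f) (h : ∀ ε > 0, f ε ∉ Kc Q x) : ∃ P ∈ Co T x, P ≠ Q ∧ f 0 ∈ Kc P x := by
  by_contra! hn
  have h1 : ∀ P ∈ Co T x, ∀ᶠ ε : ℝ in nhdsWithin 0 (Ioi 0), f ε ∉ Kc P x := by
    intro P hP
    by_cases e : P = Q
    · subst e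
      filter_upwards [self_mem_nhdsWithin] with ε hε using h ε hε
    · exact nhdsWithin_le_nhds (hf.continuousAt.eventually
        ((hT.Kc_closed hx hP).isOpen_compl.mem_nhds (hn P hP e)))
  obtain ⟨ε, hε⟩ := ((Filter.eventually_all_finite (hT.finCo x)).2 h1).exists
  obtain ⟨P, hP, hd⟩ := hT.cone_cover x (f ε)
  exact hε P hP hd

theorem Mono.next (hT : Mono T) {x : ℂ} (hx : x ∈ Vx T) {Q : Set ℂ} (hQ : Q ∈ Co T x) {r l : ℂ}
    (h : IsSec Q x r l) : ∃ P ∈ Co T x, P ≠ Q ∧ ∃ l', IsSec P x l l' := by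
  obtain ⟨P, hP, hne, hd⟩ := hT.limit_dir hx (Q := Q) (fun ε : ℝ => l + ε * (Complex.I * l)) (by fun_prop) (by
    intro ε hε hm
    rw [h.eq] at hm
    have := hm.2
    rw [cr_add_left, cr_self, cr_real_left, cr_swap, zero_add] at this
    nlinarith [cr_I_pos h.l0])
  simp only [Complex.ofReal_zero, zero_mul, add_zero] at hd
  obtain ⟨r', l', h'⟩ := hT.sec hx hP
  rcases hT.adj_dir hQ hP hne.symm h h' h.l_mem hd h.nl with ⟨-, e⟩ | ⟨e, -⟩
  · exact ⟨P, hP, hne, l', by rw [e]; exact h'⟩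
  · exact absurd e h.ne

theorem Mono.prev (hT : Mono T) {x : ℂ} (hx : x ∈ Vx T) {Q : Set ℂ} (hQ : Q ∈ Co T x) {r l : ℂ}
    (h : IsSec Q x r l) : ∃ P ∈ Co T x, P ≠ Q ∧ ∃ r', IsSec P x r' r := by
  obtain ⟨P, hP, hne, hd⟩ := hT.limit_dir hx (Q := Q) (fun ε : ℝ => r - ε * (Complex.I * r)) (by fun_prop) (by
    intro ε hε hm
    rw [h.eq] at hm
    have := hm.1
    rw [cr_sub_right, cr_self, cr_real_right] at this
    nlinarith [cr_I_pos h.r0])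
  simp only [Complex.ofReal_zero, zero_mul, sub_zero] at hd
  obtain ⟨r', l', h'⟩ := hT.sec hx hP
  rcases hT.adj_dir hQ hP hne.symm h h' h.r_mem hd h.nr with ⟨e, -⟩ | ⟨-, e⟩
  · exact absurd e.symm h.ne
  · exact ⟨P, hP, hne, r', by rw [e]; exact h'⟩

def Nxt (T : Set (Set ℂ)) (x : ℂ) (Q P : Set ℂ) : Prop :=
  Q ∈ Co T x ∧ P ∈ Co T x ∧ Q ≠ P ∧ ∃ r l l', IsSec Q x r l ∧ IsSec P x l l'

theorem Mono.nxt_ex (hT : Mono T) {x : ℂ} (hx : x ∈ Vx T) {Q : Set ℂ} (hQ : Q ∈ Co T x) :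
    ∃ P, Nxt T x Q P := by
  obtain ⟨r, l, h⟩ := hT.sec hx hQ
  obtain ⟨P, hP, hne, l', h'⟩ := hT.next hx hQ h
  exact ⟨P, hQ, hP, hne.symm, r, l, l', h, h'⟩

theorem Mono.prv_ex (hT : Mono T) {x : ℂ} (hx : x ∈ Vx T) {Q : Set ℂ} (hQ : Q ∈ Co T x) :
    ∃ P, Nxt T x P Q := by
  obtain ⟨r, l, h⟩ := hT.sec hx hQ
  obtain ⟨P, hP, hne, r', h'⟩ := hT.prev hx hQ h
  exact ⟨P, hP, hQ, hne, r', r, l, h', h⟩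

theorem Nxt.right (hT : Mono T) {x : ℂ} {Q P P' : Set ℂ} (h : Nxt T x Q P) (h' : Nxt T x Q P') : P = P' := by
  obtain ⟨-, hP, -, r, l, l1, h1, h2⟩ := h
  obtain ⟨-, hP', -, r', l', l1', h1', h2'⟩ := h'
  obtain ⟨-, e⟩ := h1.unique h1' rfl
  subst e
  exact hT.r_inj hP hP' h2 h2'

theorem Nxt.left (hT : Mono T) {x : ℂ} {Q Q' P : Set ℂ} (h : Nxt T x Q P) (h' : Nxt T x Q' P) : Q = Q' := by
  obtain ⟨hQ, -, -, r, l, l1, h1, h2⟩ := h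
  obtain ⟨hQ', -, -, r', l', l1', h1', h2'⟩ := h'
  obtain ⟨e, -⟩ := h2.unique h2' rfl
  subst e
  exact hT.l_inj hQ hQ' h1 h1'

theorem Nxt.smul {x y : ℂ} {Q P : Set ℂ} (h : Nxt T x Q P) (g : Mo) (hg : g • x = y)
    (h1 : g • Q ∈ Co T y) (h2 : g • P ∈ Co T y) : Nxt T y (g • Q) (g • P) := by
  obtain ⟨-, -, hne, r, l, l', e1, e2⟩ := h
  subst hg
  exact ⟨h1, h2, fun e => hne (smul_left_cancel g e), _, _, _, e1.smul g, e2.smul g⟩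

theorem Mono.share (hT : Mono T) {x y : ℂ} (hx : x ∈ Vx T) {P Q : Set ℂ} (hP : P ∈ Co T x) (hQ : Q ∈ Co T x)
    (hne : P ≠ Q) (hy : y ≠ x) (h1 : y ∈ P) (h2 : y ∈ Q) : Nxt T x P Q ∨ Nxt T x Q P := by
  obtain ⟨r, l, h⟩ := hT.sec hx hP
  obtain ⟨r', l', h'⟩ := hT.sec hx hQ
  have hy0 : ‖y - x‖ ≠ 0 := by rw [norm_ne_zero_iff]; exact sub_ne_zero.2 hy
  have hpos : 0 < ‖y - x‖⁻¹ := by positivity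
  have hn : ‖((‖y - x‖⁻¹ : ℝ) : ℂ) * (y - x)‖ = 1 := by
    rw [norm_mul, Complex.norm_real, Real.norm_of_nonneg hpos.le, inv_mul_cancel₀ hy0]
  rcases hT.adj_dir hP hQ hne h h' (Kc_real (Kc_sub h1) hpos) (Kc_real (Kc_sub h2) hpos) hn with ⟨e1, e2⟩ | ⟨e1, e2⟩
  · left
    rw [e1] at e2; subst e2
    exact ⟨hP, hQ, hne, _, _, _, h, h'⟩
  · right
    rw [e1] at e2; subst e2
    exact ⟨hQ, hP, hne.symm, _, _, _, h', h⟩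

theorem Mono.cyc (hT : Mono T) {x : ℂ} (hx : x ∈ Vx T) {A : Set (Set ℂ)} (hA : A ⊆ Co T x) (hne : A.Nonempty)
    (hc : ∀ Q ∈ A, ∀ P, Nxt T x Q P → P ∈ A) : A = Co T x := by
  classical
  have hfin : A.Finite := (hT.finCo x).subset hA
  have hex : ∀ Q : Set ℂ, ∃ P, Q ∈ A → Nxt T x Q P := by
    intro Q
    by_cases h : Q ∈ A
    · obtain ⟨P, hP⟩ := hT.nxt_ex hx (hA h)
      exact ⟨P, fun _ => hP⟩
    · exact ⟨∅, fun h' => absurd h' h⟩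
  choose f hf using hex
  have hmaps : MapsTo f A A := fun Q hQ => hc Q hQ _ (hf Q hQ)
  have hinj : InjOn f A := by
    intro Q hQ Q' hQ' e
    have h1 := hf Q hQ
    have h2 := hf Q' hQ'
    rw [← e] at h2
    exact h1.left hT h2
  have hsurj : SurjOn f A A := by
    have := Finset.surjOn_of_injOn_of_card_le (s := hfin.toFinset) (t := hfin.toFinset) f
      (by simpa using hmaps) (by simpa using hinj) le_rfl
    simpa using this
  have hp : ∀ Q ∈ A, ∀ P, Nxt T x P Q → P ∈ A := by
    intro Q hQ P hP
    obtain ⟨Q', hQ', e⟩ := hsurj hQ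
    have := hf Q' hQ'
    rw [e] at this
    rw [hP.left hT this]; exact hQ'
  by_contra hcon
  obtain ⟨B, hB, hBA⟩ : ∃ B ∈ Co T x, B ∉ A := by
    by_contra! h
    exact hcon (Subset.antisymm hA h)
  let U : Set ℂ := ⋃ Q ∈ A, Kc Q x
  let W : Set ℂ := ⋃ Q ∈ (Co T x \ A), Kc Q x
  have hU : IsClosed U := hfin.isClosed_biUnion (fun Q hQ => hT.Kc_closed hx (hA hQ))
  have hW : IsClosed W := ((hT.finCo x).subset sdiff_subset).isClosed_biUnion (fun Q hQ => hT.Kc_closed hx hQ.1)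
  have hconn : IsPreconnected (Metric.sphere (0 : ℂ) 1) :=
    isPreconnected_sphere (by rw [Complex.rank_real_complex]; norm_num) 0 1
  have hin : ∀ Q ∈ Co T x, ∃ d ∈ Metric.sphere (0:ℂ) 1, d ∈ Kc Q x := by
    intro Q hQ
    obtain ⟨r, l, h⟩ := hT.sec hx hQ
    exact ⟨r, by simpa using h.nr, h.r_mem⟩
  obtain ⟨A0, hA0⟩ := hne
  have key := (isPreconnected_closed_iff.1 hconn) U W hU hW (by
      intro d _
      obtain ⟨Q, hQ, hd⟩ := hT.cone_cover x d
      by_cases h : Q ∈ A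
      · exact Or.inl (mem_iUnion₂.2 ⟨Q, h, hd⟩)
      · exact Or.inr (mem_iUnion₂.2 ⟨Q, ⟨hQ, h⟩, hd⟩))
    (by obtain ⟨d, h1, h2⟩ := hin A0 (hA hA0); exact ⟨d, h1, mem_iUnion₂.2 ⟨A0, hA0, h2⟩⟩)
    (by obtain ⟨d, h1, h2⟩ := hin B hB; exact ⟨d, h1, mem_iUnion₂.2 ⟨B, ⟨hB, hBA⟩, h2⟩⟩)
  obtain ⟨d, hd, hdU, hdW⟩ := key
  obtain ⟨P, hP, hdP⟩ := mem_iUnion₂.1 hdU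
  obtain ⟨Q, hQ, hdQ⟩ := mem_iUnion₂.1 hdW
  have hPQ : P ≠ Q := by rintro rfl; exact hQ.2 hP
  obtain ⟨r, l, h⟩ := hT.sec hx (hA hP)
  obtain ⟨r', l', h'⟩ := hT.sec hx hQ.1
  rcases hT.adj_dir (hA hP) hQ.1 hPQ h h' hdP hdQ (by simpa using hd) with ⟨e1, e2⟩ | ⟨e1, e2⟩
  · rw [e1] at e2; subst e2
    exact hQ.2 (hc P hP Q ⟨hA hP, hQ.1, hPQ, _, _, _, h, h'⟩)
  · rw [e1] at e2; subst e2
    exact hQ.2 (hp P hP Q ⟨hQ.1, hA hP, hPQ.symm, _, _, _, h', h⟩)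

theorem Mono.meet_vx (hT : Mono T) {P Q : Set ℂ} (hP : P ∈ T) (hQ : Q ∈ T) (hne : P ≠ Q)
    (hm : (P ∩ Q).Nonempty) : ∃ v ∈ P ∩ Q, v ∈ Vx T := by
  have hcomp : IsCompact (P ∩ Q) := (hT.poly P hP).comp.inter (hT.poly Q hQ).comp
  obtain ⟨v, hv⟩ := hcomp.extremePoints_nonempty hm
  refine ⟨v, hv.1, ?_⟩
  by_contra hn
  have hPC : P ∈ Co T v := ⟨hP, hv.1.1⟩
  have hQC : Q ∈ Co T v := ⟨hQ, hv.1.2⟩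
  obtain ⟨r, l, h⟩ := exists_sec (hT.poly P hP) hv.1.1 (hT.not_int hPC hQC hne)
  obtain ⟨r', l', h'⟩ := exists_sec (hT.poly Q hQ) hv.1.2 (hT.not_int hQC hPC hne.symm)
  have f := h.not_ext (hT.poly P hP).conv hv.1.1 (fun he => hn ⟨P, hP, he⟩)
  have f' := h'.not_ext (hT.poly Q hQ).conv hv.1.2 (fun he => hn ⟨Q, hQ, he⟩)
  have key : ∀ d ∈ Kc P v, -d ∈ Kc P v → d ∈ Kc Q v → -d ∈ Kc Q v → d ≠ 0 → False := by
    rintro d ⟨a, ha, ha'⟩ ⟨b, hb, hb'⟩ ⟨c, hc, hc'⟩ ⟨e, he, he'⟩ hd0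
    set m := min (min a b) (min c e) with hm
    have hm0 : 0 < m := by simp [hm, ha, hb, hc, he]
    have m1 : m ≤ a := (min_le_left _ _).trans (min_le_left _ _)
    have m2 : m ≤ b := (min_le_left _ _).trans (min_le_right _ _)
    have m3 : m ≤ c := (min_le_right _ _).trans (min_le_left _ _)
    have m4 : m ≤ e := (min_le_right _ _).trans (min_le_right _ _)
    have p1 := Kc_small (hT.poly P hP).conv hv.1.1 hm0.le m1 ha'
    have p2 := Kc_small (hT.poly P hP).conv hv.1.1 hm0.le m2 hb'
    have p3 := Kc_small (hT.poly Q hQ).conv hv.1.2 hm0.le m3 hc'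
    have p4 := Kc_small (hT.poly Q hQ).conv hv.1.2 hm0.le m4 he'
    have := hv.2 ⟨p1, p3⟩ ⟨p2, p4⟩ ⟨1/2, 1/2, by norm_num, by norm_num, by norm_num, by
      simp only [Complex.real_smul]; push_cast; ring⟩
    have hm' : (m : ℂ) ≠ 0 := by exact_mod_cast hm0.ne'
    have h5 : (m : ℂ) * d = 0 := by linear_combination this
    rcases mul_eq_zero.1 h5 with h | h
    · exact hm' h
    · exact hd0 h
  by_cases hc : r ∈ Kc Q v
  · rcases hT.adj_dir hPC hQC hne h h' h.r_mem hc h.nr with ⟨e, -⟩ | ⟨-, e⟩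
    · exact h.ne e.symm
    · have e' : -r = r' := by rw [e, f']; ring
      exact key r h.r_mem (by rw [← f]; exact h.l_mem) hc (by rw [e']; exact h'.r_mem) h.r0
  · have hc2 : l ∈ Kc Q v := by
      rw [f, h'.eq, Sec_flat f']
      rw [h'.eq, Sec_flat f'] at hc
      simp only [mem_ofPred_eq, not_le] at hc ⊢
      rw [cr_neg_right]; linarith
    rcases hT.adj_dir hPC hQC hne h h' h.l_mem hc2 h.nl with ⟨-, e⟩ | ⟨e, -⟩
    · have e' : r = l' := by rw [f', ← e, f]; ring
      exact hc (by rw [e']; exact h'.l_mem)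
    · exact h.ne e



theorem frontier_conn {Q : Set ℂ} (hQ : Pgon Q) : IsPreconnected (frontier Q) := by
  obtain ⟨e, -, -, h⟩ := exists_homeomorph_image_interior_closure_frontier_eq_unitBall hQ.conv hQ.ne hQ.comp.isBounded
  have hconn : IsPreconnected (Metric.sphere (0 : ℂ) 1) :=
    isPreconnected_sphere (by rw [Complex.rank_real_complex]; norm_num) 0 1
  rw [← h] at hconn
  exact (e.isPreconnected_image).1 hconn

theorem Mono.connected (hT : Mono T) {D : Set ℂ} (hne : ∃ x ∈ D, x ∈ Vx T)
    (hD : ∀ x ∈ D, x ∈ Vx T → ∀ P ∈ Co T x, ∀ Q ∈ Co T x, P ≠ Q → ∀ z ∈ Vx T, z ∈ P → z ∈ Q → z ∈ D) :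
    ∀ x ∈ Vx T, x ∈ D := by
  -- each tile is good or bad
  have tile : ∀ Q ∈ T, (∀ x ∈ Vx T, x ∈ Q → x ∈ D) ∨ (∀ x ∈ Vx T, x ∈ Q → x ∉ D) := by
    intro Q hQ
    by_contra! hcon
    obtain ⟨⟨w, hwV, hwQ, hwD⟩, ⟨v, hvV, hvQ, hvD⟩⟩ := hcon
    have hQp := hT.poly Q hQ
    let F : (ℂ → Prop) → Set (Set ℂ) := fun p => {P | P ∈ T ∧ P ≠ Q ∧ ∃ x ∈ Vx T, x ∈ P ∧ x ∈ Q ∧ p x}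
    let U : (ℂ → Prop) → Set ℂ := fun p => ⋃ P ∈ F p, P
    have hFfin : ∀ p, (F p).Finite := by
      intro p
      obtain ⟨R, hR⟩ := hQp.comp.isBounded.subset_closedBall 0
      refine (hT.fin_meet 0 R).subset ?_
      rintro P ⟨hP, -, x, -, hx1, hx2, -⟩
      exact ⟨hP, x, hx1, hR hx2⟩
    have hcl : ∀ p, IsClosed (U p) := fun p => (hFfin p).isClosed_biUnion
      (fun P hP => (hT.poly P hP.1).comp.isClosed)
    have hfr : ∀ x ∈ Vx T, x ∈ Q → x ∈ frontier Q ∧ ∀ p : ℂ → Prop, p x → x ∈ U p := by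
      intro x hx hxQ
      have hni : x ∉ interior Q := by
        obtain ⟨P, hP, hxP⟩ := hx
        by_cases h : Q = P
        · subst h; exact ext_notMem_interior hxP
        · exact hT.not_int ⟨hQ, hxQ⟩ ⟨hP, hxP.1⟩ h
      refine ⟨⟨subset_closure hxQ, hni⟩, ?_⟩
      intro p hp
      obtain ⟨P, hP, hPQ⟩ := hT.frontier_other ⟨hQ, hxQ⟩ hni
      exact mem_iUnion₂.2 ⟨P, ⟨hP.1, hPQ, x, hx, hP.2, hxQ, hp⟩, hP.2⟩
    have key := (isPreconnected_closed_iff.1 (frontier_conn hQp)) (U (· ∈ D)) (U (· ∉ D)) (hcl _) (hcl _)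
      (by
        intro y hy
        have hyQ : y ∈ Q := by
          have := hy.1; rwa [hQp.comp.isClosed.closure_eq] at this
        obtain ⟨P, hP, hPQ⟩ := hT.frontier_other ⟨hQ, hyQ⟩ hy.2
        obtain ⟨x, hx, hxV⟩ := hT.meet_vx hP.1 hQ hPQ ⟨y, hP.2, hyQ⟩
        by_cases h : x ∈ D
        · exact Or.inl (mem_iUnion₂.2 ⟨P, ⟨hP.1, hPQ, x, hxV, hx.1, hx.2, h⟩, hP.2⟩)
        · exact Or.inr (mem_iUnion₂.2 ⟨P, ⟨hP.1, hPQ, x, hxV, hx.1, hx.2, h⟩, hP.2⟩))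
      ⟨v, (hfr v hvV hvQ).1, (hfr v hvV hvQ).2 _ hvD⟩ ⟨w, (hfr w hwV hwQ).1, (hfr w hwV hwQ).2 _ hwD⟩
    obtain ⟨y, hy, h1, h2⟩ := key
    have hyQ : y ∈ Q := by
      have := hy.1; rwa [hQp.comp.isClosed.closure_eq] at this
    obtain ⟨P, ⟨hP, hPQ, a, haV, haP, haQ, haD⟩, hyP⟩ := mem_iUnion₂.1 h1
    obtain ⟨P', ⟨hP', hPQ', b, hbV, hbP, hbQ, hbD⟩, hyP'⟩ := mem_iUnion₂.1 h2
    by_cases e : P = P'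
    · subst e
      exact hbD (hD a haD haV P ⟨hP, haP⟩ Q ⟨hQ, haQ⟩ hPQ b hbV hbP hbQ)
    · have hyV : y ∈ Vx T := hT.vx_three ⟨hQ, hyQ⟩ ⟨hP, hyP⟩ ⟨hP', hyP'⟩ hPQ.symm hPQ'.symm e
      have hyD := hD a haD haV P ⟨hP, haP⟩ Q ⟨hQ, haQ⟩ hPQ y hyV hyP hyQ
      exact hbD (hD y hyD hyV P' ⟨hP', hyP'⟩ Q ⟨hQ, hyQ⟩ hPQ' b hbV hbP hbQ)
  intro w hw
  by_contra hwD
  obtain ⟨v, hvD, hvV⟩ := hne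
  let G : Bool → Set (Set ℂ) := fun b => {Q | Q ∈ T ∧ ∀ x ∈ Vx T, x ∈ Q → (x ∈ D ↔ b = true)}
  have hcl : ∀ b, IsClosed (⋃ Q : G b, (Q : Set ℂ)) := by
    intro b
    apply LocallyFinite.isClosed_iUnion
    · intro x
      refine ⟨Metric.ball x 1, Metric.ball_mem_nhds x one_pos, ?_⟩
      have := hT.fin_meet x 1
      refine Set.Finite.of_finite_image (f := Subtype.val) (this.subset ?_) Subtype.val_injective.injOn
      rintro Q ⟨⟨Q', hQ'⟩, ⟨z, hz1, hz2⟩, rfl⟩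
      exact ⟨hQ'.1, z, hz1, (Metric.mem_ball.1 hz2).le⟩
    · rintro ⟨Q, hQ⟩
      exact (hT.poly Q hQ.1).comp.isClosed
  have hG : ∀ Q ∈ T, Q ∈ G true ∨ Q ∈ G false := by
    intro Q hQ
    rcases tile Q hQ with h | h
    · exact Or.inl ⟨hQ, fun x hx hxQ => by simp [h x hx hxQ]⟩
    · exact Or.inr ⟨hQ, fun x hx hxQ => by simp [h x hx hxQ]⟩
  have hin : ∀ x ∈ Vx T, ∀ b, (x ∈ D ↔ b = true) → x ∈ ⋃ Q : G b, (Q : Set ℂ) := by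
    rintro x ⟨Q, hQ, hx⟩ b hb
    rcases hG Q hQ with h | h
    · have := (h.2 x ⟨Q, hQ, hx⟩ hx.1)
      have e : b = true := by rw [← hb]; simpa using this
      subst e
      exact mem_iUnion.2 ⟨⟨Q, h⟩, hx.1⟩
    · have := (h.2 x ⟨Q, hQ, hx⟩ hx.1)
      have e : b = false := by
        cases b
        · rfl
        · exact absurd (hb.2 rfl) (by simpa using this)
      subst e
      exact mem_iUnion.2 ⟨⟨Q, h⟩, hx.1⟩
  have key := (isPreconnected_closed_iff.1 (isPreconnected_univ (α := ℂ))) _ _ (hcl true) (hcl false)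
    (by
      intro z _
      obtain ⟨Q, hQ, hz⟩ := hT.cov z
      rcases hG Q hQ with h | h
      · exact Or.inl (mem_iUnion.2 ⟨⟨Q, h⟩, hz⟩)
      · exact Or.inr (mem_iUnion.2 ⟨⟨Q, h⟩, hz⟩))
    ⟨v, trivial, hin v hvV true (by simp [hvD])⟩ ⟨w, trivial, hin w hw false (by simp [hwD])⟩
  obtain ⟨z, -, h1, h2⟩ := key
  obtain ⟨⟨P, hP⟩, hzP⟩ := mem_iUnion.1 h1
  obtain ⟨⟨Q, hQ⟩, hzQ⟩ := mem_iUnion.1 h2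
  have hPQ : P ≠ Q := by
    rintro rfl
    obtain ⟨x, hx⟩ := (hT.poly P hP.1).ext_ne
    have a := hP.2 x ⟨P, hP.1, hx⟩ hx.1
    have b := hQ.2 x ⟨P, hP.1, hx⟩ hx.1
    simp at a b
    exact b a
  obtain ⟨x, hx, hxV⟩ := hT.meet_vx hP.1 hQ.1 hPQ ⟨z, hzP, hzQ⟩
  have a := hP.2 x hxV hx.1
  have b := hQ.2 x hxV hx.2
  simp at a b
  exact b a



/-- vertices whose corona is mapped by `g` to a corona -/
def Dg (T : Set (Set ℂ)) (g : Mo) : Set ℂ := {y | y ∈ Vx T ∧ g • y ∈ Vx T ∧ g • Co T y = Co T (g • y)}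

theorem Dg_known {g : Mo} {x : ℂ} (hx : x ∈ Dg T g) {Q : Set ℂ} (hQ : Q ∈ Co T x) : g • Q ∈ T := by
  have : g • Q ∈ g • Co T x := Set.smul_mem_smul_set hQ
  rw [hx.2.2] at this
  exact this.1

theorem sub_all (hT : Mono T) {g : Mo} (h : ∀ Q ∈ T, g • Q ∈ T) : g • T = T := by
  apply Subset.antisymm
  · rintro _ ⟨Q, hQ, rfl⟩
    exact h Q hQ
  · intro P hP
    obtain ⟨p, hp⟩ := (hT.poly P hP).ne
    obtain ⟨Q, hQ, hq⟩ := hT.cov (g⁻¹ • p)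
    have hpQ : p ∈ g • Q := by rwa [Set.mem_smul_set_iff_inv_smul_mem]
    by_cases e : P = g • Q
    · rw [e]; exact Set.smul_mem_smul_set hQ
    · exact absurd hp (hT.not_int ⟨hP, interior_subset hp⟩ ⟨h Q hQ, hpQ⟩ e)

theorem Dg_all (hT : Mono T) {g : Mo} (h : ∀ x ∈ Vx T, x ∈ Dg T g) : g • T = T := by
  apply sub_all hT
  intro Q hQ
  obtain ⟨v, hv⟩ := (hT.poly Q hQ).ext_ne
  exact Dg_known (h v ⟨Q, hQ, hv⟩) ⟨hQ, hv.1⟩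

theorem Mono.prop (hT : Mono T) {g : Mo} {z : ℂ} (hz : z ∈ Vx T) {K : Set (Set ℂ)} (hK : K ⊆ Co T z)
    (hg : ∀ Q ∈ K, g • Q ∈ T) (he : ∃ Q ∈ K, z ∈ extremePoints ℝ Q)
    (hr : ∀ ρ : Mo, ρ • z = z → (∀ Q ∈ K, ρ • Q ∈ Co T z) → ρ • Co T z = Co T z) : z ∈ Dg T g := by
  obtain ⟨Q, hQ, hzQ⟩ := he
  have hgz : g • z ∈ Vx T := by
    refine ⟨g • Q, hg Q hQ, ?_⟩
    rw [← Mo.smul_extremePoints]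
    exact Set.smul_mem_smul_set hzQ
  obtain ⟨h, h1, h2⟩ := hT.mono (g • z) hgz z hz
  have := hr (h * g) (by rw [mul_smul, h1]) (by
    intro P hP
    rw [mul_smul, ← h2]
    exact Set.smul_mem_smul_set ⟨hg P hP, Set.smul_mem_smul_set (hK hP).2⟩)
  refine ⟨hz, hgz, ?_⟩
  rw [mul_smul] at this
  exact smul_left_cancel h (this.trans h2.symm)

/-- rigid pair of tiles at a vertex -/
def Rig (T : Set (Set ℂ)) (z : ℂ) (P Q : Set ℂ) : Prop :=
  ∀ ρ : Mo, ρ • z = z → ρ • P ∈ Co T z → ρ • Q ∈ Co T z → ρ • Co T z = Co T z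

theorem Rig.symm {z : ℂ} {P Q : Set ℂ} (h : Rig T z P Q) : Rig T z Q P :=
  fun ρ h1 h2 h3 => h ρ h1 h3 h2

theorem Mono.step (hT : Mono T) {g : Mo} {x z : ℂ} (hx : x ∈ Dg T g) {P Q : Set ℂ} (hP : P ∈ Co T x)
    (hQ : Q ∈ Co T x) (hne : P ≠ Q) (hz : z ∈ Vx T) (hzP : z ∈ P) (hzQ : z ∈ Q) (hr : Rig T z P Q) :
    z ∈ Dg T g := by
  refine hT.prop hz (K := {P, Q}) ?_ ?_ ?_ ?_
  · rintro R (rfl | rfl)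
    · exact ⟨hP.1, hzP⟩
    · exact ⟨hQ.1, hzQ⟩
  · rintro R (rfl | rfl)
    · exact Dg_known hx hP
    · exact Dg_known hx hQ
  · rcases hT.ext_or hz ⟨hP.1, hzP⟩ ⟨hQ.1, hzQ⟩ hne with h | h
    · exact ⟨P, by simp, h⟩
    · exact ⟨Q, by simp, h⟩
  · intro ρ h1 h2
    exact hr ρ h1 (h2 P (by simp)) (h2 Q (by simp))

/-- all corona maps are symmetries -/
def AllSym (T : Set (Set ℂ)) : Prop :=
  ∀ x ∈ Vx T, ∀ y ∈ Vx T, ∀ f : Mo, f • x = y → f • Co T x = Co T y → f • T = T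

/-- closure under nonrigid steps suffices -/
theorem Mono.allSym (hT : Mono T)
    (h : ∀ g : Mo, ∀ x ∈ Dg T g, ∀ P ∈ Co T x, ∀ Q ∈ Co T x, P ≠ Q → ∀ z ∈ Vx T, z ≠ x → z ∈ P → z ∈ Q →
      ¬ Rig T z P Q → z ∈ Dg T g) : AllSym T := by
  intro x hx y hy f h1 h2
  apply Dg_all hT
  apply hT.connected (D := Dg T f) ⟨x, ⟨hx, by rwa [h1], by rw [h1, h2]⟩, hx⟩
  intro v hv hvV P hP Q hQ hne z hz hzP hzQ
  by_cases e : z = v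
  · rwa [e]
  by_cases hr : Rig T z P Q
  · exact hT.step hv hP hQ hne hz hzP hzQ hr
  · exact h f v hv P hP Q hQ hne z hz e hzP hzQ hr

theorem Vx_smul {g : Mo} (hg : g • T = T) {x : ℂ} (hx : x ∈ Vx T) : g • x ∈ Vx T := by
  obtain ⟨P, hP, h⟩ := hx
  refine ⟨g • P, ?_, ?_⟩
  · rw [← hg]; exact Set.smul_mem_smul_set hP
  · rw [← Mo.smul_extremePoints]; exact Set.smul_mem_smul_set h

theorem smul_int (g : Mo) (Q : Set ℂ) : interior (g • Q) = g • interior Q := interior_smul g Q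

theorem Mono.final (hT : Mono T) (hA : AllSym T) : ∃ g : Mo, g.a ≠ 1 ∧ g • T = T := by
  by_contra! hcon
  obtain ⟨x0, hx0⟩ := hT.vx_ne
  have htr : ∀ x ∈ Vx T, ∀ y ∈ Vx T, Mo.tr (y - x) • T = T := by
    intro x hx y hy
    obtain ⟨f, h1, h2⟩ := hT.mono x hx y hy
    have h3 := hA x hx y hy f h1 h2
    have ha : f.a = 1 := by
      by_contra h; exact hcon f h h3
    have : f = Mo.tr (y - x) := by
      apply Mo.ext
      · rw [ha]; rfl
      · rw [Mo.smul_def, ha] at h1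
        simp at h1
        show f.b = y - x
        rw [← h1]; ring
    rwa [this] at h3
  let g := Mo.refl x0
  have gg : ∀ z : ℂ, g • g • z = z := by
    intro z; simp only [g, Mo.refl_smul]; ring
  -- the skeleton
  let S : Set ℂ := {p | ∃ Q ∈ T, p ∈ Q ∧ p ∉ interior Q}
  have hStr : ∀ v : ℂ, Mo.tr v • T = T → ∀ p ∈ S, p + v ∈ S := by
    rintro v hv p ⟨Q, hQ, h1, h2⟩
    refine ⟨Mo.tr v • Q, ?_, ?_, ?_⟩
    · rw [← hv]; exact Set.smul_mem_smul_set hQ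
    · rw [← Mo.tr_smul]; exact Set.smul_mem_smul_set h1
    · rw [smul_int, ← Mo.tr_smul, Set.smul_mem_smul_set_iff]; exact h2
  have hS : ∀ p ∈ S, g • p ∈ S := by
    rintro p ⟨Q, hQ, h1, h2⟩
    by_cases he : p ∈ extremePoints ℝ Q
    · have := hStr _ (htr p ⟨Q, hQ, he⟩ x0 hx0) x0
        (by obtain ⟨P, hP, h⟩ := hx0; exact ⟨P, hP, h.1, ext_notMem_interior h⟩)
      convert this using 1
      simp only [g, Mo.refl_smul]; ring
    · obtain ⟨r, l, h⟩ := exists_sec (hT.poly Q hQ) h1 h2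
      have hl := h.not_ext (hT.poly Q hQ).conv h1 he
      obtain ⟨t, ht, hte⟩ := h.er
      obtain ⟨s, hs, hse⟩ := h.el
      rw [hl] at hse
      have v1 := htr _ ⟨Q, hQ, hte⟩ x0 hx0
      have v2 := htr _ ⟨Q, hQ, hse⟩ x0 hx0
      have hq : p + ((t - s : ℝ) : ℂ) * r ∈ S := by
        refine ⟨Q, hQ, ?_, ?_⟩
        · by_cases hle : s ≤ t
          · exact Kc_small (hT.poly Q hQ).conv h1 (by linarith) (by linarith) hte.1
          · have := Kc_small (hT.poly Q hQ).conv h1 (δ := s - t) (by linarith) (by linarith) hse.1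
            convert this using 2
            push_cast; ring
        · intro hi
          have : (((t - s : ℝ) : ℂ) * r) ∈ interior (Kc Q p) := by
            have ho : IsOpen ((fun z : ℂ => p + z) ⁻¹' interior Q) := isOpen_interior.preimage (by fun_prop)
            refine interior_maximal (t := (fun z : ℂ => p + z) ⁻¹' interior Q) ?_ ho hi
            intro d hd
            have := Kc_sub (x := p) (interior_subset hd)
            simpa using this
          rw [h.eq, Sec_flat hl] at this
          have h3 : ∀ᶠ ε : ℝ in nhds 0, ((t - s : ℝ) : ℂ) * r - ε * (Complex.I * r) ∈ interior {d | 0 ≤ cr r d} := by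
            have : Continuous (fun ε : ℝ => ((t - s : ℝ) : ℂ) * r - ε * (Complex.I * r)) := by fun_prop
            apply this.continuousAt
            simp only [Complex.ofReal_zero, zero_mul, sub_zero]
            exact isOpen_interior.mem_nhds ‹_›
          have h4 := (h3.filter_mono (nhdsWithin_le_nhds (s := Ioi 0))).and self_mem_nhdsWithin
          obtain ⟨ε, h5, h6⟩ := h4.exists
          have h7 := interior_subset h5
          simp only [mem_ofPred_eq, cr_sub_right, cr_real_right, cr_self] at h7
          nlinarith [cr_I_pos h.r0, (show (0:ℝ) < ε from h6)]
      have := hStr _ v2 _ (hStr _ v1 _ hq)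
      convert this using 1
      simp only [g, Mo.refl_smul]; push_cast; ring
  have hsubP : ∀ Q ∈ T, ∃ P ∈ T, g • interior Q ⊆ interior P := by
    intro Q hQ
    have hcov : ∀ z ∈ g • interior Q, ∃ P ∈ T, z ∈ interior P := by
      rintro _ ⟨w, hw, rfl⟩
      obtain ⟨P, hP, hz⟩ := hT.cov (g • w)
      by_cases hi : g • w ∈ interior P
      · exact ⟨P, hP, hi⟩
      · exfalso
        obtain ⟨R, hR, h1, h2⟩ := hS _ ⟨P, hP, hz, hi⟩
        rw [gg] at h1 h2
        by_cases e : Q = R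
        · subst e; exact h2 hw
        · exact hT.not_int ⟨hQ, interior_subset hw⟩ ⟨hR, h1⟩ e hw
    obtain ⟨w, hw⟩ := (hT.poly Q hQ).ne
    obtain ⟨P, hP, hwP⟩ := hcov (g • w) (Set.smul_mem_smul_set hw)
    refine ⟨P, hP, ?_⟩
    have hpre : IsPreconnected (g • interior Q) := by
      rw [← smul_int]
      exact ((hT.poly Q hQ).smul g).conv.interior.isPreconnected
    refine hpre.subset_left_of_subset_union (v := ⋃ R ∈ T \ {P}, interior R) isOpen_interior
      (isOpen_biUnion fun _ _ => isOpen_interior) ?_ ?_ ⟨_, Set.smul_mem_smul_set hw, hwP⟩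
    · rw [Set.disjoint_left]
      intro z hz hz'
      obtain ⟨R, hR, hzR⟩ := mem_iUnion₂.1 hz'
      exact hR.2 (hT.dis R hR.1 P hP z hzR hz)
    · intro z hz
      obtain ⟨R, hR, hzR⟩ := hcov z hz
      by_cases e : R = P
      · subst e; exact Or.inl hzR
      · exact Or.inr (mem_iUnion₂.2 ⟨R, ⟨hR, e⟩, hzR⟩)
  have hgT : ∀ Q ∈ T, g • Q ∈ T := by
    intro Q hQ
    obtain ⟨P, hP, h1⟩ := hsubP Q hQ
    obtain ⟨R, hR, h2⟩ := hsubP P hP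
    have h3 : ∀ z ∈ interior Q, z ∈ interior R := by
      intro z hz
      have := h2 (Set.smul_mem_smul_set (h1 (Set.smul_mem_smul_set hz)))
      rwa [gg] at this
    obtain ⟨w, hw⟩ := (hT.poly Q hQ).ne
    have e := hT.dis Q hQ R hR w hw (h3 w hw)
    subst e
    have h4 : interior (g • Q) = interior P := by
      rw [smul_int]
      refine Subset.antisymm h1 ?_
      intro z hz
      have := h2 (Set.smul_mem_smul_set hz)
      rw [← gg z]
      exact Set.smul_mem_smul_set this
    have cl : ∀ P : Set ℂ, Pgon P → closure (interior P) = P := by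
      intro P hP
      rw [hP.conv.closure_interior_eq_closure_of_nonempty_interior hP.ne, hP.comp.isClosed.closure_eq]
    rw [← cl _ ((hT.poly Q hQ).smul g), h4, cl _ (hT.poly P hP)]
    exact hP
  refine hcon g ?_ (sub_all hT hgT)
  intro h
  have h0 : g • (x0 + 1) = x0 + 1 := by
    have h1 : g • x0 = x0 := by simp only [g, Mo.refl_smul]; ring
    have := Mo.smul_sub' g (x0 + 1) x0
    rw [h1, h] at this
    simp at this
    linear_combination this
  simp only [g, Mo.refl_smul] at h0
  have : (2 : ℂ) = 0 := by linear_combination -h0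
  norm_num at this



open Classical in
/-- sum of a weight over the flags at a vertex -/
def Mono.fs (hT : Mono T) (φ : Set ℂ → ℂ → ℝ) (z : ℂ) : ℝ :=
  ∑ Q ∈ hT.cof z, if z ∈ extremePoints ℝ Q then φ Q z else 0

theorem ext_smul_iff (g : Mo) (Q : Set ℂ) (z : ℂ) : g • z ∈ extremePoints ℝ (g • Q) ↔ z ∈ extremePoints ℝ Q := by
  rw [← Mo.smul_extremePoints, Set.smul_mem_smul_set_iff]

theorem Mono.fs_eq (hT : Mono T) {φ : Set ℂ → ℂ → ℝ} (hφ : ∀ (g : Mo) Q v, φ (g • Q) (g • v) = φ Q v)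
    {z w : ℂ} (hz : z ∈ Vx T) (hw : w ∈ Vx T) : hT.fs φ z = hT.fs φ w := by
  classical
  obtain ⟨g, hg, hC⟩ := hT.mono z hz w hw
  unfold Mono.fs
  refine Finset.sum_nbij (fun Q => g • Q) ?_ ?_ ?_ ?_
  · intro Q hQ
    rw [hT.mem_cof] at hQ ⊢
    rw [← hC]; exact Set.smul_mem_smul_set hQ
  · intro Q _ Q' _ h
    exact smul_left_cancel g h
  · intro P hP
    have hP' := hT.mem_cof.1 (Finset.mem_coe.1 hP)
    rw [← hC] at hP'
    obtain ⟨Q, hQ, rfl⟩ := hP'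
    exact ⟨Q, by simpa using hT.mem_cof.2 hQ, rfl⟩
  · intro Q hQ
    rw [← hg, hφ]
    simp only [ext_smul_iff]

theorem Mono.nc_bdd (hT : Mono T) : ∃ K : ℕ, ∀ Q ∈ T, nc Q ≤ K := by
  obtain ⟨x, hx⟩ := hT.vx_ne
  refine ⟨∑ P ∈ hT.cof x, nc P, ?_⟩
  intro Q hQ
  obtain ⟨v, hv⟩ := (hT.poly Q hQ).ext_ne
  obtain ⟨g, hg, hC⟩ := hT.mono v ⟨Q, hQ, hv⟩ x hx
  rw [← nc_smul g]
  refine Finset.single_le_sum (f := nc) (fun _ _ => Nat.zero_le _) ?_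
  rw [hT.mem_cof, ← hC]
  exact Set.smul_mem_smul_set ⟨hQ, hv.1⟩

theorem Mono.vfin (hT : Mono T) (R : ℝ) : {z | z ∈ Vx T ∧ ‖z‖ ≤ R}.Finite := by
  have h := hT.fin_meet 0 R
  have : {z | z ∈ Vx T ∧ ‖z‖ ≤ R} ⊆ ⋃ Q ∈ {Q | Q ∈ T ∧ ∃ z ∈ Q, dist z 0 ≤ R}, extremePoints ℝ Q := by
    rintro z ⟨⟨Q, hQ, hz⟩, hR⟩
    exact mem_iUnion₂.2 ⟨Q, ⟨hQ, z, hz.1, by simpa using hR⟩, hz⟩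
  exact (h.biUnion (fun Q hQ => (hT.poly Q hQ.1).fin)).subset this

theorem Mono.vcount (hT : Mono T) : ∃ A B : ℝ, 0 ≤ A ∧ 0 ≤ B ∧ ∀ R : ℝ, 0 ≤ R →
    ((hT.vfin R).toFinset.card : ℝ) ≤ A * (R + B) ^ 2 := by
  classical
  obtain ⟨K, hK⟩ := hT.nc_bdd
  obtain ⟨d, r, hd, hr, -, h⟩ := hT.count
  refine ⟨K / r ^ 2, d, by positivity, hd.le, ?_⟩
  intro R hR
  set S := (hT.fin_meet 0 R).toFinset with hS
  have h1 := h 0 R hR S (by intro Q hQ; simpa [hS] using hQ)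
  have hmem : ∀ Q ∈ S, Q ∈ T := by intro Q hQ; rw [hS, Set.Finite.mem_toFinset] at hQ; exact hQ.1
  have h2 : (hT.vfin R).toFinset.card ≤ K * S.card := by
    let F : Set ℂ → Finset ℂ := fun Q => if hQ : Q ∈ T then (hT.poly Q hQ).fin.toFinset else ∅
    have hsub : (hT.vfin R).toFinset ⊆ S.biUnion F := by
      intro z hz
      rw [Set.Finite.mem_toFinset] at hz
      obtain ⟨⟨Q, hQ, hzQ⟩, hzR⟩ := hz
      rw [Finset.mem_biUnion]
      refine ⟨Q, ?_, ?_⟩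
      · rw [hS, Set.Finite.mem_toFinset]
        exact ⟨hQ, z, hzQ.1, by simpa using hzR⟩
      · simp only [F, hQ, dif_pos, Set.Finite.mem_toFinset]; exact hzQ
    refine (Finset.card_le_card hsub).trans ?_
    rw [mul_comm]
    refine Finset.card_biUnion_le_card_mul _ _ _ ?_
    intro Q hQ
    simp only [F, hmem Q hQ, dif_pos]
    rw [← Set.ncard_eq_toFinset_card _ (hT.poly Q (hmem Q hQ)).fin]
    exact hK Q (hmem Q hQ)
  have h3 : ((hT.vfin R).toFinset.card : ℝ) ≤ K * S.card := by exact_mod_cast h2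
  refine h3.trans ?_
  rw [div_mul_eq_mul_div, le_div_iff₀ (by positivity), mul_assoc]
  exact mul_le_mul_of_nonneg_left h1 (by positivity)

theorem Mono.fs_abs_le (hT : Mono T) (φ : Set ℂ → ℂ → ℝ) (z : ℂ) : hT.fs φ z ≤ hT.fs (fun Q v => |φ Q v|) z := by
  classical
  unfold Mono.fs
  apply Finset.sum_le_sum
  intro Q _
  split_ifs
  · exact le_abs_self _
  · exact le_rfl

theorem Mono.fs_sum (hT : Mono T) (φ : Set ℂ → ℂ → ℝ) (R : ℝ) (s : Finset ℂ)
    (hs : ∀ z ∈ s, ‖z‖ ≤ R) : ∑ z ∈ s, hT.fs φ z =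
      (open Classical in ∑ Q ∈ (hT.fin_meet 0 R).toFinset, ∑ z ∈ s, if z ∈ extremePoints ℝ Q then φ Q z else 0) := by
  classical
  rw [Finset.sum_comm]
  apply Finset.sum_congr rfl
  intro z hz
  unfold Mono.fs
  have hsub : hT.cof z ⊆ (hT.fin_meet 0 R).toFinset := by
    intro Q hQ
    rw [hT.mem_cof] at hQ
    rw [Set.Finite.mem_toFinset]
    exact ⟨hQ.1, z, hQ.2, by simpa using hs z hz⟩
  rw [← Finset.sum_subset hsub]
  intro Q hQ hn
  rw [if_neg]
  intro he
  rw [Set.Finite.mem_toFinset] at hQ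
  exact hn (hT.mem_cof.2 ⟨hQ.1, he.1⟩)

theorem Mono.mt_le (hT : Mono T) {φ : Set ℂ → ℂ → ℝ} (hφ : ∀ (g : Mo) Q v, φ (g • Q) (g • v) = φ Q v)
    (h0 : ∀ Q (hQ : Q ∈ T), ∑ v ∈ (hT.poly Q hQ).fin.toFinset, φ Q v = 0) {x : ℂ} (hx : x ∈ Vx T) :
    hT.fs φ x ≤ 0 := by
  classical
  by_contra! hC
  set C := hT.fs φ x with hCdef
  set M := hT.fs (fun Q v => |φ Q v|) x with hMdef
  have hCM : C ≤ M := hT.fs_abs_le φ x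
  obtain ⟨d, r, hd, hr, hdiam, -⟩ := hT.count
  set N : ℝ → ℝ := fun R => ((hT.vfin R).toFinset.card : ℝ) with hN
  have step : ∀ R, C * N R ≤ M * (N R - N (R - d)) := by
    intro R
    set s := (hT.vfin R).toFinset with hs
    have hsm : ∀ z ∈ s, z ∈ Vx T ∧ ‖z‖ ≤ R := by
      intro z hz; rw [hs, Set.Finite.mem_toFinset] at hz; exact hz
    set s' := s.filter (fun z => R - d < ‖z‖) with hs'
    have e1 : ∑ z ∈ s, hT.fs φ z = C * N R := by
      rw [Finset.sum_congr rfl (fun z hz => hT.fs_eq hφ (hsm z hz).1 hx), Finset.sum_const, nsmul_eq_mul, mul_comm]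
    have e2 : ∑ z ∈ s', hT.fs (fun Q v => |φ Q v|) z = M * (N R - N (R - d)) := by
      rw [Finset.sum_congr rfl (fun z hz => hT.fs_eq (by intro g Q v; simp only [hφ]) (hsm z (Finset.mem_filter.1 hz).1).1 hx),
        Finset.sum_const, nsmul_eq_mul, mul_comm]
      congr 1
      have h1 : s.filter (fun z => ¬ R - d < ‖z‖) = (hT.vfin (R - d)).toFinset := by
        ext z
        rw [Finset.mem_filter, hs, Set.Finite.mem_toFinset, Set.Finite.mem_toFinset]
        constructor
        · rintro ⟨⟨a, b⟩, c⟩; exact ⟨a, not_lt.1 c⟩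
        · rintro ⟨a, b⟩; exact ⟨⟨a, by linarith⟩, not_lt.2 b⟩
      have h2 := Finset.card_filter_add_card_filter_not (s := s) (fun z => R - d < ‖z‖)
      simp only [hN]
      rw [← h1, ← h2]
      push_cast; ring
    rw [← e1, ← e2, hT.fs_sum φ R s (fun z hz => (hsm z hz).2),
      hT.fs_sum _ R s' (fun z hz => (hsm z (Finset.mem_filter.1 hz).1).2)]
    apply Finset.sum_le_sum
    intro Q hQ
    rw [Set.Finite.mem_toFinset] at hQ
    have hQT := hQ.1
    by_cases hall : ∀ v ∈ extremePoints ℝ Q, ‖v‖ ≤ R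
    · have : ∑ z ∈ s, (if z ∈ extremePoints ℝ Q then φ Q z else 0) = 0 := by
        rw [← Finset.sum_filter]
        refine Eq.trans (Finset.sum_congr ?_ (fun _ _ => rfl)) (h0 Q hQT)
        ext z
        rw [Finset.mem_filter, hs, Set.Finite.mem_toFinset, Set.Finite.mem_toFinset]
        exact ⟨fun h => h.2, fun h => ⟨⟨⟨Q, hQT, h⟩, hall z h⟩, h⟩⟩
      rw [this]
      apply Finset.sum_nonneg
      intro z _
      split_ifs
      · exact abs_nonneg _
      · exact le_rfl
    · push Not at hall
      obtain ⟨v, hv, hvR⟩ := hall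
      have : ∑ z ∈ s, (if z ∈ extremePoints ℝ Q then φ Q z else 0) =
          ∑ z ∈ s', (if z ∈ extremePoints ℝ Q then φ Q z else 0) := by
        symm
        apply Finset.sum_subset (Finset.filter_subset _ _)
        intro z hz hn
        rw [if_neg]
        intro he
        apply hn
        rw [Finset.mem_filter]
        refine ⟨hz, ?_⟩
        have := hdiam Q hQT v hv.1 z he.1
        rw [dist_eq_norm] at this
        linarith [norm_sub_norm_le v z]
      rw [this]
      apply Finset.sum_le_sum
      intro z _
      split_ifs
      · exact le_abs_self _
      · exact le_rfl
  have hM : 0 < M := hC.trans_le hCM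
  have step' : ∀ R, M * N (R - d) ≤ (M - C) * N R := by
    intro R; linarith [step R]
  have h1 : 1 ≤ N ‖x‖ := by
    simp only [hN]
    have : 0 < (hT.vfin ‖x‖).toFinset.card := by
      rw [Finset.card_pos]
      exact ⟨x, by rw [Set.Finite.mem_toFinset]; exact ⟨hx, le_rfl⟩⟩
    exact_mod_cast this
  have hMC : 0 < M - C := by
    rcases (sub_nonneg.2 hCM).eq_or_lt with h | h
    · have := step' (‖x‖ + d)
      rw [← h, zero_mul, add_sub_cancel_right] at this
      nlinarith
    · exact h
  set q := M / (M - C) with hq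
  have hq1 : 1 < q := by rw [hq, one_lt_div hMC]; linarith
  have grow : ∀ n : ℕ, q ^ n ≤ N (‖x‖ + n * d) := by
    intro n
    induction n with
    | zero => simpa using h1
    | succ n ih =>
      have := step' (‖x‖ + (n + 1 : ℕ) * d)
      have e : ‖x‖ + ((n + 1 : ℕ) : ℝ) * d - d = ‖x‖ + n * d := by push_cast; ring
      rw [e] at this
      rw [pow_succ, hq, mul_div_assoc', div_le_iff₀ hMC, ← hq]
      nlinarith
  obtain ⟨A, B, hA, hB, hAB⟩ := hT.vcount
  have h2 : ∀ n : ℕ, 1 ≤ n → q ^ n ≤ A * (‖x‖ + d + B) ^ 2 * (n : ℝ) ^ 2 := by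
    intro n hn
    have hn' : (1 : ℝ) ≤ n := by exact_mod_cast hn
    refine (grow n).trans ((hAB _ (by positivity)).trans ?_)
    rw [mul_assoc, ← mul_pow]
    refine mul_le_mul_of_nonneg_left ?_ hA
    apply pow_le_pow_left₀ (by positivity)
    nlinarith [norm_nonneg x]
  have h3 := tendsto_pow_const_div_const_pow_of_one_lt 2 hq1
  set W := A * (‖x‖ + d + B) ^ 2 with hW
  have hW0 : 0 ≤ W := by positivity
  have h4 : ∀ᶠ n : ℕ in Filter.atTop, (n : ℝ) ^ 2 / q ^ n < 1 / (W + 1) :=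
    h3.eventually (gt_mem_nhds (by positivity))
  obtain ⟨n, h5, h6⟩ := (h4.and (Filter.eventually_ge_atTop 1)).exists
  have h7 := h2 n h6
  have hqn : 0 < q ^ n := by positivity
  rw [div_lt_div_iff₀ hqn (by positivity)] at h5
  nlinarith [sq_nonneg (n : ℝ)]

theorem Mono.mt (hT : Mono T) {φ : Set ℂ → ℂ → ℝ} (hφ : ∀ (g : Mo) Q v, φ (g • Q) (g • v) = φ Q v)
    (h0 : ∀ Q (hQ : Q ∈ T), ∑ v ∈ (hT.poly Q hQ).fin.toFinset, φ Q v = 0) {x : ℂ} (hx : x ∈ Vx T) :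
    hT.fs φ x = 0 := by
  classical
  apply le_antisymm (hT.mt_le hφ h0 hx)
  have := hT.mt_le (φ := fun Q v => - φ Q v) (by intro g Q v; simp only [hφ])
    (by intro Q hQ; rw [Finset.sum_neg_distrib, h0 Q hQ, neg_zero]) hx
  have e : hT.fs (fun Q v => - φ Q v) x = - hT.fs φ x := by
    unfold Mono.fs
    rw [← Finset.sum_neg_distrib]
    apply Finset.sum_congr rfl
    intro Q _
    split_ifs <;> simp
  rw [e] at this
  linarith



theorem unit_par {r l : ℂ} (hr : ‖r‖ = 1) (hl : ‖l‖ = 1) (h : cr r l = 0) : r = l ∨ r = -l := by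
  have r0 : r ≠ 0 := by rintro rfl; simp at hr
  obtain ⟨t, ht⟩ := cr_eq_zero r0 h
  rw [ht, norm_mul, hr, mul_one, Complex.norm_real, Real.norm_eq_abs] at hl
  rcases abs_eq (zero_le_one) |>.1 hl with e | e
  · left; rw [ht, e]; simp
  · right; rw [ht, e]; simp

theorem edge_aux {P : Set ℂ} (hP : Pgon P) {z r l : ℂ} (hz : z ∈ P) (h : IsSec P z r l) {s : ℝ} (hs : 0 < s)
    (hy : z + s * l ∈ P) : ∃ l', IsSec P (z + s * l) (-l) l' := by
  have key : ∀ d ∈ Kc P (z + s * l), 0 ≤ cr d l := by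
    rintro d ⟨ε, hε, hd⟩
    have h1 : z + s * l + ε * d - z ∈ Kc P z := Kc_sub hd
    rw [h.eq] at h1
    have h2 := h1.2
    have e : z + s * l + ε * d - z = s * l + ε * d := by ring
    rw [e, cr_add_left, cr_real_left, cr_real_left, cr_self, mul_zero, zero_add] at h2
    exact nonneg_of_mul_nonneg_right h2 hε
  have hm : -l ∈ Kc P (z + s * l) := by
    refine ⟨s, hs, ?_⟩
    convert hz using 1; ring
  have hi : z + s * l ∉ interior P := by
    intro hi
    have h1 : -(Complex.I * l) ∈ Kc P (z + s * l) := by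
      have hc : Continuous (fun t : ℝ => z + s * l + t * (-(Complex.I * l))) := by fun_prop
      have h2 : ∀ᶠ t : ℝ in nhds 0, z + s * l + t * (-(Complex.I * l)) ∈ interior P :=
        hc.continuousAt.eventually (isOpen_interior.mem_nhds (by simpa using hi))
      have h3 := (h2.filter_mono (nhdsWithin_le_nhds (s := Ioi 0))).and self_mem_nhdsWithin
      obtain ⟨t, h4, h5⟩ := h3.exists
      exact ⟨t, h5, interior_subset h4⟩
    have h1' : Complex.I * l ∈ Kc P (z + s * l) := by
      have hc : Continuous (fun t : ℝ => z + s * l + t * ((Complex.I * l))) := by fun_prop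
      have h2 : ∀ᶠ t : ℝ in nhds 0, z + s * l + t * ((Complex.I * l)) ∈ interior P :=
        hc.continuousAt.eventually (isOpen_interior.mem_nhds (by simpa using hi))
      have h3 := (h2.filter_mono (nhdsWithin_le_nhds (s := Ioi 0))).and self_mem_nhdsWithin
      obtain ⟨t, h4, h5⟩ := h3.exists
      exact ⟨t, h5, interior_subset h4⟩
    have h2 := key _ h1'
    have h3 := cr_I_pos h.l0
    rw [cr_swap] at h2
    linarith
  obtain ⟨r1, l1, h1⟩ := exists_sec hP hy hi
  have hm' := hm
  rw [h1.eq] at hm'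
  have a1 := hm'.1
  rw [cr_neg_right] at a1
  have a2 := key _ h1.r_mem
  rcases unit_par h1.nr h.nl (by linarith) with e | e
  · exfalso
    subst e
    have a3 := hm'.2
    rw [cr_neg_left] at a3
    rcases h1.pos with hp | hp
    · linarith
    · have h4 : Complex.I * r1 ∈ Kc P (z + s * r1) := by
        rw [h1.eq, Sec_flat hp]
        exact (cr_I_pos h1.r0).le
      have h2 := key _ h4
      have h3 := cr_I_pos h1.r0
      rw [cr_swap] at h2
      linarith
  · exact ⟨l1, by rw [← e]; exact h1⟩

theorem edge_aux' {P : Set ℂ} (hP : Pgon P) {z r l : ℂ} (hz : z ∈ P) (h : IsSec P z l r) {s : ℝ} (hs : 0 < s)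
    (hy : z + s * l ∈ P) : ∃ l', IsSec P (z + s * l) l' (-l) := by
  have key : ∀ d ∈ Kc P (z + s * l), 0 ≤ cr l d := by
    rintro d ⟨ε, hε, hd⟩
    have h1 : z + s * l + ε * d - z ∈ Kc P z := Kc_sub hd
    rw [h.eq] at h1
    have h2 := h1.1
    have e : z + s * l + ε * d - z = s * l + ε * d := by ring
    rw [e, cr_add_right, cr_real_right, cr_real_right, cr_self, mul_zero, zero_add] at h2
    exact nonneg_of_mul_nonneg_right h2 hε
  have hm : -l ∈ Kc P (z + s * l) := by
    refine ⟨s, hs, ?_⟩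
    convert hz using 1; ring
  have hi : z + s * l ∉ interior P := by
    intro hi
    have h1 : -(Complex.I * l) ∈ Kc P (z + s * l) := by
      have hc : Continuous (fun t : ℝ => z + s * l + t * (-(Complex.I * l))) := by fun_prop
      have h2 : ∀ᶠ t : ℝ in nhds 0, z + s * l + t * (-(Complex.I * l)) ∈ interior P :=
        hc.continuousAt.eventually (isOpen_interior.mem_nhds (by simpa using hi))
      have h3 := (h2.filter_mono (nhdsWithin_le_nhds (s := Ioi 0))).and self_mem_nhdsWithin
      obtain ⟨t, h4, h5⟩ := h3.exists
      exact ⟨t, h5, interior_subset h4⟩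
    have h2 := key _ h1
    have h3 := cr_I_pos h.r0
    rw [cr_neg_right] at h2
    linarith
  obtain ⟨r1, l1, h1⟩ := exists_sec hP hy hi
  have hm' := hm
  rw [h1.eq] at hm'
  have a1 := hm'.2
  rw [cr_neg_left] at a1
  have a2 := key _ h1.l_mem
  have a4 : cr l1 l = 0 := by rw [cr_swap]; linarith
  rcases unit_par h1.nl h.nr a4 with e | e
  · exfalso
    subst e
    have a3 := hm'.1
    rw [cr_neg_right] at a3
    rcases h1.pos with hp | hp
    · linarith
    · have h4 : Complex.I * r1 ∈ Kc P (z + s * l1) := by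
        rw [h1.eq, Sec_flat hp]
        exact (cr_I_pos h1.r0).le
      have h2 := key _ h4
      have h3 := cr_I_pos h1.r0
      rw [hp, cr_neg_left] at h2
      linarith
  · exact ⟨r1, by rw [← e]; exact h1⟩

/-- sector, possibly mirrored -/
def Sb (b : Bool) (Q : Set ℂ) (x r l : ℂ) : Prop :=
  match b with
  | true => IsSec Q x r l
  | false => IsSec Q x l r

theorem Sb.not {b : Bool} {Q : Set ℂ} {x r l : ℂ} (h : Sb b Q x r l) : Sb (!b) Q x l r := by
  cases b <;> exact h

theorem Sb.nl {b : Bool} {Q : Set ℂ} {x r l : ℂ} (h : Sb b Q x r l) : ‖l‖ = 1 := by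
  cases b
  · exact IsSec.nr h
  · exact IsSec.nl h

theorem Sb.nr {b : Bool} {Q : Set ℂ} {x r l : ℂ} (h : Sb b Q x r l) : ‖r‖ = 1 := h.not.nl

theorem Sb.l0 {b : Bool} {Q : Set ℂ} {x r l : ℂ} (h : Sb b Q x r l) : l ≠ 0 := by
  rintro rfl; simpa using h.nl

theorem Sb.ne {b : Bool} {Q : Set ℂ} {x r l : ℂ} (h : Sb b Q x r l) : l ≠ r := by
  cases b
  · exact (IsSec.ne h).symm
  · exact IsSec.ne h

theorem Sb.unique {b : Bool} {Q : Set ℂ} {x r l r' l' : ℂ} (h : Sb b Q x r l) (h' : Sb b Q x r' l') :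
    r = r' ∧ l = l' := by
  cases b
  · exact (IsSec.unique h h' rfl).symm
  · exact IsSec.unique h h' rfl

theorem Sb.smul {b : Bool} {Q : Set ℂ} {x r l : ℂ} (h : Sb b Q x r l) (g : Mo) :
    Sb b (g • Q) (g • x) (g.a * r) (g.a * l) := by
  cases b
  · exact IsSec.smul h g
  · exact IsSec.smul h g

theorem Sb.ext {b : Bool} {Q : Set ℂ} (hQ : Convex ℝ Q) {x r l : ℂ} (hx : x ∈ Q) (h : Sb b Q x r l) :
    x ∈ extremePoints ℝ Q ↔ l ≠ -r := by
  cases b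
  · have h : IsSec Q x l r := h
    rw [h.ext_iff hQ hx]
    constructor
    · rintro hp rfl; rw [cr_neg_left, cr_self] at hp; simp at hp
    · intro hn
      rcases h.pos with h' | h'
      · exact h'
      · exact absurd (by rw [h', neg_neg]) hn
  · have h : IsSec Q x r l := h
    rw [h.ext_iff hQ hx]
    constructor
    · rintro hp rfl; rw [cr_neg_right, cr_self] at hp; simp at hp
    · intro hn
      rcases h.pos with h' | h'
      · exact h'
      · exact absurd h' hn

theorem Sb.el {b : Bool} {Q : Set ℂ} {x r l : ℂ} (h : Sb b Q x r l) :
    ∃ t : ℝ, 0 < t ∧ x + t * l ∈ extremePoints ℝ Q := by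
  cases b
  · obtain ⟨t, h1, h2⟩ := IsSec.er h; exact ⟨t, h1, h2⟩
  · obtain ⟨t, h1, h2⟩ := IsSec.el h; exact ⟨t, h1, h2⟩

theorem Sb.mem_l {b : Bool} {Q : Set ℂ} {x r l : ℂ} (h : Sb b Q x r l) : l ∈ Kc Q x := by
  cases b
  · exact IsSec.r_mem h
  · exact IsSec.l_mem h

theorem Sb.edge {b : Bool} {P : Set ℂ} (hP : Pgon P) {z r l : ℂ} (hz : z ∈ P) (h : Sb b P z r l) {s : ℝ}
    (hs : 0 < s) (hy : z + s * l ∈ P) : ∃ l', Sb b P (z + s * l) (-l) l' := by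
  cases b
  · exact edge_aux' hP hz h hs hy
  · exact edge_aux hP hz h hs hy

theorem Sb.ex (b : Bool) {Q : Set ℂ} (hQ : Pgon Q) {x : ℂ} (hx : x ∈ extremePoints ℝ Q) : ∃ r l, Sb b Q x r l := by
  obtain ⟨r, l, h⟩ := exists_sec hQ hx.1 (ext_notMem_interior hx)
  cases b
  · exact ⟨l, r, h⟩
  · exact ⟨r, l, h⟩

theorem not_ext_of_two {Q : Set ℂ} {x d : ℂ} (hd : d ≠ 0) {s t : ℝ} (hs : 0 < s) (ht : 0 < t)
    (h1 : x + s * d ∈ Q) (h2 : x - t * d ∈ Q) : x ∉ extremePoints ℝ Q := by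
  intro he
  have hm : x ∈ openSegment ℝ (x + s * d) (x - t * d) := by
    refine ⟨t / (s + t), s / (s + t), by positivity, by positivity, by field_simp; ring, ?_⟩
    simp only [Complex.real_smul]
    have : ((s + t : ℝ) : ℂ) ≠ 0 := by exact_mod_cast (by positivity : s + t ≠ 0)
    push_cast at this ⊢
    field_simp
    ring
  have := mem_extremePoints.1 he |>.2 _ h1 _ h2 hm
  have h3 := this.1
  apply hd
  have hs' : (s : ℂ) ≠ 0 := by exact_mod_cast hs.ne'
  have : (s : ℂ) * d = 0 := by linear_combination h3
  exact (mul_eq_zero.1 this).resolve_left hs'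

theorem ray_uniq {Q : Set ℂ} {x d : ℂ} (hd : d ≠ 0) (hx : x ∈ Q) {s t : ℝ} (hs : 0 < s)
    (h1 : x + s * d ∈ extremePoints ℝ Q) (h2 : x + t * d ∈ Q) : t ≤ s := by
  by_contra! hlt
  refine not_ext_of_two (Q := Q) (x := x + s * d) hd (s := t - s) (t := s) (by linarith) hs ?_ ?_ h1
  · convert h2 using 1; push_cast; ring
  · convert hx using 1; ring

/-- neighbours along the boundary of a polygon -/
def Lb (b : Bool) (P : Set ℂ) (z x : ℂ) : Prop :=
  ∃ (r l : ℂ) (t : ℝ), Sb b P z r l ∧ 0 < t ∧ x = z + t * l ∧ z ∈ extremePoints ℝ P ∧ x ∈ extremePoints ℝ P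

theorem Lb.e1 {b : Bool} {P : Set ℂ} {z x : ℂ} (h : Lb b P z x) : z ∈ extremePoints ℝ P := by
  obtain ⟨_, _, _, _, _, _, h, _⟩ := h; exact h

theorem Lb.e2 {b : Bool} {P : Set ℂ} {z x : ℂ} (h : Lb b P z x) : x ∈ extremePoints ℝ P := by
  obtain ⟨_, _, _, _, _, _, _, h⟩ := h; exact h

theorem Lb.flip {b : Bool} {P : Set ℂ} (hP : Pgon P) {z x : ℂ} (h : Lb b P z x) : Lb (!b) P x z := by
  obtain ⟨r, l, t, h1, ht, rfl, hz, hx⟩ := h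
  obtain ⟨l', h2⟩ := h1.edge hP hz.1 ht hx.1
  exact ⟨l', -l, t, h2.not, ht, by ring, hx, hz⟩

theorem Lb.flip' {b : Bool} {P : Set ℂ} (hP : Pgon P) {z x : ℂ} (h : Lb (!b) P z x) : Lb b P x z := by
  have := h.flip hP
  rwa [Bool.not_not] at this

theorem Lb.ex (b : Bool) {P : Set ℂ} (hP : Pgon P) {z : ℂ} (hz : z ∈ extremePoints ℝ P) : ∃ x, Lb b P z x := by
  obtain ⟨r, l, h⟩ := Sb.ex b hP hz
  obtain ⟨t, ht, hx⟩ := h.el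
  exact ⟨_, r, l, t, h, ht, rfl, hz, hx⟩

theorem Lb.ex' (b : Bool) {P : Set ℂ} (hP : Pgon P) {z : ℂ} (hz : z ∈ extremePoints ℝ P) : ∃ x, Lb b P x z := by
  obtain ⟨x, h⟩ := Lb.ex (!b) hP hz
  exact ⟨x, h.flip' hP⟩

theorem Lb.right {b : Bool} {P : Set ℂ} {z x x' : ℂ} (h : Lb b P z x) (h' : Lb b P z x') : x = x' := by
  obtain ⟨r, l, t, h1, ht, rfl, hz, hx⟩ := h
  obtain ⟨r', l', t', h1', ht', rfl, hz', hx'⟩ := h'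
  obtain ⟨-, e⟩ := h1.unique h1'
  subst e
  have a := ray_uniq h1.l0 hz.1 ht hx hx'.1
  have b := ray_uniq h1.l0 hz.1 ht' hx' hx.1
  rw [le_antisymm a b]

theorem Lb.left {b : Bool} {P : Set ℂ} (hP : Pgon P) {z z' x : ℂ} (h : Lb b P z x) (h' : Lb b P z' x) : z = z' :=
  (h.flip hP).right (h'.flip hP)

theorem Lb.ne {b : Bool} {P : Set ℂ} {z x : ℂ} (h : Lb b P z x) : x ≠ z := by
  obtain ⟨r, l, t, h1, ht, rfl, hz, hx⟩ := h
  intro e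
  have : (t : ℂ) * l = 0 := by linear_combination e
  rcases mul_eq_zero.1 this with h | h
  · exact ht.ne' (by exact_mod_cast h)
  · exact h1.l0 h

theorem dir_uniq {l l' : ℂ} (hl : ‖l‖ = 1) (hl' : ‖l'‖ = 1) {t t' : ℝ} (ht : 0 < t) (ht' : 0 < t')
    (h : (t : ℂ) * l = t' * l') : t = t' ∧ l = l' := by
  have h1 := congrArg norm h
  rw [norm_mul, norm_mul, hl, hl', Complex.norm_real, Complex.norm_real, Real.norm_of_nonneg ht.le,
    Real.norm_of_nonneg ht'.le, mul_one, mul_one] at h1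
  refine ⟨h1, ?_⟩
  rw [h1] at h
  have : (t' : ℂ) ≠ 0 := by exact_mod_cast ht'.ne'
  exact mul_left_cancel₀ this h

theorem Lb.no2 {b : Bool} {P : Set ℂ} (hP : Pgon P) {z x : ℂ} (h : Lb b P z x) (h' : Lb b P x z) : False := by
  have h2 := h'.flip hP
  obtain ⟨r, l, t, h1, ht, rfl, hz, hx⟩ := h
  obtain ⟨r', l', t', h1', ht', e, hz', hx'⟩ := h2
  obtain ⟨-, e2⟩ := dir_uniq h1.nl h1'.nl ht ht' (by linear_combination e)
  subst e2
  obtain ⟨e3, -⟩ := h1'.unique h1.not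
  obtain ⟨-, e4⟩ := h1'.unique h1.not
  exact h1.ne e4

theorem Lb.smul {b : Bool} {P : Set ℂ} {z x : ℂ} (h : Lb b P z x) (g : Mo) : Lb b (g • P) (g • z) (g • x) := by
  obtain ⟨r, l, t, h1, ht, rfl, hz, hx⟩ := h
  refine ⟨_, _, t, h1.smul g, ht, ?_, (ext_smul_iff _ _ _).2 hz, (ext_smul_iff _ _ _).2 hx⟩
  simp only [Mo.smul_def]; ring

theorem Lb.tri {b : Bool} {P : Set ℂ} (hP : Pgon P) (hn : nc P = 3) {z x : ℂ} (h : Lb b P z x) :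
    ∃ w, Lb b P x w ∧ Lb b P w z ∧ w ≠ z ∧ w ≠ x ∧ extremePoints ℝ P = {z, x, w} := by
  obtain ⟨w, hw⟩ := Lb.ex b hP h.e2
  have hwz : w ≠ z := by rintro rfl; exact h.no2 hP hw
  have hset : {z, x, w} = extremePoints ℝ P := by
    apply Set.eq_of_subset_of_ncard_le
    · rintro v (rfl | rfl | rfl)
      exacts [h.e1, h.e2, hw.e2]
    · unfold nc at hn
      rw [hn, Set.ncard_eq_three.2 ⟨z, x, w, h.ne.symm, hwz.symm, hw.ne.symm, rfl⟩]
    · exact hP.fin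
  obtain ⟨y, hy⟩ := Lb.ex b hP hw.e2
  have hym := hy.e2
  rw [← hset] at hym
  rcases hym with rfl | rfl | rfl
  · exact ⟨w, hw, hy, hwz, hw.ne, hset.symm⟩
  · exact absurd hy (fun h => hw.no2 hP h)
  · exact absurd rfl hy.ne

theorem Lb.quad {b : Bool} {P : Set ℂ} (hP : Pgon P) (hn : nc P = 4) {z x : ℂ} (h : Lb b P z x) :
    ∃ w y, Lb b P x w ∧ Lb b P w y ∧ Lb b P y z ∧ extremePoints ℝ P = {z, x, w, y} := by
  obtain ⟨w, hw⟩ := Lb.ex b hP h.e2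
  have hwz : w ≠ z := by rintro rfl; exact h.no2 hP hw
  obtain ⟨y, hy⟩ := Lb.ex b hP hw.e2
  have hyx : y ≠ x := by rintro rfl; exact hw.no2 hP hy
  have hyz : y ≠ z := by
    rintro rfl
    have h3 : ({y, x, w} : Set ℂ).ncard = 3 :=
      Set.ncard_eq_three.2 ⟨y, x, w, h.ne.symm, hwz.symm, hw.ne.symm, rfl⟩
    have : ∃ v ∈ extremePoints ℝ P, v ∉ ({y, x, w} : Set ℂ) := by
      refine Set.exists_mem_notMem_of_ncard_lt_ncard ?_ (Set.toFinite _)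
      rw [h3]; unfold nc at hn; omega
    obtain ⟨v, hv, hvn⟩ := this
    have key : ∀ u, Lb b P v u → u ∉ ({y, x, w} : Set ℂ) := by
      rintro u hu (rfl | rfl | rfl)
      · exact hvn (by rw [hu.left hP hy]; simp)
      · exact hvn (by rw [hu.left hP h]; simp)
      · exact hvn (by rw [hu.left hP hw]; simp)
    obtain ⟨u, hu⟩ := Lb.ex b hP hv
    have hun := key u hu
    simp only [mem_insert_iff, mem_singleton_iff, not_or] at hun hvn
    have : ({v, u, y, x, w} : Finset ℂ).card ≤ 4 := by
      rw [← hn]; unfold nc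
      rw [← Set.ncard_coe_finset]
      apply Set.ncard_le_ncard _ hP.fin
      intro q hq
      simp only [Finset.coe_insert, Finset.coe_singleton, mem_insert_iff, mem_singleton_iff] at hq
      rcases hq with rfl | rfl | rfl | rfl | rfl
      exacts [hv, hu.e2, h.e1, h.e2, hw.e2]
    rw [Finset.card_insert_of_notMem, Finset.card_insert_of_notMem, Finset.card_insert_of_notMem,
      Finset.card_insert_of_notMem, Finset.card_singleton] at this
    · omega
    · simpa using hw.ne.symm
    · simp only [Finset.mem_insert, Finset.mem_singleton, not_or]; exact ⟨h.ne.symm, hwz.symm⟩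
    · simp only [Finset.mem_insert, Finset.mem_singleton, not_or]; exact hun
    · simp only [Finset.mem_insert, Finset.mem_singleton, not_or]; exact ⟨hu.ne.symm, hvn⟩
  have hset : {z, x, w, y} = extremePoints ℝ P := by
    apply Set.eq_of_subset_of_ncard_le
    · rintro v (rfl | rfl | rfl | rfl)
      exacts [h.e1, h.e2, hw.e2, hy.e2]
    · unfold nc at hn
      rw [hn]
      have : ({z, x, w, y} : Set ℂ) = (({z, x, w, y} : Finset ℂ) : Set ℂ) := by simp
      rw [this, Set.ncard_coe_finset, Finset.card_insert_of_notMem, Finset.card_insert_of_notMem,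
        Finset.card_insert_of_notMem, Finset.card_singleton]
      · simpa using hy.ne.symm
      · simp only [Finset.mem_insert, Finset.mem_singleton, not_or]; exact ⟨hw.ne.symm, hyx.symm⟩
      · simp only [Finset.mem_insert, Finset.mem_singleton, not_or]; exact ⟨h.ne.symm, hwz.symm, hyz.symm⟩
    · exact hP.fin
  obtain ⟨u, hu⟩ := Lb.ex b hP hy.e2
  have hum := hu.e2
  rw [← hset] at hum
  rcases hum with rfl | rfl | rfl | rfl
  · exact ⟨w, y, hw, hy, hu, hset.symm⟩
  · exact absurd (hu.left hP h) hyz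
  · exact absurd hu (fun h => hy.no2 hP h)
  · exact absurd rfl hu.ne

/-- neighbours in a corona, possibly mirrored -/
def Nb (b : Bool) (T : Set (Set ℂ)) (x : ℂ) (Q P : Set ℂ) : Prop :=
  Q ∈ Co T x ∧ P ∈ Co T x ∧ Q ≠ P ∧ ∃ r l l', Sb b Q x r l ∧ Sb b P x l l'

theorem Nb.not {b : Bool} {x : ℂ} {Q P : Set ℂ} (h : Nb b T x Q P) : Nb (!b) T x P Q := by
  obtain ⟨h1, h2, h3, r, l, l', e1, e2⟩ := h
  exact ⟨h2, h1, h3.symm, l', l, r, e2.not, e1.not⟩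

theorem Nb.not' {b : Bool} {x : ℂ} {Q P : Set ℂ} (h : Nb (!b) T x Q P) : Nb b T x P Q := by
  have := h.not
  rwa [Bool.not_not] at this

theorem nb_ex (b : Bool) (hT : Mono T) {x : ℂ} (hx : x ∈ Vx T) {Q : Set ℂ} (hQ : Q ∈ Co T x) : ∃ P, Nb b T x Q P := by
  cases b
  · obtain ⟨P, h⟩ := hT.prv_ex hx hQ
    have h : Nb true T x P Q := h
    exact ⟨P, h.not⟩
  · exact hT.nxt_ex hx hQ

theorem nb_ex' (b : Bool) (hT : Mono T) {x : ℂ} (hx : x ∈ Vx T) {Q : Set ℂ} (hQ : Q ∈ Co T x) : ∃ P, Nb b T x P Q := by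
  obtain ⟨P, h⟩ := nb_ex (!b) hT hx hQ
  exact ⟨P, h.not'⟩

theorem Nb.right {b : Bool} (hT : Mono T) {x : ℂ} {Q P P' : Set ℂ} (h : Nb b T x Q P) (h' : Nb b T x Q P') : P = P' := by
  cases b
  · have h1 : Nb true T x P Q := h.not
    have h2 : Nb true T x P' Q := h'.not
    exact Nxt.left hT h1 h2
  · exact Nxt.right hT h h'

theorem Nb.left {b : Bool} (hT : Mono T) {x : ℂ} {Q Q' P : Set ℂ} (h : Nb b T x Q P) (h' : Nb b T x Q' P) : Q = Q' :=
  h.not.right hT h'.not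

theorem Nb.smul {b : Bool} {x y : ℂ} {Q P : Set ℂ} (h : Nb b T x Q P) (g : Mo) (hg : g • x = y)
    (h1 : g • Q ∈ Co T y) (h2 : g • P ∈ Co T y) : Nb b T y (g • Q) (g • P) := by
  obtain ⟨-, -, hne, r, l, l', e1, e2⟩ := h
  subst hg
  exact ⟨h1, h2, fun e => hne (smul_left_cancel g e), _, _, _, e1.smul g, e2.smul g⟩

theorem Nb.m1 {b : Bool} {x : ℂ} {Q P : Set ℂ} (h : Nb b T x Q P) : Q ∈ Co T x := h.1
theorem Nb.m2 {b : Bool} {x : ℂ} {Q P : Set ℂ} (h : Nb b T x Q P) : P ∈ Co T x := h.2.1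
theorem Nb.ne {b : Bool} {x : ℂ} {Q P : Set ℂ} (h : Nb b T x Q P) : Q ≠ P := h.2.2.1

/-- transfer of a shared edge to its other end -/
theorem Nb.across {b : Bool} (hT : Mono T) {z x : ℂ} {P Q : Set ℂ} (h : Nb b T z P Q) (hzQ : z ∈ extremePoints ℝ Q)
    (hL : Lb b P z x) (hxQ : x ∈ extremePoints ℝ Q) : Lb b Q x z ∧ Nb b T x Q P := by
  obtain ⟨h1, h2, hne, r, l, l', e1, e2⟩ := h
  obtain ⟨r1, l1, t, e3, ht, rfl, hz, hx⟩ := hL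
  obtain ⟨-, e⟩ := e1.unique e3
  subst e
  have hL2 : Lb (!b) Q z (z + t * l) := ⟨l', l, t, e2.not, ht, rfl, hzQ, hxQ⟩
  refine ⟨hL2.flip' (hT.poly Q h2.1), ⟨h2.1, hxQ.1⟩, ⟨h1.1, hx.1⟩, hne.symm, ?_⟩
  obtain ⟨a, e4⟩ := e3.edge (hT.poly P h1.1) hz.1 ht hx.1
  obtain ⟨c, e5⟩ := e2.not.edge (hT.poly Q h2.1) hzQ.1 ht hxQ.1
  have e6 := e5.not
  rw [Bool.not_not] at e6
  exact ⟨c, -l, a, e6, e4⟩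

/-- no flat tiles -/
def NF (T : Set (Set ℂ)) : Prop := ∀ z ∈ Vx T, ∀ P ∈ Co T z, z ∈ extremePoints ℝ P

theorem Nb.across_nf {b : Bool} (hT : Mono T) (hF : NF T) {z x : ℂ} (hz : z ∈ Vx T) {P Q : Set ℂ} (h : Nb b T z P Q)
    (hL : Lb b P z x) : Lb b Q x z ∧ Nb b T x Q P := by
  have hzQ := hF z hz Q h.m2
  refine h.across hT hzQ hL ?_
  obtain ⟨h1, h2, hne, r, l, l', e1, e2⟩ := h
  obtain ⟨r1, l1, t, e3, ht, rfl, hz', hx⟩ := hL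
  obtain ⟨-, e⟩ := e1.unique e3
  subst e
  have hxV : z + t * l ∈ Vx T := ⟨P, h1.1, hx⟩
  obtain ⟨t', ht', hy⟩ := e2.not.el
  by_cases hle : t ≤ t'
  · exact hF _ hxV Q ⟨h2.1, Kc_small (hT.poly Q h2.1).conv h2.2 ht.le hle hy.1⟩
  · have hy2 : z + t' * l ∈ extremePoints ℝ P :=
      hF _ ⟨Q, h2.1, hy⟩ P ⟨h1.1, Kc_small (hT.poly P h1.1).conv h1.2 ht'.le (by linarith) hx.1⟩
    have := ray_uniq e1.l0 h1.2 ht' hy2 hx.1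
    linarith

theorem nf_of (hT : Mono T) {z : ℂ} (hz : z ∈ Vx T) (h : ∀ P ∈ Co T z, z ∈ extremePoints ℝ P) : NF T := by
  intro y hy P hP
  obtain ⟨g, hg, hC⟩ := hT.mono z hz y hy
  rw [← hC] at hP
  obtain ⟨Q, hQ, rfl⟩ := hP
  rw [← hg]
  exact (ext_smul_iff _ _ _).2 (h Q hQ)


theorem aut_one {P : Set ℂ} (hP : Pgon P) {z : ℂ} (hz : z ∈ extremePoints ℝ P) {σ : Mo} (h1 : σ • P = P)
    (h2 : σ • z = z) : σ = 1 := by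
  obtain ⟨r, l, h⟩ := Sb.ex true hP hz
  have h3 := h.smul σ
  rw [h1, h2] at h3
  have h4 := (h3.unique h).2
  apply Mo.eq_one h2
  have : ((σ.a : ℂ) - 1) * l = 0 := by rw [sub_mul, h4]; ring
  rcases mul_eq_zero.1 this with h5 | h5
  · exact Circle.ext (by simpa using sub_eq_zero.1 h5)
  · exact absurd h5 h.l0

def wt (Q : Set ℂ) : ℝ := 1 - 2 / (nc Q : ℝ)

open Classical in
def Wz (z : ℂ) (Q : Set ℂ) : ℝ := if z ∈ extremePoints ℝ Q then wt Q else 1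

theorem Mono.euler (hT : Mono T) {z : ℂ} (hz : z ∈ Vx T) : ∑ Q ∈ hT.cof z, Wz z Q = 2 := by
  classical
  have h := hT.mt (φ := fun Q v => th Q v - wt Q * Real.pi) ?_ ?_ hz
  · unfold Mono.fs at h
    have h2 : ∑ Q ∈ hT.cof z, (th Q z - Wz z Q * Real.pi) = 0 := by
      rw [← h]
      apply Finset.sum_congr rfl
      intro Q hQ
      have hQ' := hT.mem_cof.1 hQ
      unfold Wz
      split_ifs with h3
      · rfl
      · obtain ⟨r, l, hs⟩ := hT.sec hz hQ'
        have := hs.not_ext (hT.poly Q hQ'.1).conv hQ'.2 h3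
        rw [this] at hs
        rw [hs.th_flat rfl]; ring
    rw [Finset.sum_sub_distrib, hT.sum_eq z, ← Finset.sum_mul] at h2
    have := Real.pi_pos
    nlinarith
  · intro g Q v
    simp only [wt, nc_smul, th_smul]
  · intro Q hQ
    rw [Finset.sum_sub_distrib, angle_sum (hT.poly Q hQ), Finset.sum_const]
    have h3 := nc_ge (hT.poly Q hQ)
    have h4 : (hT.poly Q hQ).fin.toFinset.card = nc Q := by
      unfold nc; rw [Set.ncard_eq_toFinset_card _ (hT.poly Q hQ).fin]
    rw [h4, nsmul_eq_mul, wt]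
    change ((nc Q : ℝ) - 2) * Real.pi - _ = 0
    have : (nc Q : ℝ) ≠ 0 := by positivity
    field_simp
    ring

theorem wt_ge {Q : Set ℂ} (hQ : Pgon Q) : 1 / 3 ≤ wt Q := by
  have h3 := nc_ge hQ
  have h4 : (3 : ℝ) ≤ nc Q := by exact_mod_cast h3
  unfold wt
  have : 2 / (nc Q : ℝ) ≤ 2 / 3 := by gcongr
  linarith

theorem wt_lt {Q : Set ℂ} (hQ : Pgon Q) : wt Q < 1 := by
  have h3 := nc_ge hQ
  unfold wt
  have : 0 < 2 / (nc Q : ℝ) := by positivity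
  linarith

theorem Wz_ge {Q : Set ℂ} (hQ : Pgon Q) (z : ℂ) : 1 / 3 ≤ Wz z Q := by
  unfold Wz
  split_ifs
  · exact wt_ge hQ
  · norm_num

theorem Wz_ext {Q : Set ℂ} {z : ℂ} (h : z ∈ extremePoints ℝ Q) : Wz z Q = wt Q := by
  unfold Wz; rw [if_pos h]

theorem Wz_lt {Q : Set ℂ} {z : ℂ} (h : Wz z Q < 1) : z ∈ extremePoints ℝ Q := by
  by_contra hn
  unfold Wz at h
  rw [if_neg hn] at h
  exact lt_irrefl _ h

theorem wt_smul (g : Mo) (Q : Set ℂ) : wt (g • Q) = wt Q := by unfold wt; rw [nc_smul]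

/-- letter class -/
def Lt (T : Set (Set ℂ)) (z : ℂ) (Q : Set ℂ) (v : ℂ) : Set (Set ℂ) := {P | P ∈ Co T z ∧ ∃ g : Mo, g • Q = P ∧ g • v = z}

theorem Lt_sub {z v : ℂ} {Q : Set ℂ} : Lt T z Q v ⊆ Co T z := fun _ h => h.1

theorem Lt_ext {z v : ℂ} {Q P : Set ℂ} (hv : v ∈ extremePoints ℝ Q) (h : P ∈ Lt T z Q v) : z ∈ extremePoints ℝ P := by
  obtain ⟨_, g, rfl, rfl⟩ := h
  exact (ext_smul_iff _ _ _).2 hv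

theorem Mono.lt_fin (hT : Mono T) (z v : ℂ) (Q : Set ℂ) : (Lt T z Q v).Finite := (hT.finCo z).subset Lt_sub

theorem Mono.fs_lt (hT : Mono T) {z v : ℂ} {Q : Set ℂ} (hv : v ∈ extremePoints ℝ Q) :
    (open Classical in hT.fs (fun P u => if ∃ g : Mo, g • Q = P ∧ g • v = u then 1 else 0) z) = (Lt T z Q v).ncard := by
  classical
  unfold Mono.fs
  have : ∀ P ∈ hT.cof z, (if z ∈ extremePoints ℝ P then (if ∃ g : Mo, g • Q = P ∧ g • v = z then (1 : ℝ) else 0) else 0)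
      = if P ∈ Lt T z Q v then 1 else 0 := by
    intro P hP
    have hP' := hT.mem_cof.1 hP
    by_cases h : P ∈ Lt T z Q v
    · rw [if_pos h, if_pos (Lt_ext hv h), if_pos h.2]
    · rw [if_neg h]
      have : ¬ ∃ g : Mo, g • Q = P ∧ g • v = z := fun h' => h ⟨hP', h'⟩
      rw [if_neg this, ite_self]
  rw [Finset.sum_congr rfl this, Finset.sum_ite, Finset.sum_const_zero, add_zero, Finset.sum_const, nsmul_eq_mul, mul_one]
  congr 1
  rw [← Set.ncard_coe_finset]
  congr 1
  ext P
  simp only [Finset.coe_filter, mem_ofPred_eq, hT.mem_cof]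
  exact ⟨fun h => h.2, fun h => ⟨h.1, h⟩⟩

theorem Mono.lt_card (hT : Mono T) {z v w : ℂ} {Q : Set ℂ} (hQ : Pgon Q) (hz : z ∈ Vx T) (hv : v ∈ extremePoints ℝ Q)
    (hw : w ∈ extremePoints ℝ Q) : (Lt T z Q v).ncard = (Lt T z Q w).ncard := by
  classical
  have h := hT.mt (φ := fun P u => (if ∃ g : Mo, g • Q = P ∧ g • v = u then (1:ℝ) else 0) -
    (if ∃ g : Mo, g • Q = P ∧ g • w = u then (1:ℝ) else 0)) ?_ ?_ hz
  · have h1 := hT.fs_lt (z := z) hv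
    have h2 := hT.fs_lt (z := z) hw
    have h3 : ((Lt T z Q v).ncard : ℝ) - (Lt T z Q w).ncard = 0 := by
      rw [← h1, ← h2]
      refine Eq.trans ?_ h
      unfold Mono.fs
      rw [← Finset.sum_sub_distrib]
      apply Finset.sum_congr rfl
      intro P _
      split_ifs <;> simp
    exact_mod_cast sub_eq_zero.1 h3
  · intro f P u
    have key : ∀ v, (∃ g : Mo, g • Q = f • P ∧ g • v = f • u) ↔ ∃ g : Mo, g • Q = P ∧ g • v = u := by
      intro v
      constructor
      · rintro ⟨g, h1, h2⟩
        exact ⟨f⁻¹ * g, by rw [mul_smul, h1, inv_smul_smul], by rw [mul_smul, h2, inv_smul_smul]⟩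
      · rintro ⟨g, h1, h2⟩
        exact ⟨f * g, by rw [mul_smul, h1], by rw [mul_smul, h2]⟩
    simp only [key]
  · intro P hP
    have key : ∀ v ∈ extremePoints ℝ Q, ∑ u ∈ (hT.poly P hP).fin.toFinset,
        (if ∃ g : Mo, g • Q = P ∧ g • v = u then (1:ℝ) else 0) = ({g : Mo | g • Q = P}.ncard : ℝ) := by
      intro v hv
      rw [Finset.sum_ite, Finset.sum_const_zero, add_zero, Finset.sum_const, nsmul_eq_mul, mul_one]
      congr 1
      have hinj : Set.InjOn (fun g : Mo => g • v) {g : Mo | g • Q = P} := by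
        intro g hg g' hg' e
        have : g⁻¹ * g' = 1 := by
          apply aut_one hQ hv
          · rw [mul_smul, hg', ← hg, inv_smul_smul]
          · rw [mul_smul]; change g⁻¹ • (g' • v) = v
            rw [← (show g • v = g' • v from e), inv_smul_smul]
        exact (inv_mul_eq_one.1 this)
      rw [← Set.InjOn.ncard_image hinj, ← Set.ncard_coe_finset]
      congr 1
      ext u
      simp only [Finset.coe_filter, Set.Finite.mem_toFinset, mem_ofPred_eq, mem_image]
      constructor
      · rintro ⟨_, g, h1, h2⟩; exact ⟨g, h1, h2⟩
      · rintro ⟨g, h1, h2⟩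
        refine ⟨?_, g, h1, h2⟩
        rw [← h1, ← h2]; exact (ext_smul_iff _ _ _).2 hv
    rw [Finset.sum_sub_distrib, key v hv, key w hw, sub_self]

/-- vertex-transitive tile -/
def Tr (Q : Set ℂ) : Prop := ∀ v ∈ extremePoints ℝ Q, ∀ w ∈ extremePoints ℝ Q, ∃ σ : Mo, σ • Q = Q ∧ σ • v = w

theorem Tr.smul {Q : Set ℂ} (h : Tr Q) (g : Mo) : Tr (g • Q) := by
  intro v hv w hw
  rw [← Mo.smul_extremePoints] at hv hw
  obtain ⟨v, hv, rfl⟩ := hv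
  obtain ⟨w, hw, rfl⟩ := hw
  obtain ⟨σ, h1, h2⟩ := h v hv w hw
  refine ⟨g * σ * g⁻¹, ?_, ?_⟩
  · rw [mul_smul, mul_smul, inv_smul_smul, h1]
  · change (g * σ * g⁻¹) • g • v = g • w
    rw [mul_smul, mul_smul, inv_smul_smul, h2]

theorem Tr.lt {z : ℂ} {P X : Set ℂ} (h : Tr P) (hz : z ∈ extremePoints ℝ P) (hX : X ∈ Co T z) (hzX : z ∈ extremePoints ℝ X)
    {g : Mo} (hg : g • P = X) : X ∈ Lt T z P z := by
  have h1 : g⁻¹ • z ∈ extremePoints ℝ P := by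
    rw [← ext_smul_iff g, smul_inv_smul, hg]; exact hzX
  obtain ⟨σ, h2, h3⟩ := h z hz _ h1
  exact ⟨hX, g * σ, by rw [mul_smul, h2, hg], by rw [mul_smul, h3, smul_inv_smul]⟩

theorem lt_disj {z v w : ℂ} {Q X : Set ℂ} (h1 : X ∈ Lt T z Q v) (h2 : X ∈ Lt T z Q w) : ∃ σ : Mo, σ • Q = Q ∧ σ • v = w := by
  obtain ⟨_, g, e1, e2⟩ := h1
  obtain ⟨_, f, e3, e4⟩ := h2
  exact ⟨f⁻¹ * g, by rw [mul_smul, e1, ← e3, inv_smul_smul], by rw [mul_smul, e2, ← e4, inv_smul_smul]⟩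

theorem self_lt {z : ℂ} {P : Set ℂ} (h : P ∈ Co T z) : P ∈ Lt T z P z := ⟨h, 1, one_smul _ _, one_smul _ _⟩

theorem lt_symm {z : ℂ} {P X : Set ℂ} (hP : P ∈ Co T z) (h : X ∈ Lt T z P z) : P ∈ Lt T z X z := by
  obtain ⟨_, g, e1, e2⟩ := h
  exact ⟨hP, g⁻¹, by rw [← e1, inv_smul_smul], by rw [inv_smul_eq_iff, e2]⟩

theorem lt_tr {z v : ℂ} {P X Y : Set ℂ} (h : X ∈ Lt T z P v) (h' : Y ∈ Lt T z X z) : Y ∈ Lt T z P v := by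
  obtain ⟨_, g, e1, e2⟩ := h
  obtain ⟨h3, f, e3, e4⟩ := h'
  exact ⟨h3, f * g, by rw [mul_smul, e1, e3], by rw [mul_smul, e2, e4]⟩

theorem lt_rot {z v : ℂ} {P X : Set ℂ} {ρ : Mo} (hρ : ρ • z = z) (h : X ∈ Lt T z P v) (h' : ρ • X ∈ Co T z) :
    ρ • X ∈ Lt T z P v := lt_tr h ⟨h', ρ, rfl, hρ⟩

/-- a triangle that is not vertex transitive has three inequivalent vertices -/
theorem tri_rigid {P : Set ℂ} (hP : Pgon P) (hn : nc P = 3) (h : ¬ Tr P) {σ : Mo} (hσ : σ • P = P) : σ = 1 := by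
  by_contra hne
  apply h
  have hinj : ∀ v ∈ extremePoints ℝ P, σ • v ≠ v := fun v hv e => hne (aut_one hP hv hσ e)
  have hm : ∀ v ∈ extremePoints ℝ P, σ • v ∈ extremePoints ℝ P := by
    intro v hv
    have := (ext_smul_iff σ P v).2 hv
    rwa [hσ] at this
  intro v hv w hw
  have h2 : σ • σ • P = P := by rw [hσ, hσ]
  have hne2 : σ • σ • v ≠ v := by
    intro e
    -- then the third vertex is fixed
    unfold nc at hn
    have : ∃ u ∈ extremePoints ℝ P, u ∉ ({v, σ • v} : Set ℂ) := by
      refine Set.exists_mem_notMem_of_ncard_lt_ncard ?_ (Set.toFinite _)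
      rw [hn]
      exact lt_of_le_of_lt (Set.ncard_insert_le _ _) (by rw [Set.ncard_singleton]; norm_num)
    obtain ⟨u, hu, hun⟩ := this
    simp only [mem_insert_iff, mem_singleton_iff, not_or] at hun
    have hset : ({v, σ • v, u} : Set ℂ) = extremePoints ℝ P := by
      apply Set.eq_of_subset_of_ncard_le
      · rintro y (rfl | rfl | rfl)
        exacts [hv, hm _ hv, hu]
      · rw [hn, Set.ncard_eq_three.2 ⟨v, σ • v, u, (hinj v hv).symm, (Ne.symm hun.1), (Ne.symm hun.2), rfl⟩]
      · exact hP.fin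
    have := hm u hu
    rw [← hset] at this
    rcases this with e' | e' | e'
    · apply hun.2
      rw [← e] at e'
      exact smul_left_cancel σ e'
    · exact hun.1 (smul_left_cancel σ e')
    · exact hinj u hu e'
  have hset : ({v, σ • v, σ • σ • v} : Set ℂ) = extremePoints ℝ P := by
    apply Set.eq_of_subset_of_ncard_le
    · rintro y (rfl | rfl | rfl)
      exacts [hv, hm _ hv, hm _ (hm _ hv)]
    · unfold nc at hn
      rw [hn, Set.ncard_eq_three.2 ⟨v, σ • v, σ • σ • v, (hinj v hv).symm, hne2.symm, (hinj _ (hm v hv)).symm, rfl⟩]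
    · exact hP.fin
  rw [← hset] at hw
  rcases hw with rfl | rfl | rfl
  · exact ⟨1, one_smul _ _, one_smul _ _⟩
  · exact ⟨σ, hσ, rfl⟩
  · exact ⟨σ * σ, by rw [mul_smul, h2], by rw [mul_smul]⟩

/-- subsets of the corona -/
theorem Mono.sum_sub (hT : Mono T) {z : ℂ} (hz : z ∈ Vx T) {S : Finset (Set ℂ)} (hS : ∀ X ∈ S, X ∈ Co T z) :
    ∑ Q ∈ S, Wz z Q ≤ 2 := by
  rw [← hT.euler hz]
  apply Finset.sum_le_sum_of_subset_of_nonneg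
  · intro X hX; exact hT.mem_cof.2 (hS X hX)
  · intro X hX _
    have := Wz_ge (hT.poly X (hT.mem_cof.1 hX).1) z
    linarith

theorem Mono.sum_full (hT : Mono T) {z : ℂ} (hz : z ∈ Vx T) {S : Finset (Set ℂ)} (hS : ∀ X ∈ S, X ∈ Co T z)
    (h : 5 / 3 < ∑ Q ∈ S, Wz z Q) : ∀ X ∈ Co T z, X ∈ S := by
  classical
  intro X hX
  by_contra hn
  have := hT.sum_sub hz (S := insert X S) (by
    intro Y hY
    rcases Finset.mem_insert.1 hY with rfl | h
    · exact hX
    · exact hS Y h)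
  rw [Finset.sum_insert hn] at this
  have h3 := Wz_ge (hT.poly X hX.1) z
  linarith

/-- the sum over the letter class -/
theorem Mono.sum_lt (hT : Mono T) {z v : ℂ} {Q : Set ℂ} (hv : v ∈ extremePoints ℝ Q) :
    ∑ X ∈ (hT.lt_fin z v Q).toFinset, Wz z X = (Lt T z Q v).ncard * wt Q := by
  have : ∀ X ∈ (hT.lt_fin z v Q).toFinset, Wz z X = wt Q := by
    intro X hX
    rw [Set.Finite.mem_toFinset] at hX
    rw [Wz_ext (Lt_ext hv hX)]
    obtain ⟨_, g, rfl, _⟩ := hX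
    exact wt_smul g Q
  rw [Finset.sum_congr rfl this, Finset.sum_const, nsmul_eq_mul, Set.ncard_eq_toFinset_card _ (hT.lt_fin z v Q)]


theorem Mono.co_of_sub (hT : Mono T) {z : ℂ} {ρ : Mo} (h : ∀ X ∈ Co T z, ρ • X ∈ Co T z) : ρ • Co T z = Co T z := by
  apply Set.eq_of_subset_of_ncard_le
  · rintro _ ⟨X, hX, rfl⟩; exact h X hX
  · have : ρ • Co T z = (fun X => ρ • X) '' Co T z := rfl
    rw [this, Set.InjOn.ncard_image (fun X _ Y _ e => smul_left_cancel ρ e)]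
  · exact hT.finCo z

structure NR (T : Set (Set ℂ)) (z : ℂ) (P Q : Set ℂ) (ρ : Mo) : Prop where
  fx : ρ • z = z
  m1 : ρ • P ∈ Co T z
  m2 : ρ • Q ∈ Co T z
  ne : ρ • Co T z ≠ Co T z

theorem not_rig {z : ℂ} {P Q : Set ℂ} (h : ¬ Rig T z P Q) : ∃ ρ, NR T z P Q ρ := by
  unfold Rig at h
  push Not at h
  obtain ⟨ρ, h1, h2, h3, h4⟩ := h
  exact ⟨ρ, h1, h2, h3, h4⟩

theorem NR.symm {z : ℂ} {P Q : Set ℂ} {ρ : Mo} (h : NR T z P Q ρ) : NR T z Q P ρ := ⟨h.fx, h.m2, h.m1, h.ne⟩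

theorem sec_fix (hT : Mono T) {z : ℂ} (hz : z ∈ Vx T) {P : Set ℂ} (hP : P ∈ Co T z) {ρ : Mo} (h1 : ρ • z = z)
    (h2 : ρ • P = P) : ρ = 1 := by
  obtain ⟨r, l, h⟩ := hT.sec hz hP
  have h3 := h.smul ρ
  rw [h1, h2] at h3
  have h4 := (h3.unique h rfl).1
  apply Mo.eq_one h1
  have : ((ρ.a : ℂ) - 1) * r = 0 := by rw [sub_mul, h4]; ring
  rcases mul_eq_zero.1 this with h5 | h5
  · exact Circle.ext (by simpa using sub_eq_zero.1 h5)
  · exact absurd h5 h.r0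

theorem NR.nf {z : ℂ} {P Q : Set ℂ} {ρ : Mo} (hT : Mono T) (hz : z ∈ Vx T) (hP : P ∈ Co T z) (h : NR T z P Q ρ) :
    ρ • P ≠ P := by
  intro e
  apply h.ne
  rw [sec_fix hT hz hP h.fx e, one_smul]

theorem NR.ext {z : ℂ} {P Q : Set ℂ} {ρ : Mo} (hT : Mono T) (hz : z ∈ Vx T) (hP : P ∈ Co T z) (h : NR T z P Q ρ) :
    z ∈ extremePoints ℝ P := by
  rcases hT.ext_or hz hP h.m1 (h.nf hT hz hP).symm with h1 | h1
  · exact h1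
  · rw [← ext_smul_iff ρ, h.fx]; exact h1

/-- pairs closed under succession -/
theorem Nb.cyc {b : Bool} (hT : Mono T) {z : ℂ} (hz : z ∈ Vx T) {A : Set (Set ℂ)} (hA : A ⊆ Co T z) (hne : A.Nonempty)
    (h : ∀ X ∈ A, ∀ Y, Nb b T z X Y → Y ∈ A) : A = Co T z := by
  cases b
  swap
  · exact hT.cyc hz hA hne (fun X hX Y hN => h X hX Y hN)
  · -- predecessor closed finite set: complement
    by_contra hcon
    have hB : (Co T z \ A).Nonempty := by
      by_contra hB
      rw [Set.not_nonempty_iff_eq_empty, Set.sdiff_eq_empty] at hB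
      exact hcon (Subset.antisymm hA hB)
    have := hT.cyc (A := Co T z \ A) hz sdiff_subset hB (by
      rintro X ⟨hX, hXA⟩ Y hN
      refine ⟨hN.2.1, fun hY => hXA (h Y hY X ?_)⟩
      exact Nb.not (b := true) hN)
    obtain ⟨X, hX⟩ := hne
    have h1 := hA hX
    rw [← this] at h1
    exact h1.2 hX

theorem Mono.co_card (hT : Mono T) {z : ℂ} (hz : z ∈ Vx T) : 3 ≤ (Co T z).ncard := by
  classical
  by_contra! hlt
  have h := hT.euler hz
  have h2 : (hT.cof z).card = (Co T z).ncard := by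
    rw [← Set.ncard_coe_finset]; congr 1; ext X; simp [hT.mem_cof]
  have h1 : ∀ Q ∈ hT.cof z, Wz z Q ≤ 1 := by
    intro Q hQ
    unfold Wz; split_ifs
    · exact (wt_lt (hT.poly Q (hT.mem_cof.1 hQ).1)).le
    · exact le_rfl
  by_cases hl : (hT.cof z).card ≤ 1
  · have := Finset.sum_le_card_nsmul _ _ _ h1
    rw [h, nsmul_one] at this
    have : 2 ≤ (hT.cof z).card := by exact_mod_cast this
    omega
  · obtain ⟨X, Y, hXY, hC⟩ := Finset.card_eq_two.1 (show (hT.cof z).card = 2 by omega)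
    have hX : X ∈ Co T z := hT.mem_cof.1 (by rw [hC]; simp)
    have hY : Y ∈ Co T z := hT.mem_cof.1 (by rw [hC]; simp)
    rw [hC, Finset.sum_pair hXY] at h
    rw [hC] at h1
    have a1 := h1 X (by simp)
    have a2 := h1 Y (by simp)
    rcases hT.ext_or hz hX hY hXY with he | he
    · have := wt_lt (hT.poly X hX.1)
      rw [← Wz_ext he] at this
      linarith
    · have := wt_lt (hT.poly Y hY.1)
      rw [← Wz_ext he] at this
      linarith

theorem Nb.no2 {b : Bool} (hT : Mono T) {z : ℂ} (hz : z ∈ Vx T) {P Q : Set ℂ} (h : Nb b T z P Q) : ¬ Nb b T z Q P := by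
  intro h'
  have := Nb.cyc (b := b) hT hz (A := {P, Q}) (by rintro X (rfl | rfl); exacts [h.m1, h.m2]) ⟨P, by simp⟩ (by
    rintro X (rfl | rfl) Y hY
    · rw [← h.right hT hY]; simp
    · rw [← h'.right hT hY]; simp)
  have h3 := hT.co_card hz
  rw [← this, Set.ncard_pair h.ne] at h3
  omega

theorem lemma_two {b : Bool} (hT : Mono T) {z : ℂ} (hz : z ∈ Vx T) {P Q : Set ℂ} {ρ : Mo} (h : NR T z P Q ρ)
    (hN : Nb b T z P Q) (hQ : Q ∈ Lt T z P z) (hc : (Lt T z P z).ncard = 2) : False := by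
  have hset : ({P, Q} : Set (Set ℂ)) = Lt T z P z := by
    apply Set.eq_of_subset_of_ncard_le
    · rintro X (rfl | rfl)
      exacts [self_lt hN.m1, hQ]
    · rw [hc, Set.ncard_pair hN.ne]
    · exact hT.lt_fin _ _ _
  have h1 : ρ • P ∈ ({P, Q} : Set (Set ℂ)) := by rw [hset]; exact lt_rot h.fx (self_lt hN.m1) h.m1
  have h2 : ρ • Q ∈ ({P, Q} : Set (Set ℂ)) := by rw [hset]; exact lt_rot h.fx hQ h.m2
  have h3 : ρ • P = Q := by
    rcases h1 with e | e
    · exact absurd e (h.nf hT hz hN.m1)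
    · exact e
  have h4 : ρ • Q = P := by
    rcases h2 with e | e
    · exact e
    · exact absurd e (h.symm.nf hT hz hN.m2)
  have := hN.smul ρ h.fx h.m1 h.m2
  rw [h3, h4] at this
  exact hN.no2 hT hz this

theorem lemma_F {b : Bool} (hT : Mono T) {z : ℂ} (hz : z ∈ Vx T) {P Q : Set ℂ} {ρ : Mo} (h : NR T z P Q ρ)
    (hN : Nb b T z P Q) (h1 : ρ • P ≠ Q) (h2 : ρ • Q ≠ P) (hC : ∀ X ∈ Co T z, X = P ∨ X = Q ∨ X = ρ • P ∨ X = ρ • Q) : False := by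
  have hN' := hN.smul ρ h.fx h.m1 h.m2
  have a1 : Nb b T z Q (ρ • P) := by
    obtain ⟨X, hX⟩ := nb_ex b hT hz hN.m2
    rcases hC X hX.m2 with rfl | rfl | rfl | rfl
    · exact absurd hX (hN.no2 hT hz)
    · exact absurd rfl hX.ne
    · exact hX
    · exact absurd (hN'.left hT hX) h1
  have a2 : Nb b T z (ρ • Q) P := by
    obtain ⟨X, hX⟩ := nb_ex b hT hz h.m2
    rcases hC X hX.m2 with rfl | rfl | rfl | rfl
    · exact hX
    · exact absurd (hX.left hT hN) h2
    · exact absurd hX (hN'.no2 hT hz)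
    · exact absurd rfl hX.ne
  have hr : ρ * ρ = 1 := by
    obtain ⟨_, _, _, r, m, l, s1, s2⟩ := hN
    obtain ⟨_, _, _, r', m', l', s3, s4⟩ := a1
    obtain ⟨_, _, _, r'', m'', l'', s5, s6⟩ := a2
    have t1 := s1.smul ρ
    have t2 := s2.smul ρ
    rw [h.fx] at t1 t2
    have e1 := (s4.unique t1).1
    have e2 := (s3.unique s2).2
    have e3 := (s5.unique t2).2
    have e4 := (s6.unique s1).1
    apply Mo.eq_one (x := z)
    · rw [mul_smul, h.fx, h.fx]
    · have hl := s2.l0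
      rw [e2] at e1
      rw [e3] at e4
      have : ((ρ.a : ℂ) * ρ.a - 1) * l = 0 := by rw [sub_mul, mul_assoc, e4, ← e1]; ring
      rcases mul_eq_zero.1 this with h5 | h5
      · rw [Mo.mul_a]
        exact Circle.ext (by simpa using sub_eq_zero.1 h5)
      · exact absurd h5 hl
  apply h.ne
  apply hT.co_of_sub
  intro X hX
  rcases hC X hX with rfl | rfl | rfl | rfl
  · exact h.m1
  · exact h.m2
  · rw [← mul_smul, hr, one_smul]; exact hN.m1
  · rw [← mul_smul, hr, one_smul]; exact hN.m2

theorem rot_comm {z : ℂ} {g f : Mo} (h1 : g • z = z) (h2 : f • z = z) : g * f = f * g := by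
  have a1 : (g * f) • z = z := by rw [mul_smul, h2, h1]
  have a2 : (f * g) • z = z := by rw [mul_smul, h1, h2]
  rw [Mo.eq_rot a1, Mo.eq_rot a2, Mo.mul_a, Mo.mul_a, mul_comm]

/-- a rotation fixing the vertex transports succession when letters agree -/
theorem nb_rot {b : Bool} {z : ℂ} {X Y X' Y' : Set ℂ} (hN : Nb b T z X Y) (hN' : Nb b T z X' Y')
    {f : Mo} (hf : f • z = z) (hfX : f • X = X') (hY : Y' ∈ Lt T z Y z) : f • Y = Y' := by
  obtain ⟨mX, mY, _, r, m, l, s1, s2⟩ := hN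
  obtain ⟨mX', mY', _, r', m', l', s1', s2'⟩ := hN'
  obtain ⟨_, g', e3, e4⟩ := hY
  have t1 := s1.smul f
  rw [hf, hfX] at t1
  have u1 := (t1.unique s1').2
  have t2 := s2.smul g'
  rw [e4, e3] at t2
  have u2 := (t2.unique s2').1
  have : f = g' := by
    apply Mo.ext_two (x := z) (y := z + m) (by rw [hf, e4])
    · have v1 := Mo.smul_sub' f (z + m) z
      have v2 := Mo.smul_sub' g' (z + m) z
      rw [add_sub_cancel_left, hf, u1] at v1
      rw [add_sub_cancel_left, e4, u2] at v2
      exact sub_left_injective (v1.trans v2.symm)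
    · intro e
      exact s1.l0 (by simpa using e)
  rw [this, e3]

theorem lemma_G (hT : Mono T) {z : ℂ} (hz : z ∈ Vx T) {P Q : Set ℂ} {ρ : Mo} (hP : P ∈ Co T z) (h : NR T z P Q ρ)
    (hC : ∀ X ∈ Co T z, X ∈ Lt T z P z) : False := by
  have hA := Nb.cyc (b := true) hT hz (A := {X | X ∈ Co T z ∧ ρ • X ∈ Co T z}) (fun X hX => hX.1) ⟨P, hP, h.m1⟩ (by
    rintro X ⟨h1, h2⟩ Y hN
    obtain ⟨Y', hN'⟩ := nb_ex true hT hz h2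
    refine ⟨hN.m2, ?_⟩
    rw [nb_rot hN hN' h.fx rfl (lt_tr (lt_symm hP (hC Y hN.m2)) (hC Y' hN'.m2))]
    exact hN'.m2)
  apply h.ne
  apply hT.co_of_sub
  intro X hX
  rw [← hA] at hX
  exact hX.2


/-- all sides have length s -/
def Sd (X : Set ℂ) (s : ℝ) : Prop := ∀ (b : Bool) u v, Lb b X u v → ‖v - u‖ = s

theorem Tr.sd {X : Set ℂ} (hX : Pgon X) (h : Tr X) : ∃ s, Sd X s := by
  obtain ⟨u0, hu0⟩ := hX.ext_ne
  obtain ⟨v0, hv0⟩ := Lb.ex true hX hu0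
  have key : ∀ u v, Lb true X u v → ‖v - u‖ = ‖v0 - u0‖ := by
    intro u v huv
    obtain ⟨σ, h1, h2⟩ := h u0 hu0 u huv.e1
    have h3 := hv0.smul σ
    rw [h1, h2] at h3
    rw [huv.right h3, ← h2, Mo.smul_sub', norm_mul, Mo.norm_a, one_mul]
  refine ⟨‖v0 - u0‖, ?_⟩
  intro b u v huv
  cases b
  · rw [norm_sub_rev]; exact key v u (Lb.flip (b := false) hX huv)
  · exact key u v huv

theorem Sd.adj {b : Bool} (hT : Mono T) (hF : NF T) {z : ℂ} (hz : z ∈ Vx T) {X Y : Set ℂ} (h : Nb b T z X Y)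
    {s s' : ℝ} (h1 : Sd X s) (h2 : Sd Y s') : s = s' := by
  obtain ⟨x, hx⟩ := Lb.ex b (hT.poly X h.m1.1) (hF z hz X h.m1)
  have h3 := (h.across_nf hT hF hz hx).1
  rw [← h1 b z x hx, ← h2 b x z h3, norm_sub_rev]

theorem Sd.all (hT : Mono T) (hF : NF T) {z : ℂ} (hz : z ∈ Vx T) (htr : ∀ X ∈ Co T z, Tr X) {X Y : Set ℂ} (hX : X ∈ Co T z)
    (hY : Y ∈ Co T z) {s : ℝ} (h : Sd X s) : Sd Y s := by
  have := Nb.cyc (b := true) hT hz (A := {Y | Y ∈ Co T z ∧ Sd Y s}) (fun X hX => hX.1) ⟨X, hX, h⟩ (by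
    rintro U ⟨h1, h2⟩ V hN
    obtain ⟨s', hs'⟩ := (htr V hN.m2).sd (hT.poly V hN.m2.1)
    refine ⟨hN.m2, ?_⟩
    rw [Sd.adj hT hF hz hN h2 hs']; exact hs')
  rw [← this] at hY
  exact hY.2

theorem reg_l {X : Set ℂ} {z x r l : ℂ} {s : ℝ} (hs : Sd X s) (h : IsSec X z r l) (hx : Lb true X z x) : x = z + s * l := by
  have h0 := hs true z x hx
  obtain ⟨r', l', t, h1, ht, rfl, _, _⟩ := hx
  have e := (Sb.unique (b := true) h h1).2
  subst e
  rw [add_sub_cancel_left, norm_mul, h1.nl, Complex.norm_real, Real.norm_of_nonneg ht.le, mul_one] at h0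
  rw [h0]

theorem reg_r {X : Set ℂ} (hX : Pgon X) {z x r l : ℂ} {s : ℝ} (hs : Sd X s) (h : IsSec X z r l) (hx : Lb true X x z) :
    x = z + s * r := by
  have hx := hx.flip hX
  have h0 := hs false z x hx
  obtain ⟨r', l', t, h1, ht, rfl, _, _⟩ := hx
  have e := (Sb.unique (b := false) h h1).2
  subst e
  rw [add_sub_cancel_left, norm_mul, h1.nl, Complex.norm_real, Real.norm_of_nonneg ht.le, mul_one] at h0
  rw [h0]

theorem sec_im {r l c : ℂ} (h : 0 < cr r l) (e : l = c * r) : 0 < c.im := by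
  rw [e] at h
  unfold cr at h
  simp only [Complex.mul_re, Complex.mul_im] at h
  have : 0 < c.im * (r.re ^ 2 + r.im ^ 2) := by nlinarith
  by_contra! hn
  nlinarith [sq_nonneg r.re, sq_nonneg r.im]

theorem sd_pos {X : Set ℂ} (hX : Pgon X) {s : ℝ} (h : Sd X s) : 0 < s := by
  obtain ⟨u0, hu0⟩ := hX.ext_ne
  obtain ⟨v0, hv0⟩ := Lb.ex true hX hu0
  rw [← h _ _ _ hv0, norm_pos_iff, sub_ne_zero]
  exact hv0.ne

theorem reg3 {X : Set ℂ} (hX : Pgon X) (hn : nc X = 3) (htr : Tr X) {s : ℝ} (hs : Sd X s) {z r l : ℂ}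
    (hz : z ∈ extremePoints ℝ X) (h : IsSec X z r l) :
    ∃ c : ℂ, 0 < c.im ∧ c * c - c + 1 = 0 ∧ l = c * r ∧ extremePoints ℝ X = {z, z + s * l, z + s * r} := by
  obtain ⟨x, hx⟩ := Lb.ex true hX hz
  obtain ⟨w, h1, h2, _, _, hext⟩ := hx.tri hX hn
  have ex := reg_l hs h hx
  have ew := reg_r hX hs h h2
  have hs0 : (s : ℂ) ≠ 0 := by exact_mod_cast (sd_pos hX hs).ne'
  obtain ⟨σ, g1, g2⟩ := htr z hz x hx.e2
  have g3 : σ • x = w := by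
    have := hx.smul σ
    rw [g1, g2] at this
    exact this.right h1
  have g4 : σ • w = z := by
    have := h1.smul σ
    rw [g1, g3] at this
    exact this.right h2
  have a1 := Mo.smul_sub' σ x z
  have a2 := Mo.smul_sub' σ w x
  rw [g3, g2, ex, ew] at a1
  rw [g4, g3, ex, ew] at a2
  have b1 : r - l = σ.a * l := mul_left_cancel₀ hs0 (by linear_combination a1)
  have b2 : - r = σ.a * (r - l) := mul_left_cancel₀ hs0 (by linear_combination a2)
  have hpos : 0 < cr r l := by
    rcases h.pos with h | e
    · exact h
    · exact absurd e ((h.ext_iff hX.conv hz.1).1 hz |> fun h' => by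
        intro e; rw [e, cr_neg_right, cr_self] at h'; simp at h')
  have e1 : l = (-(σ.a : ℂ)) * r := by linear_combination (-1 : ℂ) * b1 - b2
  refine ⟨-(σ.a : ℂ), sec_im hpos e1, ?_, e1, ?_⟩
  · apply mul_right_cancel₀ h.r0
    linear_combination b1 + (1 + (σ.a : ℂ)) * e1
  · rw [hext, ex, ew]

theorem reg4 {X : Set ℂ} (hX : Pgon X) (hn : nc X = 4) (htr : Tr X) {s : ℝ} (hs : Sd X s) {z r l : ℂ}
    (hz : z ∈ extremePoints ℝ X) (h : IsSec X z r l) :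
    ∃ c : ℂ, 0 < c.im ∧ c * c + 1 = 0 ∧ l = c * r ∧ extremePoints ℝ X = {z, z + s * l, z + s * (l + r), z + s * r} := by
  obtain ⟨x, hx⟩ := Lb.ex true hX hz
  obtain ⟨w, y, h1, h2, h3, hext⟩ := hx.quad hX hn
  have ex := reg_l hs h hx
  have ew := reg_r hX hs h h3
  have hs0 : (s : ℂ) ≠ 0 := by exact_mod_cast (sd_pos hX hs).ne'
  obtain ⟨σ, g1, g2⟩ := htr z hz x hx.e2
  have g3 : σ • x = w := by
    have := hx.smul σ
    rw [g1, g2] at this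
    exact this.right h1
  have g4 : σ • w = y := by
    have := h1.smul σ
    rw [g1, g3] at this
    exact this.right h2
  have g5 : σ • y = z := by
    have := h2.smul σ
    rw [g1, g4] at this
    exact this.right h3
  have a1 := Mo.smul_sub' σ x z
  have a2 := Mo.smul_sub' σ w x
  have a3 := Mo.smul_sub' σ y w
  rw [g3, g2] at a1
  rw [g4, g3] at a2
  rw [g5, g4] at a3
  have hwz : w - z ≠ 0 := by
    intro e
    rw [sub_eq_zero.1 e] at h1
    exact hx.no2 hX h1
  have c0 : ((σ.a : ℂ) * σ.a + 1) * (w - z) = 0 := by linear_combination (-1:ℂ) * a3 - a2 - σ.a * a1 - σ.a * a2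
  have c1 : (σ.a : ℂ) * σ.a + 1 = 0 := by
    rcases mul_eq_zero.1 c0 with e | e
    · exact e
    · exact absurd e hwz
  have b1 : r = σ.a * l := by
    apply mul_left_cancel₀ hs0
    linear_combination (-1:ℂ) * ew + a2 + a1 + σ.a * a1 + c1 * (x - z) + σ.a * ex
  have hpos : 0 < cr r l := by
    rcases h.pos with h | e
    · exact h
    · exact absurd e ((h.ext_iff hX.conv hz.1).1 hz |> fun h' => by
        intro e; rw [e, cr_neg_right, cr_self] at h'; simp at h')
  have e1 : l = (-(σ.a : ℂ)) * r := by linear_combination l * c1 + (σ.a : ℂ) * b1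
  refine ⟨-(σ.a : ℂ), sec_im hpos e1, ?_, e1, ?_⟩
  · linear_combination c1
  · have : w = z + s * (l + r) := by linear_combination a1 + ex + σ.a * ex - s * b1
    rw [hext, ex, ew, this]

theorem hull_congr {X Y : Set ℂ} (hX : Pgon X) (hY : Pgon Y) {g : Mo} (h : g • extremePoints ℝ X = extremePoints ℝ Y) : g • X = Y := by
  rw [← hX.hull, ← hY.hull, Mo.smul_convexHull, h]

theorem reg_congr {X Y : Set ℂ} {z : ℂ} (hX : Pgon X) (hY : Pgon Y) (hYC : Y ∈ Co T z) (hn : nc X = nc Y)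
    (h34 : nc X = 3 ∨ nc X = 4) (hXt : Tr X) (hYt : Tr Y) {s : ℝ} (hXs : Sd X s) (hYs : Sd Y s)
    (hzX : z ∈ extremePoints ℝ X) (hzY : z ∈ extremePoints ℝ Y) : Y ∈ Lt T z X z := by
  obtain ⟨r, l, h⟩ := Sb.ex true hX hzX
  obtain ⟨r', l', h'⟩ := Sb.ex true hY hzY
  have hr0 : r ≠ 0 := IsSec.r0 h
  have hu : ‖r' / r‖ = 1 := by rw [norm_div, Sb.nr h, Sb.nr h', div_one]
  let a : Circle := ⟨r' / r, mem_sphere_zero_iff_norm.2 hu⟩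
  have ha : (a : ℂ) * r = r' := by change r' / r * r = r'; field_simp
  refine ⟨hYC, Mo.rot z a, ?_, by rw [Mo.rot_smul]; ring⟩
  apply hull_congr hX hY
  have main : ∀ c c' : ℂ, l = c * r → l' = c' * r' → c = c' → (a : ℂ) * l = l' := by
    rintro c c' e1 e2 rfl
    rw [e1, e2, ← ha]; ring
  have img : ∀ S : Set ℂ, Mo.rot z a • S = (fun w => z + a * (w - z)) '' S := by
    intro S
    ext w
    rw [Set.mem_smul_set]
    simp only [mem_image, Mo.rot_smul]
  rcases h34 with h3 | h4
  · obtain ⟨c, c1, c2, c3, c4⟩ := reg3 hX h3 hXt hXs hzX h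
    obtain ⟨c', c1', c2', c3', c4'⟩ := reg3 hY (hn ▸ h3) hYt hYs hzY h'
    have : (c - c') * (c + c' - 1) = 0 := by linear_combination c2 - c2'
    have hcc : c = c' := by
      rcases mul_eq_zero.1 this with e | e
      · exact sub_eq_zero.1 e
      · have := congrArg Complex.im e
        simp at this; linarith
    have hl := main c c' c3 c3' hcc
    rw [c4, c4', img, image_insert_eq, image_insert_eq, image_singleton, ← hl, ← ha]
    congr 1
    · ring
    · congr 1
      · ring
      · congr 1; ring
  · obtain ⟨c, c1, c2, c3, c4⟩ := reg4 hX h4 hXt hXs hzX h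
    obtain ⟨c', c1', c2', c3', c4'⟩ := reg4 hY (hn ▸ h4) hYt hYs hzY h'
    have : (c - c') * (c + c') = 0 := by linear_combination c2 - c2'
    have hcc : c = c' := by
      rcases mul_eq_zero.1 this with e | e
      · exact sub_eq_zero.1 e
      · have := congrArg Complex.im e
        simp at this; linarith
    have hl := main c c' c3 c3' hcc
    rw [c4, c4', img, image_insert_eq, image_insert_eq, image_insert_eq, image_singleton, ← hl, ← ha]
    congr 1
    · ring
    · congr 1
      · ring
      · congr 1
        · ring
        · congr 1; ring

theorem eq_adj {b : Bool} (hT : Mono T) (hF : NF T) {z : ℂ} (hz : z ∈ Vx T) {X Y : Set ℂ} (h : Nb b T z X Y)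
    (hn : nc X = nc Y) (h34 : nc X = 3 ∨ nc X = 4) (hXt : Tr X) (hYt : Tr Y) : Y ∈ Lt T z X z := by
  have hX := hT.poly X h.m1.1
  have hY := hT.poly Y h.m2.1
  obtain ⟨s, hs⟩ := hXt.sd hX
  obtain ⟨s', hs'⟩ := hYt.sd hY
  have := Sd.adj hT hF hz h hs hs'
  subst this
  exact reg_congr hX hY h.m2 hn h34 hXt hYt hs hs' (hF z hz X h.m1) (hF z hz Y h.m2)

theorem eq_all (hT : Mono T) {z : ℂ} (hz : z ∈ Vx T) (hext : ∀ X ∈ Co T z, z ∈ extremePoints ℝ X)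
    (htr : ∀ X ∈ Co T z, Tr X) {X Y : Set ℂ} (hX : X ∈ Co T z) (hY : Y ∈ Co T z)
    (hn : nc X = nc Y) (h34 : nc X = 3 ∨ nc X = 4) : Y ∈ Lt T z X z := by
  have hF := nf_of hT hz hext
  obtain ⟨s, hs⟩ := (htr X hX).sd (hT.poly X hX.1)
  exact reg_congr (hT.poly X hX.1) (hT.poly Y hY.1) hY hn h34 (htr X hX) (htr Y hY) hs
    (Sd.all hT hF hz htr hX hY hs) (hext X hX) (hext Y hY)

theorem wt_cases {Q : Set ℂ} (hQ : Pgon Q) : (nc Q = 3 ∧ wt Q = 1 / 3) ∨ (nc Q = 4 ∧ wt Q = 1 / 2) ∨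
    (nc Q = 5 ∧ wt Q = 3 / 5) ∨ (nc Q = 6 ∧ wt Q = 2 / 3) ∨ (5 / 7 ≤ wt Q) := by
  have h3 := nc_ge hQ
  by_cases h7 : 7 ≤ nc Q
  · right; right; right; right
    have h4 : (7 : ℝ) ≤ nc Q := by exact_mod_cast h7
    unfold wt
    have : 2 / (nc Q : ℝ) ≤ 2 / 7 := by gcongr
    linarith
  · have : nc Q = 3 ∨ nc Q = 4 ∨ nc Q = 5 ∨ nc Q = 6 := by omega
    unfold wt
    rcases this with h | h | h | h <;> rw [h] <;> norm_num

theorem Mono.leftover (hT : Mono T) {z : ℂ} (hz : z ∈ Vx T) {S : Finset (Set ℂ)} (hS : ∀ X ∈ S, X ∈ Co T z)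
    {ρ : ℝ} (hsum : ∑ Q ∈ S, Wz z Q + ρ = 2) (h0 : 0 < ρ) (h1 : ρ ≤ 2 / 3) :
    (∃ X ∈ Co T z, X ∉ S ∧ Wz z X = ρ ∧ ∀ Y ∈ Co T z, Y = X ∨ Y ∈ S) ∨
    (ρ = 2 / 3 ∧ ∃ X ∈ Co T z, ∃ Y ∈ Co T z, X ≠ Y ∧ X ∉ S ∧ Y ∉ S ∧ Wz z X = 1 / 3 ∧ Wz z Y = 1 / 3 ∧
      ∀ Z ∈ Co T z, Z = X ∨ Z = Y ∨ Z ∈ S) := by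
  classical
  have hsub : S ⊆ hT.cof z := fun X hX => hT.mem_cof.2 (hS X hX)
  have hR : ∑ Q ∈ hT.cof z \ S, Wz z Q = ρ := by
    have := Finset.sum_sdiff (f := Wz z) hsub
    rw [hT.euler hz] at this
    linarith
  have hge : ∀ Q ∈ hT.cof z \ S, 1 / 3 ≤ Wz z Q := by
    intro Q hQ
    exact Wz_ge (hT.poly Q (hT.mem_cof.1 (Finset.mem_sdiff.1 hQ).1).1) z
  have hc := Finset.card_nsmul_le_sum _ _ _ hge
  rw [hR, nsmul_eq_mul] at hc
  have hc2 : (hT.cof z \ S).card ≤ 2 := by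
    have : ((hT.cof z \ S).card : ℝ) ≤ 2 := by linarith
    exact_mod_cast this
  have hc0 : (hT.cof z \ S).card ≠ 0 := by
    intro e
    rw [Finset.card_eq_zero] at e
    rw [e, Finset.sum_empty] at hR
    linarith
  have hall : ∀ X ∈ Co T z, X ∈ hT.cof z \ S ∨ X ∈ S := by
    intro X hX
    by_cases h : X ∈ S
    · exact Or.inr h
    · exact Or.inl (Finset.mem_sdiff.2 ⟨hT.mem_cof.2 hX, h⟩)
  rcases (show (hT.cof z \ S).card = 1 ∨ (hT.cof z \ S).card = 2 by omega) with e | e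
  · obtain ⟨X, hX⟩ := Finset.card_eq_one.1 e
    have hXm : X ∈ hT.cof z \ S := by rw [hX]; simp
    rw [hX, Finset.sum_singleton] at hR
    left
    refine ⟨X, hT.mem_cof.1 (Finset.mem_sdiff.1 hXm).1, (Finset.mem_sdiff.1 hXm).2, hR, ?_⟩
    intro Y hY
    have := hall Y hY
    rw [hX, Finset.mem_singleton] at this
    exact this
  · obtain ⟨X, Y, hne, hXY⟩ := Finset.card_eq_two.1 e
    have hXm : X ∈ hT.cof z \ S := by rw [hXY]; simp
    have hYm : Y ∈ hT.cof z \ S := by rw [hXY]; simp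
    have a1 := hge X hXm
    have a2 := hge Y hYm
    rw [hXY, Finset.sum_pair hne] at hR
    right
    refine ⟨by linarith, X, hT.mem_cof.1 (Finset.mem_sdiff.1 hXm).1, Y, hT.mem_cof.1 (Finset.mem_sdiff.1 hYm).1, hne,
      (Finset.mem_sdiff.1 hXm).2, (Finset.mem_sdiff.1 hYm).2, by linarith, by linarith, ?_⟩
    intro Z hZ
    have := hall Z hZ
    rw [hXY, Finset.mem_insert, Finset.mem_singleton, or_assoc] at this
    exact this

theorem nontr {X : Set ℂ} (h : ¬ Tr X) {z : ℂ} (hz : z ∈ extremePoints ℝ X) :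
    ∃ v ∈ extremePoints ℝ X, ¬ ∃ σ : Mo, σ • X = X ∧ σ • z = v := by
  by_contra! hcon
  apply h
  intro v hv w hw
  obtain ⟨σ, h1, h2⟩ := hcon v hv
  obtain ⟨τ, h3, h4⟩ := hcon w hw
  refine ⟨τ * σ⁻¹, ?_, ?_⟩
  · rw [mul_smul, inv_smul_eq_iff.2 h1.symm, h3]
  · rw [mul_smul, inv_smul_eq_iff.2 h2.symm, h4]

theorem Mono.lt_ne (hT : Mono T) {z v : ℂ} {X : Set ℂ} (hz : z ∈ Vx T) (hX : X ∈ Co T z) (he : z ∈ extremePoints ℝ X)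
    (hv : v ∈ extremePoints ℝ X) : ∃ Y, Y ∈ Lt T z X v := by
  have h1 := hT.lt_card (hT.poly X hX.1) hz he hv
  have h2 : (Lt T z X z).ncard ≠ 0 := (Set.ncard_pos (hT.lt_fin _ _ _)).2 ⟨X, self_lt hX⟩ |>.ne'
  rw [h1] at h2
  by_contra! hcon
  apply h2
  rw [Set.ncard_eq_zero (hT.lt_fin _ _ _)]
  exact Set.eq_empty_iff_forall_notMem.2 hcon

/-- a non-transitive tile has a further copy at the vertex -/
theorem Mono.nontr_two (hT : Mono T) {z : ℂ} {X : Set ℂ} (hz : z ∈ Vx T) (hX : X ∈ Co T z) (he : z ∈ extremePoints ℝ X)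
    (h : ¬ Tr X) : ∃ Y ∈ Co T z, Y ≠ X ∧ z ∈ extremePoints ℝ Y ∧ ∃ g : Mo, g • X = Y := by
  obtain ⟨v, hv, hn⟩ := nontr h he
  obtain ⟨Y, hY⟩ := hT.lt_ne hz hX he hv
  refine ⟨Y, hY.1, ?_, Lt_ext hv hY, ?_⟩
  · rintro rfl
    exact hn (lt_disj (self_lt hX) hY)
  · obtain ⟨_, g, h1, _⟩ := hY
    exact ⟨g, h1⟩

theorem Mono.nontr_three (hT : Mono T) {z : ℂ} {X : Set ℂ} (hz : z ∈ Vx T) (hX : X ∈ Co T z) (he : z ∈ extremePoints ℝ X)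
    (h3 : nc X = 3) (h : ¬ Tr X) : ∃ Y ∈ Co T z, ∃ Y' ∈ Co T z, Y ≠ X ∧ Y' ≠ X ∧ Y ≠ Y' ∧ z ∈ extremePoints ℝ Y ∧
      z ∈ extremePoints ℝ Y' ∧ (∃ g : Mo, g • X = Y) ∧ ∃ g : Mo, g • X = Y' := by
  have hP := hT.poly X hX.1
  obtain ⟨x, hx⟩ := Lb.ex true hP he
  obtain ⟨w, h1, h2, n1, n2, _⟩ := hx.tri hP h3
  obtain ⟨Y, hY⟩ := hT.lt_ne hz hX he hx.e2
  obtain ⟨Y', hY'⟩ := hT.lt_ne hz hX he h2.e1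
  have key : ∀ u v, u ≠ v → ∀ Z, Z ∈ Lt T z X u → Z ∉ Lt T z X v := by
    intro u v huv Z hZ hZ'
    obtain ⟨σ, s1, s2⟩ := lt_disj hZ hZ'
    rw [tri_rigid hP h3 h s1, one_smul] at s2
    exact huv s2
  refine ⟨Y, hY.1, Y', hY'.1, ?_, ?_, ?_, Lt_ext hx.e2 hY, Lt_ext h2.e1 hY', ?_, ?_⟩
  · rintro rfl; exact key _ _ hx.ne _ hY (self_lt hX)
  · rintro rfl; exact key _ _ n1 _ hY' (self_lt hX)
  · rintro rfl; exact key _ _ n2 _ hY' hY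
  · obtain ⟨_, g, h1, _⟩ := hY; exact ⟨g, h1⟩
  · obtain ⟨_, g, h1, _⟩ := hY'; exact ⟨g, h1⟩


theorem pair_of {S : Set (Set ℂ)} (hc : S.ncard = 2) {a b : Set ℂ} (ha : a ∈ S) (hb : b ∈ S) (hne : a ≠ b) :
    ∀ X ∈ S, X = a ∨ X = b := by
  have hset : ({a, b} : Set (Set ℂ)) = S := by
    apply Set.eq_of_subset_of_ncard_le
    · rintro X (rfl | rfl) <;> assumption
    · rw [hc, Set.ncard_pair hne]
    · exact Set.finite_of_ncard_ne_zero (by omega)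
  intro X hX
  rw [← hset] at hX
  exact hX

theorem Nb.chain4 {b : Bool} (hT : Mono T) {z : ℂ} (hz : z ∈ Vx T) {p q r s : Set ℂ} (h1 : Nb b T z p q) (h2 : Nb b T z q r)
    (h3 : Nb b T z r s) (hc : 3 < (Co T z).ncard) : s ≠ p ∧ s ≠ q ∧ s ≠ r := by
  refine ⟨?_, ?_, h3.ne.symm⟩
  · rintro rfl
    have := Nb.cyc (b := b) hT hz (A := {s, q, r}) (by rintro X (rfl | rfl | rfl); exacts [h1.m1, h2.m1, h3.m1]) ⟨s, by simp⟩ (by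
      rintro X (rfl | rfl | rfl) Y hY
      · rw [← h1.right hT hY]; simp
      · rw [← h2.right hT hY]; simp
      · rw [← h3.right hT hY]; simp)
    rw [← this] at hc
    have h5 := Set.ncard_insert_le s {q, r}
    have h6 := Set.ncard_insert_le q {r}
    rw [Set.ncard_singleton] at h6
    omega
  · rintro rfl
    exact h2.no2 hT hz h3

theorem Nb.chain5 {b : Bool} (hT : Mono T) {z : ℂ} (hz : z ∈ Vx T) {p q r s t : Set ℂ} (h1 : Nb b T z p q) (h2 : Nb b T z q r)
    (h3 : Nb b T z r s) (h4 : Nb b T z s t) (hc : 4 < (Co T z).ncard) : t ≠ p ∧ t ≠ q ∧ t ≠ r ∧ t ≠ s := by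
  refine ⟨?_, h2.chain4 hT hz h3 h4 (by omega)⟩
  rintro rfl
  have := Nb.cyc (b := b) hT hz (A := {t, q, r, s}) (by rintro X (rfl | rfl | rfl | rfl); exacts [h1.m1, h2.m1, h3.m1, h4.m1])
    ⟨t, by simp⟩ (by
    rintro X (rfl | rfl | rfl | rfl) Y hY
    · rw [← h1.right hT hY]; simp
    · rw [← h2.right hT hY]; simp
    · rw [← h3.right hT hY]; simp
    · rw [← h4.right hT hY]; simp)
  rw [← this] at hc
  have h5 := Set.ncard_insert_le t {q, r, s}
  have h6 := Set.ncard_insert_le q {r, s}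
  have h7 := Set.ncard_insert_le r {s}
  rw [Set.ncard_singleton] at h7
  omega

/-- a five-cycle of successive tiles -/
structure C5 (b : Bool) (T : Set (Set ℂ)) (z : ℂ) (p q r s t : Set ℂ) : Prop where
  h1 : Nb b T z p q
  h2 : Nb b T z q r
  h3 : Nb b T z r s
  h4 : Nb b T z s t
  h5 : Nb b T z t p
  all : ∀ X ∈ Co T z, X = p ∨ X = q ∨ X = r ∨ X = s ∨ X = t
  card : (Co T z).ncard = 5

theorem C5.mk' {b : Bool} (hT : Mono T) {z : ℂ} (hz : z ∈ Vx T) {p q r s t : Set ℂ} (h1 : Nb b T z p q) (h2 : Nb b T z q r)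
    (h3 : Nb b T z r s) (h4 : Nb b T z s t) (hc : (Co T z).ncard = 5) : C5 b T z p q r s t := by
  classical
  have a1 := h1.chain5 hT hz h2 h3 h4 (by omega)
  have a2 := h1.chain4 hT hz h2 h3 (by omega)
  have a3 : r ≠ p := by rintro rfl; exact h1.no2 hT hz h2
  have hset : (({p, q, r, s, t} : Finset (Set ℂ)) : Set (Set ℂ)) = Co T z := by
    apply Set.eq_of_subset_of_ncard_le
    · intro X hX
      simp only [Finset.coe_insert, Finset.coe_singleton, mem_insert_iff, mem_singleton_iff] at hX
      rcases hX with rfl | rfl | rfl | rfl | rfl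
      exacts [h1.m1, h2.m1, h3.m1, h4.m1, h4.m2]
    · rw [hc, Set.ncard_coe_finset, Finset.card_insert_of_notMem, Finset.card_insert_of_notMem,
        Finset.card_insert_of_notMem, Finset.card_insert_of_notMem, Finset.card_singleton]
      · simpa using h4.ne
      · simp only [Finset.mem_insert, Finset.mem_singleton, not_or]; exact ⟨h3.ne, a1.2.2.1.symm⟩
      · simp only [Finset.mem_insert, Finset.mem_singleton, not_or]; exact ⟨h2.ne, a2.2.1.symm, a1.2.1.symm⟩
      · simp only [Finset.mem_insert, Finset.mem_singleton, not_or]; exact ⟨h1.ne, a3.symm, a2.1.symm, a1.1.symm⟩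
    · exact hT.finCo z
  have hall : ∀ X ∈ Co T z, X = p ∨ X = q ∨ X = r ∨ X = s ∨ X = t := by
    intro X hX
    rw [← hset] at hX
    simpa using hX
  refine ⟨h1, h2, h3, h4, ?_, hall, hc⟩
  obtain ⟨X, hX⟩ := nb_ex b hT hz h4.m2
  rcases hall X hX.m2 with rfl | rfl | rfl | rfl | rfl
  · exact hX
  · exact absurd (hX.left hT h1) a1.1
  · exact absurd (hX.left hT h2) a1.2.1
  · exact absurd (hX.left hT h3) a1.2.2.1
  · exact absurd rfl hX.ne

theorem C5.rot {b : Bool} {z : ℂ} {p q r s t : Set ℂ} (h : C5 b T z p q r s t) : C5 b T z q r s t p :=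
  ⟨h.h2, h.h3, h.h4, h.h5, h.h1, fun X hX => by rcases h.all X hX with h | h | h | h | h <;> simp [h], h.card⟩

theorem C5.flip {b : Bool} {z : ℂ} {p q r s t : Set ℂ} (h : C5 b T z p q r s t) : C5 (!b) T z t s r q p :=
  ⟨h.h4.not, h.h3.not, h.h2.not, h.h1.not, h.h5.not, fun X hX => by rcases h.all X hX with h | h | h | h | h <;> simp [h], h.card⟩

theorem co_mem {z y : ℂ} {g : Mo} (hC : g • Co T z = Co T y) {X : Set ℂ} (hX : X ∈ Co T z) : g • X ∈ Co T y := by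
  rw [← hC]; exact Set.smul_mem_smul_set hX

theorem co_mem' {z y : ℂ} {g : Mo} (hC : g • Co T z = Co T y) {X : Set ℂ} (hX : X ∈ Co T y) :
    ∃ Y ∈ Co T z, g • Y = X := by
  rw [← hC] at hX; exact hX

theorem co_ncard {z y : ℂ} {g : Mo} (hC : g • Co T z = Co T y) : (Co T y).ncard = (Co T z).ncard := by
  rw [← hC]
  have : g • Co T z = (fun X => g • X) '' Co T z := rfl
  rw [this, Set.InjOn.ncard_image (fun X _ Y _ e => smul_left_cancel g e)]

theorem Nb.tp {b : Bool} {z y : ℂ} {g : Mo} (hg : g • z = y) (hC : g • Co T z = Co T y) {X Y : Set ℂ} (h : Nb b T z X Y) :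
    Nb b T y (g • X) (g • Y) := h.smul g hg (co_mem hC h.m1) (co_mem hC h.m2)

theorem C5.tp {b : Bool} {z y : ℂ} {g : Mo} (hg : g • z = y) (hC : g • Co T z = Co T y) {p q r s t : Set ℂ}
    (h : C5 b T z p q r s t) : C5 b T y (g • p) (g • q) (g • r) (g • s) (g • t) := by
  refine ⟨h.h1.tp hg hC, h.h2.tp hg hC, h.h3.tp hg hC, h.h4.tp hg hC, h.h5.tp hg hC, ?_, by rw [co_ncard hC, h.card]⟩
  intro X hX
  obtain ⟨Y, hY, rfl⟩ := co_mem' hC hX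
  rcases h.all Y hY with h | h | h | h | h <;> simp [h]

structure SN1 (T : Set (Set ℂ)) (P : Set ℂ) : Prop where
  nf : NF T
  pg : Pgon P
  n3 : nc P = 3
  rg : ∀ σ : Mo, σ • P = P → σ = 1
  two : ∀ y ∈ Vx T, ∀ v ∈ extremePoints ℝ P, (Lt T y P v).ncard = 2
  all : ∀ y ∈ Vx T, ∀ X ∈ Co T y, ∃ v ∈ extremePoints ℝ P, X ∈ Lt T y P v

structure SQ (T : Set (Set ℂ)) : Prop where
  nf : NF T
  ex : ∀ b, ∀ y ∈ Vx T, ∃ t1 t2 s1 t3 s2, C5 b T y t1 t2 s1 t3 s2 ∧ nc t1 = 3 ∧ nc t2 = 3 ∧ nc s1 = 4 ∧ nc t3 = 3 ∧ nc s2 = 4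

structure SS (T : Set (Set ℂ)) : Prop where
  nf : NF T
  ex : ∀ b, ∀ y ∈ Vx T, ∃ h t1 t2 t3 t4, C5 b T y h t1 t2 t3 t4 ∧ nc h = 6 ∧ nc t1 = 3 ∧ nc t2 = 3 ∧ nc t3 = 3 ∧ nc t4 = 3

structure T3 (b : Bool) (T : Set (Set ℂ)) (Δ : Set ℂ) (y : ℂ) (t1 t2 t3 : Set ℂ) : Prop where
  h1 : Nb b T y t1 t2
  h2 : Nb b T y t2 t3
  no : ¬ Nb b T y t3 t1
  iff : ∀ X ∈ Co T y, (y ∈ extremePoints ℝ X ∧ ∃ g : Mo, g • Δ = X) ↔ (X = t1 ∨ X = t2 ∨ X = t3)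

structure S3 (T : Set (Set ℂ)) (Δ : Set ℂ) : Prop where
  pg : Pgon Δ
  n3 : nc Δ = 3
  tr : Tr Δ
  ex : ∀ b, ∀ y ∈ Vx T, ∃ t1 t2 t3, T3 b T Δ y t1 t2 t3

theorem T3.flip {b : Bool} {Δ : Set ℂ} {y : ℂ} {t1 t2 t3 : Set ℂ} (h : T3 b T Δ y t1 t2 t3) : T3 (!b) T Δ y t3 t2 t1 :=
  ⟨h.h2.not, h.h1.not, fun h' => h.no h'.not', fun X hX => by rw [h.iff X hX]; tauto⟩

theorem T3.tp {b : Bool} {Δ : Set ℂ} {z y : ℂ} {g : Mo} (hg : g • z = y) (hC : g • Co T z = Co T y) {t1 t2 t3 : Set ℂ}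
    (h : T3 b T Δ z t1 t2 t3) : T3 b T Δ y (g • t1) (g • t2) (g • t3) := by
  refine ⟨h.h1.tp hg hC, h.h2.tp hg hC, ?_, ?_⟩
  · intro h'
    apply h.no
    have := h'.smul g⁻¹ (y := z) (by rw [inv_smul_eq_iff, hg])
    rw [inv_smul_smul, inv_smul_smul] at this
    exact this h.h2.m2 h.h1.m1
  · intro X hX
    obtain ⟨Y, hY, rfl⟩ := co_mem' hC hX
    have e : ∀ t, g • Y = g • t ↔ Y = t := fun t => smul_left_cancel_iff g
    rw [e, e, e, ← h.iff Y hY]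
    subst hg
    rw [ext_smul_iff]
    have : (∃ f : Mo, f • Δ = g • Y) ↔ ∃ f : Mo, f • Δ = Y := by
      constructor
      · rintro ⟨f, h⟩; exact ⟨g⁻¹ * f, by rw [mul_smul, h, inv_smul_smul]⟩
      · rintro ⟨f, h⟩; exact ⟨g * f, by rw [mul_smul, h]⟩
    rw [this]

theorem S3.of (hT : Mono T) {Δ : Set ℂ} (h1 : Pgon Δ) (h2 : nc Δ = 3) (h3 : Tr Δ) {b : Bool} {z : ℂ} (hz : z ∈ Vx T)
    {t1 t2 t3 : Set ℂ} (h : T3 b T Δ z t1 t2 t3) : S3 T Δ := by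
  refine ⟨h1, h2, h3, ?_⟩
  intro b' y hy
  obtain ⟨g, hg, hC⟩ := hT.mono z hz y hy
  have h4 := h.tp hg hC
  by_cases e : b' = b
  · subst e; exact ⟨_, _, _, h4⟩
  · have : b' = !b := by cases b <;> cases b' <;> simp_all
    subst this; exact ⟨_, _, _, h4.flip⟩

theorem SQ.of (hT : Mono T) (hF : NF T) {b : Bool} {z : ℂ} (hz : z ∈ Vx T) {t1 t2 s1 t3 s2 : Set ℂ}
    (h : C5 b T z t1 t2 s1 t3 s2) (n1 : nc t1 = 3) (n2 : nc t2 = 3) (n3 : nc s1 = 4) (n4 : nc t3 = 3) (n5 : nc s2 = 4) : SQ T := by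
  refine ⟨hF, ?_⟩
  intro b' y hy
  obtain ⟨g, hg, hC⟩ := hT.mono z hz y hy
  have h4 := h.tp hg hC
  by_cases e : b' = b
  · subst e; exact ⟨_, _, _, _, _, h4, by simp only [nc_smul]; tauto⟩
  · have : b' = !b := by cases b <;> cases b' <;> simp_all
    subst this; exact ⟨_, _, _, _, _, h4.flip.rot.rot.rot, by simp only [nc_smul]; tauto⟩

theorem SS.of (hT : Mono T) (hF : NF T) {b : Bool} {z : ℂ} (hz : z ∈ Vx T) {h t1 t2 t3 t4 : Set ℂ}
    (hc : C5 b T z h t1 t2 t3 t4) (n1 : nc h = 6) (n2 : nc t1 = 3) (n3 : nc t2 = 3) (n4 : nc t3 = 3) (n5 : nc t4 = 3) : SS T := by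
  refine ⟨hF, ?_⟩
  intro b' y hy
  obtain ⟨g, hg, hC⟩ := hT.mono z hz y hy
  have h4 := hc.tp hg hC
  by_cases e : b' = b
  · subst e; exact ⟨_, _, _, _, _, h4, by simp only [nc_smul]; tauto⟩
  · have : b' = !b := by cases b <;> cases b' <;> simp_all
    subst this; exact ⟨_, _, _, _, _, h4.flip.rot.rot.rot.rot, by simp only [nc_smul]; tauto⟩

theorem lt_smul {z y v : ℂ} {g : Mo} {P : Set ℂ} (hg : g • z = y) (hC : g • Co T z = Co T y) : Lt T y P v = g • Lt T z P v := by
  ext X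
  constructor
  · rintro ⟨h1, f, h2, h3⟩
    obtain ⟨Y, hY, rfl⟩ := co_mem' hC h1
    refine ⟨Y, ⟨hY, g⁻¹ * f, by rw [mul_smul, h2, inv_smul_smul], by rw [mul_smul, h3, ← hg, inv_smul_smul]⟩, rfl⟩
  · rintro ⟨Y, ⟨hY, f, h2, h3⟩, rfl⟩
    exact ⟨co_mem hC hY, g * f, by rw [mul_smul, h2], by rw [mul_smul, h3, hg]⟩

theorem SN1.of (hT : Mono T) {P : Set ℂ} {z : ℂ} (hz : z ∈ Vx T) (hP : P ∈ Co T z) (n3 : nc P = 3) (hnt : ¬ Tr P)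
    (two : ∀ v ∈ extremePoints ℝ P, (Lt T z P v).ncard = 2)
    (all : ∀ X ∈ Co T z, ∃ v ∈ extremePoints ℝ P, X ∈ Lt T z P v) : SN1 T P := by
  have hpg := hT.poly P hP.1
  refine ⟨?_, hpg, n3, fun σ h => tri_rigid hpg n3 hnt h, ?_, ?_⟩
  · apply nf_of hT hz
    intro X hX
    obtain ⟨v, hv, h⟩ := all X hX
    exact Lt_ext hv h
  · intro y hy v hv
    obtain ⟨g, hg, hC⟩ := hT.mono z hz y hy
    rw [lt_smul hg hC, ← two v hv]
    have : g • Lt T z P v = (fun X => g • X) '' Lt T z P v := rfl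
    rw [this, Set.InjOn.ncard_image (fun X _ Y _ e => smul_left_cancel g e)]
  · intro y hy X hX
    obtain ⟨g, hg, hC⟩ := hT.mono z hz y hy
    obtain ⟨Y, hY, rfl⟩ := co_mem' hC hX
    obtain ⟨v, hv, h⟩ := all Y hY
    refine ⟨v, hv, ?_⟩
    rw [lt_smul hg hC]; exact Set.smul_mem_smul_set h


theorem NR.c2 {z : ℂ} {P Q : Set ℂ} {ρ : Mo} (hT : Mono T) (hz : z ∈ Vx T) (hP : P ∈ Co T z) (h : NR T z P Q ρ) :
    2 ≤ (Lt T z P z).ncard := by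
  rw [← Set.ncard_pair (h.nf hT hz hP).symm]
  apply Set.ncard_le_ncard _ (hT.lt_fin _ _ _)
  rintro X (rfl | rfl)
  · exact self_lt hP
  · exact lt_rot h.fx (self_lt hP) h.m1

theorem caseA {b : Bool} (hT : Mono T) {z : ℂ} (hz : z ∈ Vx T) {P Q : Set ℂ} {ρ : Mo} (h : NR T z P Q ρ)
    (hN : Nb b T z P Q) (hnt : ¬ Tr P) : SN1 T P ∧ Q ∉ Lt T z P z := by
  classical
  have hP := hT.poly P hN.m1.1
  have hzP := h.ext hT hz hN.m1
  have hc2 := h.c2 hT hz hN.m1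
  have hc2' : (2 : ℝ) ≤ (Lt T z P z).ncard := by exact_mod_cast hc2
  obtain ⟨v, hv, hvn⟩ := nontr hnt hzP
  have hcv := hT.lt_card hP hz hv hzP
  have hdis : ∀ X, X ∈ Lt T z P z → X ∉ Lt T z P v := fun X h1 h2 => hvn (lt_disj h1 h2)
  set S := (hT.lt_fin z z P).toFinset with hSdef
  set V := (hT.lt_fin z v P).toFinset with hVdef
  have mS : ∀ X, X ∈ S ↔ X ∈ Lt T z P z := fun X => Set.Finite.mem_toFinset _
  have mV : ∀ X, X ∈ V ↔ X ∈ Lt T z P v := fun X => Set.Finite.mem_toFinset _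
  have hd : Disjoint S V := by
    rw [Finset.disjoint_left]
    intro X h1 h2
    exact hdis X ((mS X).1 h1) ((mV X).1 h2)
  have sumS : ∑ X ∈ S, Wz z X = (Lt T z P z).ncard * wt P := hT.sum_lt hzP
  have sumV : ∑ X ∈ V, Wz z X = (Lt T z P z).ncard * wt P := by rw [← hcv]; exact hT.sum_lt hv
  have hsub : ∀ X ∈ S ∪ V, X ∈ Co T z := by
    intro X hX
    rcases Finset.mem_union.1 hX with h | h
    · exact ((mS X).1 h).1
    · exact ((mV X).1 h).1
  have hsum := hT.sum_sub hz hsub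
  rw [Finset.sum_union hd, sumS, sumV] at hsum
  have hw := wt_ge hP
  have hQ2 : (Lt T z P z).ncard = 2 → Q ∉ Lt T z P z := fun hc hQ => lemma_two hT hz h hN hQ hc
  rcases wt_cases hP with ⟨n3, hw⟩ | ⟨n4, hw⟩ | ⟨_, hw⟩ | ⟨_, hw⟩ | hw
  · -- triangle
    obtain ⟨x, hx⟩ := Lb.ex true hP hzP
    obtain ⟨w, h1, h2, ne1, ne2, hext⟩ := hx.tri hP n3
    have key : ∀ u v, u ≠ v → ∀ Z, Z ∈ Lt T z P u → Z ∉ Lt T z P v := by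
      intro u v huv Z hZ hZ'
      obtain ⟨σ, s1, s2⟩ := lt_disj hZ hZ'
      rw [tri_rigid hP n3 hnt s1, one_smul] at s2
      exact huv s2
    have cx := hT.lt_card hP hz hx.e2 hzP
    have cw := hT.lt_card hP hz h2.e1 hzP
    set A := (hT.lt_fin z x P).toFinset with hA
    set B := (hT.lt_fin z w P).toFinset with hB
    have mA : ∀ X, X ∈ A ↔ X ∈ Lt T z P x := fun X => Set.Finite.mem_toFinset _
    have mB : ∀ X, X ∈ B ↔ X ∈ Lt T z P w := fun X => Set.Finite.mem_toFinset _
    have sumA : ∑ X ∈ A, Wz z X = (Lt T z P z).ncard * wt P := by rw [← cx]; exact hT.sum_lt hx.e2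
    have sumB : ∑ X ∈ B, Wz z X = (Lt T z P z).ncard * wt P := by rw [← cw]; exact hT.sum_lt h2.e1
    have d1 : Disjoint S A := by
      rw [Finset.disjoint_left]
      intro X h1 h2
      exact key _ _ hx.ne X ((mA X).1 h2) ((mS X).1 h1)
    have d2 : Disjoint (S ∪ A) B := by
      rw [Finset.disjoint_left]
      intro X h1 h2
      rcases Finset.mem_union.1 h1 with h | h
      · exact key _ _ ne1 X ((mB X).1 h2) ((mS X).1 h)
      · exact key _ _ ne2 X ((mB X).1 h2) ((mA X).1 h)
    have hsub' : ∀ X ∈ S ∪ A ∪ B, X ∈ Co T z := by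
      intro X hX
      rcases Finset.mem_union.1 hX with h | h
      · rcases Finset.mem_union.1 h with h | h
        · exact ((mS X).1 h).1
        · exact ((mA X).1 h).1
      · exact ((mB X).1 h).1
    have sumT : ∑ X ∈ S ∪ A ∪ B, Wz z X = (Lt T z P z).ncard := by
      rw [Finset.sum_union d2, Finset.sum_union d1, sumS, sumA, sumB, hw]; ring
    have hle := hT.sum_sub hz hsub'
    rw [sumT] at hle
    have hc : (Lt T z P z).ncard = 2 := by
      have : (Lt T z P z).ncard ≤ 2 := by exact_mod_cast hle
      omega
    have hfull := hT.sum_full hz hsub' (by rw [sumT, hc]; norm_num)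
    refine ⟨SN1.of hT hz hN.m1 n3 hnt ?_ ?_, hQ2 hc⟩
    · intro u hu
      rw [hT.lt_card hP hz hu hzP, hc]
    · intro X hX
      have := hfull X hX
      rcases Finset.mem_union.1 this with h | h
      · rcases Finset.mem_union.1 h with h | h
        · exact ⟨z, hzP, (mS X).1 h⟩
        · exact ⟨x, hx.e2, (mA X).1 h⟩
      · exact ⟨w, h2.e1, (mB X).1 h⟩
  · exfalso
    rw [hw] at hsum
    have hc : (Lt T z P z).ncard = 2 := by
      have h5 : ((Lt T z P z).ncard : ℝ) ≤ 2 := by linarith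
      have : (Lt T z P z).ncard ≤ 2 := by exact_mod_cast h5
      omega
    have hfull := hT.sum_full hz hsub (by rw [Finset.sum_union hd, sumS, sumV, hw, hc]; norm_num)
    have hQS := hQ2 hc
    have hQV : Q ∈ Lt T z P v := by
      rcases Finset.mem_union.1 (hfull Q hN.m2) with h | h
      · exact absurd ((mS Q).1 h) hQS
      · exact (mV Q).1 h
    have hρQ := lt_rot h.fx hQV h.m2
    have hρP := lt_rot h.fx (self_lt hN.m1) h.m1
    apply lemma_F hT hz h hN
    · intro e; rw [e] at hρP; exact hQS hρP
    · intro e; rw [e] at hρQ; exact hdis P (self_lt hN.m1) hρQ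
    · intro X hX
      rcases Finset.mem_union.1 (hfull X hX) with h' | h'
      · have := pair_of hc (self_lt hN.m1) hρP (h.nf hT hz hN.m1).symm X ((mS X).1 h')
        tauto
      · have := pair_of (hcv.trans hc) hQV hρQ (h.symm.nf hT hz hN.m2).symm X ((mV X).1 h')
        tauto
  all_goals
    exfalso
    nlinarith

theorem caseB1 {b : Bool} (hT : Mono T) {z : ℂ} (hz : z ∈ Vx T) {P Q : Set ℂ} {ρ : Mo} (h : NR T z P Q ρ)
    (hN : Nb b T z P Q) (htr : Tr P) (hQ : Q ∈ Lt T z P z) : SS T ∨ S3 T P := by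
  classical
  have hP := hT.poly P hN.m1.1
  have hzP := h.ext hT hz hN.m1
  have hc2 := h.c2 hT hz hN.m1
  have hc3 : 3 ≤ (Lt T z P z).ncard := by
    by_contra hlt
    exact lemma_two hT hz h hN hQ (by omega)
  set S := (hT.lt_fin z z P).toFinset with hSdef
  have mS : ∀ X, X ∈ S ↔ X ∈ Lt T z P z := fun X => Set.Finite.mem_toFinset _
  have hsub : ∀ X ∈ S, X ∈ Co T z := fun X hX => ((mS X).1 hX).1
  have sumS : ∑ X ∈ S, Wz z X = (Lt T z P z).ncard * wt P := hT.sum_lt hzP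
  have hsum := hT.sum_sub hz hsub
  have hG : ¬ (5 / 3 < ∑ X ∈ S, Wz z X) := by
    intro hlt
    have hfull := hT.sum_full hz hsub hlt
    exact lemma_G hT hz hN.m1 h (fun X hX => (mS X).1 (hfull X hX))
  have trS : ∀ X ∈ S, Tr X := by
    intro X hX
    obtain ⟨_, g, rfl, _⟩ := (mS X).1 hX
    exact htr.smul g
  have extS : ∀ X ∈ S, z ∈ extremePoints ℝ X := fun X hX => Lt_ext hzP ((mS X).1 hX)
  have trback : ∀ X Y, Y ∈ S → (∃ g : Mo, g • X = Y) → Tr X := by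
    rintro X Y hY ⟨g, rfl⟩
    have := (trS _ hY).smul g⁻¹
    rwa [inv_smul_smul] at this
  set c := (Lt T z P z).ncard with hcdef
  rw [sumS] at hsum hG
  have hc3' : (3 : ℝ) ≤ c := by exact_mod_cast hc3
  rcases wt_cases hP with ⟨n3, hw⟩ | ⟨n4, hw⟩ | ⟨_, hw⟩ | ⟨_, hw⟩ | hw
  · rw [hw] at hsum hG
    have hc5 : c ≤ 5 := by
      by_contra! hlt
      have : (6 : ℝ) ≤ c := by exact_mod_cast hlt
      apply hG; linarith
    rcases (show c = 3 ∨ c = 4 ∨ c = 5 by omega) with e | e | e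
    · right
      have hρP := lt_rot h.fx (self_lt hN.m1) h.m1
      have hρQ := lt_rot h.fx hQ h.m2
      have hN' := hN.smul ρ h.fx h.m1 h.m2
      have main : ∀ t1 t2 t3, Nb b T z t1 t2 → Nb b T z t2 t3 → t1 ∈ Lt T z P z → t2 ∈ Lt T z P z → t3 ∈ Lt T z P z → S3 T P := by
        intro t1 t2 t3 k1 k2 m1 m2 m3
        have k13 : t3 ≠ t1 := by rintro rfl; exact k1.no2 hT hz k2
        have hset : ({t1, t2, t3} : Set (Set ℂ)) = Lt T z P z := by
          apply Set.eq_of_subset_of_ncard_le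
          · rintro X (rfl | rfl | rfl) <;> assumption
          · rw [← hcdef, e, Set.ncard_eq_three.2 ⟨t1, t2, t3, k1.ne, k13.symm, k2.ne, rfl⟩]
          · exact hT.lt_fin _ _ _
        apply S3.of hT hP n3 htr hz (b := b) (t1 := t1) (t2 := t2) (t3 := t3)
        refine ⟨k1, k2, ?_, ?_⟩
        · intro k3
          have := Nb.cyc (b := b) hT hz (A := {t1, t2, t3}) (by rintro X (rfl | rfl | rfl); exacts [k1.m1, k2.m1, k3.m1])
            ⟨t1, by simp⟩ (by
            rintro X (rfl | rfl | rfl) Y hY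
            · rw [← k1.right hT hY]; simp
            · rw [← k2.right hT hY]; simp
            · rw [← k3.right hT hY]; simp)
          exact lemma_G hT hz hN.m1 h (fun X hX => by rw [← this, hset] at hX; exact hX)
        · intro X hX
          constructor
          · rintro ⟨h1, g, h2⟩
            have := htr.lt hzP hX h1 h2
            rw [← hset] at this
            exact this
          · intro h1
            have h2 : X ∈ Lt T z P z := by rw [← hset]; exact h1
            exact ⟨Lt_ext hzP h2, by obtain ⟨_, g, h3, _⟩ := h2; exact ⟨g, h3⟩⟩
      by_cases e1 : ρ • P = Q
      · rw [e1] at hN'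
        exact main P Q (ρ • Q) hN hN' (self_lt hN.m1) hQ hρQ
      · have e2 : ρ • Q = P := by
          by_contra e2
          have hset : (({P, Q, ρ • P, ρ • Q} : Finset (Set ℂ)) : Set (Set ℂ)) ⊆ Lt T z P z := by
            intro X hX
            simp only [Finset.coe_insert, Finset.coe_singleton, mem_insert_iff, mem_singleton_iff] at hX
            rcases hX with rfl | rfl | rfl | rfl
            exacts [self_lt hN.m1, hQ, hρP, hρQ]
          have := Set.ncard_le_ncard hset (hT.lt_fin _ _ _)
          rw [Set.ncard_coe_finset, Finset.card_insert_of_notMem, Finset.card_insert_of_notMem,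
            Finset.card_insert_of_notMem, Finset.card_singleton] at this
          · omega
          · simpa using hN.ne
          · simp only [Finset.mem_insert, Finset.mem_singleton, not_or]
            exact ⟨fun h => e1 h.symm, (h.symm.nf hT hz hN.m2).symm⟩
          · simp only [Finset.mem_insert, Finset.mem_singleton, not_or]
            exact ⟨hN.ne, (h.nf hT hz hN.m1).symm, fun h => e2 h.symm⟩
        rw [e2] at hN'
        exact main (ρ • P) P Q hN' hN hρP (self_lt hN.m1) hQ
    · rcases hT.leftover hz hsub (ρ := 2 / 3) (by rw [sumS, hw, e]; norm_num) (by norm_num) (by norm_num) with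
        ⟨X, hX, hXS, hWX, hall⟩ | ⟨_, X, hX, Y, hY, hne, hXS, hYS, hWX, hWY, hall⟩
      · left
        have hXe := Wz_lt (show Wz z X < 1 by rw [hWX]; norm_num)
        have n6 : nc X = 6 := by
          rw [Wz_ext hXe] at hWX
          rcases wt_cases (hT.poly X hX.1) with ⟨n, w⟩ | ⟨n, w⟩ | ⟨n, w⟩ | ⟨n, w⟩ | w
          · rw [w] at hWX; norm_num at hWX
          · rw [w] at hWX; norm_num at hWX
          · rw [w] at hWX; norm_num at hWX
          · exact n
          · rw [hWX] at w; norm_num at w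
        have hF : NF T := nf_of hT hz (fun Y hY => by
          rcases hall Y hY with rfl | h
          · exact hXe
          · exact extS Y h)
        have hcard : (Co T z).ncard = 5 := by
          have : Co T z = ((insert X S : Finset (Set ℂ)) : Set (Set ℂ)) := by
            ext Y
            simp only [Finset.coe_insert, mem_insert_iff, Finset.mem_coe]
            constructor
            · exact hall Y
            · rintro (rfl | h)
              · exact hX
              · exact hsub Y h
          rw [this, Set.ncard_coe_finset, Finset.card_insert_of_notMem hXS, ← Set.ncard_eq_toFinset_card _ (hT.lt_fin z z P),
            ← hcdef, e]
        obtain ⟨t1, k1⟩ := nb_ex b hT hz hX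
        obtain ⟨t2, k2⟩ := nb_ex b hT hz k1.m2
        obtain ⟨t3, k3⟩ := nb_ex b hT hz k2.m2
        obtain ⟨t4, k4⟩ := nb_ex b hT hz k3.m2
        have hC := C5.mk' hT hz k1 k2 k3 k4 hcard
        have a1 := k1.chain5 hT hz k2 k3 k4 (by omega)
        have a2 := k1.chain4 hT hz k2 k3 (by omega)
        have a3 : t2 ≠ X := by rintro rfl; exact k1.no2 hT hz k2
        have n : ∀ Y ∈ Co T z, Y ≠ X → nc Y = 3 := by
          intro Y hY hne
          rcases hall Y hY with h | h
          · exact absurd h hne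
          · obtain ⟨_, g, rfl, _⟩ := (mS Y).1 h
            rw [nc_smul, n3]
        exact SS.of hT hF hz hC n6 (n _ k1.m2 k1.ne.symm) (n _ k2.m2 a3) (n _ k3.m2 a2.1) (n _ k4.m2 a1.1)
      · exfalso
        have hXe := Wz_lt (show Wz z X < 1 by rw [hWX]; norm_num)
        have hYe := Wz_lt (show Wz z Y < 1 by rw [hWY]; norm_num)
        have n : ∀ X, X ∈ Co T z → z ∈ extremePoints ℝ X → Wz z X = 1 / 3 → nc X = 3 := by
          intro X hX hXe hWX
          rw [Wz_ext hXe] at hWX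
          rcases wt_cases (hT.poly X hX.1) with ⟨n, w⟩ | ⟨n, w⟩ | ⟨n, w⟩ | ⟨n, w⟩ | w
          · exact n
          · rw [w] at hWX; norm_num at hWX
          · rw [w] at hWX; norm_num at hWX
          · rw [w] at hWX; norm_num at hWX
          · rw [hWX] at w; norm_num at w
        have hXt : Tr X := by
          by_contra hnt
          obtain ⟨U, hU, V, hV, a1, a2, a3, _, _, g1, g2⟩ := hT.nontr_three hz hX hXe (n X hX hXe hWX) hnt
          rcases hall U hU with e | e | e
          · exact a1 e
          · rcases hall V hV with e' | e' | e'
            · exact a2 e'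
            · exact a3 (e.trans e'.symm)
            · exact hnt (trback _ _ e' g2)
          · exact hnt (trback _ _ e g1)
        have hYt : Tr Y := by
          by_contra hnt
          obtain ⟨U, hU, V, hV, a1, a2, a3, _, _, g1, g2⟩ := hT.nontr_three hz hY hYe (n Y hY hYe hWY) hnt
          rcases hall U hU with e | e | e
          · rcases hall V hV with e' | e' | e'
            · exact a3 (e.trans e'.symm)
            · exact a2 e'
            · exact hnt (trback _ _ e' g2)
          · exact a1 e
          · exact hnt (trback _ _ e g1)
        apply hXS
        rw [mS]
        apply eq_all hT hz _ _ hN.m1 hX (by rw [n3, n X hX hXe hWX]) (Or.inl n3)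
        · intro Z hZ
          rcases hall Z hZ with rfl | rfl | h
          exacts [hXe, hYe, extS Z h]
        · intro Z hZ
          rcases hall Z hZ with rfl | rfl | h
          exacts [hXt, hYt, trS Z h]
    · exfalso
      rcases hT.leftover hz hsub (ρ := 1 / 3) (by rw [sumS, hw, e]; norm_num) (by norm_num) (by norm_num) with
        ⟨X, hX, hXS, hWX, hall⟩ | ⟨e, _⟩
      · have hXe := Wz_lt (show Wz z X < 1 by rw [hWX]; norm_num)
        have n : nc X = 3 := by
          rw [Wz_ext hXe] at hWX
          rcases wt_cases (hT.poly X hX.1) with ⟨n, w⟩ | ⟨n, w⟩ | ⟨n, w⟩ | ⟨n, w⟩ | w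
          · exact n
          · rw [w] at hWX; norm_num at hWX
          · rw [w] at hWX; norm_num at hWX
          · rw [w] at hWX; norm_num at hWX
          · rw [hWX] at w; norm_num at w
        have hXt : Tr X := by
          by_contra hnt
          obtain ⟨U, hU, a1, _, g1⟩ := hT.nontr_two hz hX hXe hnt
          rcases hall U hU with e | e
          · exact a1 e
          · exact hnt (trback _ _ e g1)
        apply hXS
        rw [mS]
        apply eq_all hT hz _ _ hN.m1 hX (by rw [n3, n]) (Or.inl n3)
        · intro Z hZ
          rcases hall Z hZ with rfl | h
          exacts [hXe, extS Z h]
        · intro Z hZ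
          rcases hall Z hZ with rfl | h
          exacts [hXt, trS Z h]
      · norm_num at e
  · exfalso
    rw [hw] at hsum hG
    have hc5 : c ≤ 3 := by
      by_contra! hlt
      have : (4 : ℝ) ≤ c := by exact_mod_cast hlt
      apply hG; linarith
    have e : c = 3 := by omega
    rcases hT.leftover hz hsub (ρ := 1 / 2) (by rw [sumS, hw, e]; norm_num) (by norm_num) (by norm_num) with
        ⟨X, hX, hXS, hWX, hall⟩ | ⟨e, _⟩
    · have hXe := Wz_lt (show Wz z X < 1 by rw [hWX]; norm_num)
      have n : nc X = 4 := by
        rw [Wz_ext hXe] at hWX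
        rcases wt_cases (hT.poly X hX.1) with ⟨n, w⟩ | ⟨n, w⟩ | ⟨n, w⟩ | ⟨n, w⟩ | w
        · rw [w] at hWX; norm_num at hWX
        · exact n
        · rw [w] at hWX; norm_num at hWX
        · rw [w] at hWX; norm_num at hWX
        · rw [hWX] at w; norm_num at w
      have hXt : Tr X := by
        by_contra hnt
        obtain ⟨U, hU, a1, _, g1⟩ := hT.nontr_two hz hX hXe hnt
        rcases hall U hU with e | e
        · exact a1 e
        · exact hnt (trback _ _ e g1)
      apply hXS
      rw [mS]
      apply eq_all hT hz _ _ hN.m1 hX (by rw [n4, n]) (Or.inr n4)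
      · intro Z hZ
        rcases hall Z hZ with rfl | h
        exacts [hXe, extS Z h]
      · intro Z hZ
        rcases hall Z hZ with rfl | h
        exacts [hXt, trS Z h]
    · norm_num at e
  · exfalso
    apply hG
    rw [hw]; linarith
  · exfalso
    apply hG
    rw [hw]; linarith
  · exfalso
    nlinarith


theorem caseB2a {b : Bool} (hT : Mono T) {z : ℂ} (hz : z ∈ Vx T) {P Q : Set ℂ} {ρ : Mo} (h : NR T z P Q ρ)
    (hN : Nb b T z P Q) (htr : Tr P) (htr' : Tr Q) (hQ : Q ∉ Lt T z P z) (hle : wt P ≤ wt Q) : SQ T := by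
  classical
  have hP := hT.poly P hN.m1.1
  have hQp := hT.poly Q hN.m2.1
  have hzP := h.ext hT hz hN.m1
  have hzQ := h.symm.ext hT hz hN.m2
  have hρP := lt_rot h.fx (self_lt hN.m1) h.m1
  have hρQ := lt_rot h.fx (self_lt hN.m2) h.m2
  have hPQ : P ∉ Lt T z Q z := fun hh => hQ (lt_symm hN.m2 hh)
  have e1 : ρ • P ≠ Q := by intro e; rw [e] at hρP; exact hQ hρP
  have e2 : ρ • Q ≠ P := by intro e; rw [e] at hρQ; exact hPQ hρQ
  have e3 := h.nf hT hz hN.m1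
  have e4 := h.symm.nf hT hz hN.m2
  have e5 : ρ • P ≠ ρ • Q := fun e => hN.ne (smul_left_cancel ρ e)
  have hN' := hN.smul ρ h.fx h.m1 h.m2
  have extP : z ∈ extremePoints ℝ (ρ • P) := Lt_ext hzP hρP
  have extQ : z ∈ extremePoints ℝ (ρ • Q) := Lt_ext hzQ hρQ
  set S : Finset (Set ℂ) := {P, Q, ρ • P, ρ • Q} with hS
  have mS : ∀ X, X ∈ S ↔ X = P ∨ X = Q ∨ X = ρ • P ∨ X = ρ • Q := by intro X; simp [hS]
  have n1 : P ∉ ({Q, ρ • P, ρ • Q} : Finset (Set ℂ)) := by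
    simp only [Finset.mem_insert, Finset.mem_singleton, not_or]
    exact ⟨hN.ne, e3.symm, e2.symm⟩
  have n2 : Q ∉ ({ρ • P, ρ • Q} : Finset (Set ℂ)) := by
    simp only [Finset.mem_insert, Finset.mem_singleton, not_or]
    exact ⟨e1.symm, e4.symm⟩
  have n3 : ρ • P ∉ ({ρ • Q} : Finset (Set ℂ)) := by simpa using e5
  have cS : S.card = 4 := by
    rw [hS, Finset.card_insert_of_notMem n1, Finset.card_insert_of_notMem n2, Finset.card_insert_of_notMem n3,
      Finset.card_singleton]
  have sS : ∑ X ∈ S, Wz z X = 2 * wt P + 2 * wt Q := by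
    rw [hS, Finset.sum_insert n1, Finset.sum_insert n2, Finset.sum_insert n3, Finset.sum_singleton, Wz_ext hzP, Wz_ext hzQ,
      Wz_ext extP, Wz_ext extQ, wt_smul, wt_smul]
    ring
  have hsub : ∀ X ∈ S, X ∈ Co T z := by
    intro X hX
    rcases (mS X).1 hX with rfl | rfl | rfl | rfl
    exacts [hN.m1, hN.m2, h.m1, h.m2]
  have extS : ∀ X ∈ S, z ∈ extremePoints ℝ X := by
    intro X hX
    rcases (mS X).1 hX with rfl | rfl | rfl | rfl
    exacts [hzP, hzQ, extP, extQ]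
  have hsum := hT.sum_sub hz hsub
  rw [sS] at hsum
  have full : ¬ (5 / 3 < ∑ X ∈ S, Wz z X) := by
    intro hlt
    have hf := hT.sum_full hz hsub hlt
    exact lemma_F hT hz h hN e1 e2 (fun X hX => (mS X).1 (hf X hX))
  rw [sS] at full
  have hwP := wt_ge hP
  rcases wt_cases hP with ⟨nP, wP⟩ | ⟨nP, wP⟩ | ⟨_, wP⟩ | ⟨_, wP⟩ | wP
  · rcases wt_cases hQp with ⟨nQ, wQ⟩ | ⟨nQ, wQ⟩ | ⟨_, wQ⟩ | ⟨_, wQ⟩ | wQ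
    · exfalso
      have hF : NF T := by
        rcases hT.leftover hz hsub (ρ := 2 / 3) (by rw [sS, wP, wQ]; norm_num) (by norm_num) (by norm_num) with
          ⟨X, hX, hXS, hWX, hall⟩ | ⟨_, X, hX, Y, hY, hne, hXS, hYS, hWX, hWY, hall⟩
        · apply nf_of hT hz
          intro Y hY
          rcases hall Y hY with rfl | hh
          · exact Wz_lt (by rw [hWX]; norm_num)
          · exact extS Y hh
        · apply nf_of hT hz
          intro Z hZ
          rcases hall Z hZ with rfl | rfl | hh
          · exact Wz_lt (by rw [hWX]; norm_num)
          · exact Wz_lt (by rw [hWY]; norm_num)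
          · exact extS Z hh
      exact hQ (eq_adj hT hF hz hN (by rw [nP, nQ]) (Or.inl nP) htr htr')
    · rcases hT.leftover hz hsub (ρ := 1 / 3) (by rw [sS, wP, wQ]; norm_num) (by norm_num) (by norm_num) with
        ⟨X, hX, hXS, hWX, hall⟩ | ⟨e, _⟩
      · have hXe := Wz_lt (show Wz z X < 1 by rw [hWX]; norm_num)
        have nX : nc X = 3 := by
          rw [Wz_ext hXe] at hWX
          rcases wt_cases (hT.poly X hX.1) with ⟨n, w⟩ | ⟨n, w⟩ | ⟨n, w⟩ | ⟨n, w⟩ | w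
          · exact n
          · rw [w] at hWX; norm_num at hWX
          · rw [w] at hWX; norm_num at hWX
          · rw [w] at hWX; norm_num at hWX
          · rw [hWX] at w; norm_num at w
        have hF : NF T := nf_of hT hz (fun Y hY => by
          rcases hall Y hY with rfl | hh
          · exact hXe
          · exact extS Y hh)
        have hcard : (Co T z).ncard = 5 := by
          have : Co T z = ((insert X S : Finset (Set ℂ)) : Set (Set ℂ)) := by
            ext Y
            simp only [Finset.coe_insert, mem_insert_iff, Finset.mem_coe]
            constructor
            · exact hall Y
            · rintro (rfl | hh)
              · exact hX
              · exact hsub Y hh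
          rw [this, Set.ncard_coe_finset, Finset.card_insert_of_notMem hXS, cS]
        have hXρ : X ≠ ρ • P := fun e => hXS ((mS X).2 (by tauto))
        have hall' : ∀ Y ∈ Co T z, Y = X ∨ Y = P ∨ Y = Q ∨ Y = ρ • P ∨ Y = ρ • Q := by
          intro Y hY
          rcases hall Y hY with hh | hh
          · exact Or.inl hh
          · exact Or.inr ((mS Y).1 hh)
        obtain ⟨c, k2⟩ := nb_ex b hT hz hN.m2
        rcases hall' c k2.m2 with rfl | rfl | rfl | rfl | rfl
        · obtain ⟨d, k3⟩ := nb_ex b hT hz hX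
          have ch := hN.chain4 hT hz k2 k3 (by omega)
          rcases hall' d k3.m2 with rfl | rfl | rfl | rfl | rfl
          · exact absurd rfl ch.2.2
          · exact absurd rfl ch.1
          · exact absurd rfl ch.2.1
          · have hC := (C5.mk' hT hz hN k2 k3 hN' hcard).rot.rot
            exact SQ.of hT hF hz hC nX (by rw [nc_smul, nP]) (by rw [nc_smul, nQ]) nP nQ
          · exact absurd (k3.left hT hN') hXρ
        · exact absurd k2 (hN.no2 hT hz)
        · exact absurd rfl k2.ne
        · obtain ⟨e, k4⟩ := nb_ex b hT hz h.m2
          have ch := hN.chain5 hT hz k2 hN' k4 (by omega)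
          rcases hall' e k4.m2 with rfl | rfl | rfl | rfl | rfl
          · have hC := (C5.mk' hT hz hN k2 hN' k4 hcard).rot.rot.rot.rot
            exact SQ.of hT hF hz hC nX nP nQ (by rw [nc_smul, nP]) (by rw [nc_smul, nQ])
          · exact absurd rfl ch.1
          · exact absurd rfl ch.2.1
          · exact absurd rfl ch.2.2.1
          · exact absurd rfl ch.2.2.2
        · exact absurd (k2.left hT hN').symm e1
      · norm_num at e
    all_goals
      exfalso
      apply full
      rw [wP]
      linarith
  all_goals
    exfalso
    apply full
    linarith

theorem caseB2 {b : Bool} (hT : Mono T) {z : ℂ} (hz : z ∈ Vx T) {P Q : Set ℂ} {ρ : Mo} (h : NR T z P Q ρ)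
    (hN : Nb b T z P Q) (htr : Tr P) (htr' : Tr Q) (hQ : Q ∉ Lt T z P z) : SQ T := by
  rcases le_total (wt P) (wt Q) with hle | hle
  · exact caseB2a hT hz h hN htr htr' hQ hle
  · exact caseB2a hT hz h.symm hN.not htr' htr (fun hh => hQ (lt_symm hN.m2 hh)) hle

theorem classify {b : Bool} (hT : Mono T) {z : ℂ} (hz : z ∈ Vx T) {P Q : Set ℂ} {ρ : Mo} (h : NR T z P Q ρ)
    (hN : Nb b T z P Q) : (SN1 T P ∧ Q ∉ Lt T z P z) ∨ (SN1 T Q ∧ P ∉ Lt T z Q z) ∨ SQ T ∨ SS T ∨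
      (S3 T P ∧ Q ∈ Lt T z P z) := by
  by_cases htr : Tr P
  · by_cases htr' : Tr Q
    · by_cases hQ : Q ∈ Lt T z P z
      · rcases caseB1 hT hz h hN htr hQ with hh | hh
        · tauto
        · tauto
      · have := caseB2 hT hz h hN htr htr' hQ
        tauto
    · have := caseA hT hz h.symm hN.not htr'
      tauto
  · have := caseA hT hz h hN htr
    tauto


theorem share_edge (hT : Mono T) {z x : ℂ} (hz : z ∈ Vx T) {P Q : Set ℂ} (hP : P ∈ Co T z) (hQ : Q ∈ Co T z)
    (hne : P ≠ Q) (hx : x ≠ z) (h1 : x ∈ P) (h2 : x ∈ Q) :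
    ∃ b, Nb b T z P Q ∧ (z ∈ extremePoints ℝ P → x ∈ extremePoints ℝ P → Lb b P z x) := by
  obtain ⟨r, l, h⟩ := hT.sec hz hP
  obtain ⟨r', l', h'⟩ := hT.sec hz hQ
  have hy0 : ‖x - z‖ ≠ 0 := by rw [norm_ne_zero_iff]; exact sub_ne_zero.2 hx
  have hpos : 0 < ‖x - z‖⁻¹ := by positivity
  have hn : ‖((‖x - z‖⁻¹ : ℝ) : ℂ) * (x - z)‖ = 1 := by
    rw [norm_mul, Complex.norm_real, Real.norm_of_nonneg hpos.le, inv_mul_cancel₀ hy0]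
  have hxe : x = z + ((‖x - z‖ : ℝ) : ℂ) * (((‖x - z‖⁻¹ : ℝ) : ℂ) * (x - z)) := by
    rw [← mul_assoc, ← Complex.ofReal_mul, mul_inv_cancel₀ hy0]
    simp
  have hp : 0 < ‖x - z‖ := by positivity
  rcases hT.adj_dir hP hQ hne h h' (Kc_real (Kc_sub h1) hpos) (Kc_real (Kc_sub h2) hpos) hn with ⟨e1, e2⟩ | ⟨e1, e2⟩
  · refine ⟨true, ?_, ?_⟩
    · rw [e1] at e2; subst e2
      exact ⟨hP, hQ, hne, _, _, _, h, h'⟩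
    · intro a1 a2
      rw [e1] at hxe
      exact ⟨r, l, _, h, hp, hxe, a1, a2⟩
  · refine ⟨false, ?_, ?_⟩
    · rw [e1] at e2; subst e2
      exact ⟨hP, hQ, hne, _, _, _, h, h'⟩
    · intro a1 a2
      rw [e1] at hxe
      exact ⟨l, r, _, h, hp, hxe, a1, a2⟩

/-- across the edge preceding a tile -/
theorem Nb.back {b : Bool} (hT : Mono T) (hF : NF T) {z w : ℂ} (hz : z ∈ Vx T) {S P : Set ℂ} (h : Nb b T z S P)
    (hL : Lb b P w z) : Lb b S z w ∧ Nb b T w P S := by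
  have hP := hT.poly P h.m2.1
  have := h.not.across_nf hT hF hz (hL.flip hP)
  exact ⟨this.1.flip' (hT.poly S h.m1.1), this.2.not'⟩

theorem Rig.tp {z y : ℂ} {g : Mo} (hg : g • z = y) (hC : g • Co T z = Co T y) {X Y : Set ℂ} (h : Rig T z X Y) :
    Rig T y (g • X) (g • Y) := by
  intro ρ h1 h2 h3
  have e := h (g⁻¹ * ρ * g) (by rw [mul_smul, mul_smul, hg, h1, ← hg, inv_smul_smul])
    (by rw [mul_smul, mul_smul]; rw [← hC] at h2; exact (Set.mem_smul_set_iff_inv_smul_mem).1 h2)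
    (by rw [mul_smul, mul_smul]; rw [← hC] at h3; exact (Set.mem_smul_set_iff_inv_smul_mem).1 h3)
  rw [mul_smul, mul_smul, hC, inv_smul_eq_iff, hC] at e
  exact e

theorem SN1.uq {P : Set ℂ} (h : SN1 T P) {y u v : ℂ} {X : Set ℂ} (h1 : X ∈ Lt T y P u) (h2 : X ∈ Lt T y P v) : u = v := by
  obtain ⟨σ, s1, s2⟩ := lt_disj h1 h2
  rw [h.rg σ s1, one_smul] at s2
  exact s2

theorem lt_same {y v : ℂ} {P X Y : Set ℂ} (h1 : X ∈ Lt T y P v) (h2 : Y ∈ Lt T y P v) : Y ∈ Lt T y X y := by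
  obtain ⟨_, g, e1, e2⟩ := h1
  obtain ⟨hY, f, e3, e4⟩ := h2
  refine ⟨hY, f * g⁻¹, ?_, ?_⟩
  · rw [← e1, mul_smul, inv_smul_smul, e3]
  · rw [← e2, mul_smul, inv_smul_smul, e4, e2]

theorem SN1.six {P : Set ℂ} (h : SN1 T P) (hT : Mono T) {b : Bool} {y : ℂ} (hy : y ∈ Vx T) {D1 D2 D3 : Set ℂ} {ρ : Mo}
    (k1 : Nb b T y D1 D2) (k2 : Nb b T y D2 D3) {a1 a2 a3 : ℂ} (hext : extremePoints ℝ P = {a1, a2, a3})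
    (n12 : a1 ≠ a2) (n13 : a1 ≠ a3) (n23 : a2 ≠ a3) (l1 : D1 ∈ Lt T y P a1) (l2 : D2 ∈ Lt T y P a2) (l3 : D3 ∈ Lt T y P a3)
    (hρ : ρ • y = y) (m1 : ρ • D1 ∈ Co T y) (m2 : ρ • D2 ∈ Co T y) (m3 : ρ • D3 ∈ Co T y) : ρ • Co T y = Co T y := by
  have r1 := lt_rot hρ l1 m1
  have r2 := lt_rot hρ l2 m2
  have r3 := lt_rot hρ l3 m3
  by_cases hone : ρ = 1
  · rw [hone, one_smul]
  have d1 : D1 ≠ ρ • D1 := fun e => hone (sec_fix hT hy l1.1 hρ e.symm)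
  have d2 : D2 ≠ ρ • D2 := fun e => hone (sec_fix hT hy l2.1 hρ e.symm)
  have d3 : D3 ≠ ρ • D3 := fun e => hone (sec_fix hT hy l3.1 hρ e.symm)
  have p1 := pair_of (h.two y hy a1 (by simp [hext])) l1 r1 d1
  have p2 := pair_of (h.two y hy a2 (by simp [hext])) l2 r2 d2
  have p3 := pair_of (h.two y hy a3 (by simp [hext])) l3 r3 d3
  have all : ∀ X ∈ Co T y, X ∈ Lt T y P a1 ∨ X ∈ Lt T y P a2 ∨ X ∈ Lt T y P a3 := by
    intro X hX
    obtain ⟨v, hv, hv'⟩ := h.all y hy X hX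
    rw [hext] at hv
    rcases hv with rfl | rfl | rfl <;> tauto
  have k1' := k1.smul ρ hρ m1 m2
  have k2' := k2.smul ρ hρ m2 m3
  have nx : ∀ D E, Nb b T y D E → D ∈ Lt T y P a3 → E ∈ Lt T y P a1 := by
    intro D E hDE hD
    rcases all E hDE.m2 with e | e | e
    · exact e
    · exfalso
      rcases p2 E e with rfl | rfl
      · rw [hDE.left hT k1] at hD; exact n13 (h.uq l1 hD)
      · rw [hDE.left hT k1'] at hD; exact n13 (h.uq r1 hD)
    · exfalso
      rcases p3 E e with rfl | rfl
      · rw [hDE.left hT k2] at hD; exact n23 (h.uq l2 hD)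
      · rw [hDE.left hT k2'] at hD; exact n23 (h.uq r2 hD)
  obtain ⟨E, q1⟩ := nb_ex b hT hy l3.1
  obtain ⟨E', q2⟩ := nb_ex b hT hy m3
  have hE := nx _ _ q1 l3
  have hE' := nx _ _ q2 r3
  have closed : ¬ Nb b T y D3 D1 := by
    intro q
    have := Nb.cyc (b := b) hT hy (A := {D1, D2, D3}) (by rintro X (rfl | rfl | rfl); exacts [k1.m1, k2.m1, k2.m2]) ⟨D1, by simp⟩ (by
      rintro X (rfl | rfl | rfl) Y hY
      · rw [← k1.right hT hY]; simp
      · rw [← k2.right hT hY]; simp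
      · rw [← q.right hT hY]; simp)
    have h1 : ρ • D1 ∈ ({D1, D2, D3} : Set (Set ℂ)) := by rw [this]; exact m1
    rcases h1 with e | e | e
    · exact d1 e.symm
    · rw [e] at r1; exact n12 (h.uq r1 l2)
    · rw [e] at r1; exact n13 (h.uq r1 l3)
  rcases p1 E hE with rfl | rfl
  · exact absurd q1 closed
  rcases p1 E' hE' with rfl | rfl
  · have e := nb_rot q1 q2 hρ rfl (lt_same r1 l1)
    have hr : ρ * ρ = 1 := sec_fix hT hy l1.1 (by rw [mul_smul, hρ, hρ]) (by rw [mul_smul]; exact e)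
    apply hT.co_of_sub
    intro X hX
    have key : ∀ D, D ∈ Co T y → ρ • D ∈ Co T y → (X = D ∨ X = ρ • D) → ρ • X ∈ Co T y := by
      rintro D hD hD' (rfl | rfl)
      · exact hD'
      · rw [← mul_smul, hr, one_smul]; exact hD
    rcases all X hX with e | e | e
    · exact key _ l1.1 m1 (p1 X e)
    · exact key _ l2.1 m2 (p2 X e)
    · exact key _ l3.1 m3 (p3 X e)
  · exact absurd (q1.left hT q2) d3

theorem caseN1 {b : Bool} (hT : Mono T) {z x : ℂ} (hz : z ∈ Vx T) {P Q : Set ℂ} {ρ g : Mo} (h : NR T z P Q ρ)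
    (hN : Nb b T z P Q) (hS : SN1 T P) (hQ : Q ∉ Lt T z P z) (hL : Lb b P z x) (hx : x ∈ Dg T g) : z ∈ Dg T g := by
  obtain ⟨w, L1, L2, nwz, nwx, hext⟩ := hL.tri hS.pg hS.n3
  have nzx : z ≠ x := hL.ne.symm
  obtain ⟨β, hβ, lQ⟩ := hS.all z hz Q hN.m2
  have βz : β ≠ z := by rintro rfl; exact hQ lQ
  have lP := self_lt hN.m1
  have rP := lt_rot h.fx lP h.m1
  have rQ := lt_rot h.fx lQ h.m2
  have hN' := hN.smul ρ h.fx h.m1 h.m2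
  have pP := pair_of (hS.two z hz z hL.e1) lP rP (h.nf hT hz hN.m1).symm
  have pQ := pair_of (hS.two z hz β hβ) lQ rQ (h.symm.nf hT hz hN.m2).symm
  have AB1 : ∀ y ∈ Vx T, ∀ X Y, Nb b T y X Y → X ∈ Lt T y P z → Y ∈ Lt T y P β := by
    intro y hy X Y hXY hX
    obtain ⟨f, hf, hC⟩ := hT.mono z hz y hy
    rw [lt_smul hf hC] at hX ⊢
    obtain ⟨X, hX, rfl⟩ := hX
    rcases pP X hX with rfl | rfl
    · rw [← (hN.tp hf hC).right hT hXY]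
      exact Set.smul_mem_smul_set lQ
    · rw [← (hN'.tp hf hC).right hT hXY]
      exact Set.smul_mem_smul_set rQ
  have AB2 : ∀ y ∈ Vx T, ∀ X Y, Nb b T y X Y → Y ∈ Lt T y P β → X ∈ Lt T y P z := by
    intro y hy X Y hXY hY
    obtain ⟨f, hf, hC⟩ := hT.mono z hz y hy
    rw [lt_smul hf hC] at hY ⊢
    obtain ⟨Y, hY, rfl⟩ := hY
    rcases pQ Y hY with rfl | rfl
    · rw [← (hN.tp hf hC).left hT hXY]
      exact Set.smul_mem_smul_set lP
    · rw [← (hN'.tp hf hC).left hT hXY]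
      exact Set.smul_mem_smul_set rP
  obtain ⟨γ, γz, γβ, hext'⟩ : ∃ γ, γ ≠ z ∧ γ ≠ β ∧ extremePoints ℝ P = {z, β, γ} := by
    rw [hext] at hβ
    rcases hβ with e | e | e
    · exact absurd e βz
    · exact ⟨w, nwz, by rw [e]; exact nwx, by rw [e]; exact hext⟩
    · rw [mem_singleton_iff] at e
      exact ⟨x, nzx.symm, by rw [e]; exact nwx.symm, by rw [hext, e]; ext; simp; tauto⟩
  have hγ : γ ∈ extremePoints ℝ P := by rw [hext']; simp
  have key : ∀ y ∈ Vx T, ∀ X Y, Nb b T y X Y → ¬ (X ∈ Lt T y P z ∧ Y ∈ Lt T y P β) → Rig T y X Y := by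
    intro y hy X Y hXY hnot
    by_contra hnr
    obtain ⟨τ, hτ⟩ := not_rig hnr
    have hXz : X ∉ Lt T y P z := fun hX => hnot ⟨hX, AB1 y hy X Y hXY hX⟩
    have hYβ : Y ∉ Lt T y P β := fun hY => hnot ⟨AB2 y hy X Y hXY hY, hY⟩
    have hXY' := hXY.smul τ hτ.fx hτ.m1 hτ.m2
    obtain ⟨p, hp, lX⟩ := hS.all y hy X hXY.m1
    obtain ⟨q, hq, lY⟩ := hS.all y hy Y hXY.m2
    have rX := lt_rot hτ.fx lX hτ.m1
    have rY := lt_rot hτ.fx lY hτ.m2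
    have pX := pair_of (hS.two y hy p hp) lX rX (hτ.nf hT hy hXY.m1).symm
    have pY := pair_of (hS.two y hy q hq) lY rY (hτ.symm.nf hT hy hXY.m2).symm
    rw [hext'] at hp hq
    rcases hp with rfl | rfl | rfl
    · exact hXz lX
    · -- X has letter β
      rcases hq with rfl | rfl | rfl
      · have := Nb.cyc (b := b) hT hy (A := Lt T y P q ∪ Lt T y P p) (union_subset Lt_sub Lt_sub) ⟨Y, Or.inl lY⟩ (by
          rintro D (hD | hD) E hDE
          · exact Or.inr (AB1 y hy D E hDE hD)
          · rcases pX D hD with rfl | rfl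
            · rw [← hXY.right hT hDE]; exact Or.inl lY
            · rw [← hXY'.right hT hDE]; exact Or.inl rY)
        have hne : (Lt T y P γ).Nonempty := Set.nonempty_of_ncard_ne_zero (by rw [hS.two y hy γ hγ]; norm_num)
        obtain ⟨Z, hZ⟩ := hne
        have hZ' := Lt_sub hZ
        rw [← this] at hZ'
        rcases hZ' with hh | hh
        · exact γz (hS.uq hZ hh)
        · exact γβ (hS.uq hZ hh)
      · exact hYβ lY
      · obtain ⟨W, hW⟩ := nb_ex' b hT hy hXY.m1
        obtain ⟨W', hW'⟩ := nb_ex' b hT hy hτ.m1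
        have lW := AB2 y hy _ _ hW lX
        have lW' := AB2 y hy _ _ hW' rX
        have e := nb_rot hW.not hW'.not hτ.fx rfl (lt_same lW lW')
        exact hτ.ne (hS.six hT hy hW hXY hext' βz.symm γz.symm γβ.symm lW lX lY hτ.fx (by rw [e]; exact lW'.1) hτ.m1 hτ.m2)
    · rcases hq with rfl | rfl | rfl
      · obtain ⟨V, hV⟩ := nb_ex b hT hy hXY.m2
        obtain ⟨V', hV'⟩ := nb_ex b hT hy hτ.m2
        have lV := AB1 y hy _ _ hV lY
        have lV' := AB1 y hy _ _ hV' rY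
        have e := nb_rot hV hV' hτ.fx rfl (lt_same lV lV')
        exact hτ.ne (hS.six hT hy hXY hV (a1 := p) (a2 := q) (a3 := β) (by rw [hext']; ext; simp; tauto) γz γβ βz.symm lX lY lV hτ.fx
          hτ.m1 hτ.m2 (by rw [e]; exact lV'.1))
      · exact hYβ lY
      · rcases pX Y lY with e | e
        · exact hXY.ne e.symm
        · rcases pX _ rY with e' | e'
          · rw [e', ← e] at hXY'
            exact hXY.no2 hT hy hXY'
          · rw [← e'] at hXY'
            exact hXY'.ne rfl
  have hxV := hx.1
  have hF := hS.nf
  obtain ⟨LQ, NxQP⟩ := hN.across_nf hT hF hz hL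
  have hPx : P ∈ Co T x := NxQP.m2
  obtain ⟨R, NxPR⟩ := nb_ex b hT hxV hPx
  obtain ⟨LR, NwRP⟩ := NxPR.across_nf hT hF hxV L1
  have hwV : w ∈ Vx T := ⟨P, hN.m1.1, L2.e1⟩
  have hwD : w ∈ Dg T g := by
    apply hT.step hx NxPR.m2 hPx NxPR.ne.symm hwV NwRP.m1.2 NwRP.m2.2
    apply key w hwV _ _ NwRP
    rintro ⟨lR, lPw⟩
    have e : w = β := hS.uq (self_lt NwRP.m2) lPw
    have cR : R ∈ Lt T x P x := by
      obtain ⟨_, f, e1, e2⟩ := lR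
      have := hL.smul f
      rw [e1, e2] at this
      exact ⟨NxPR.m2, f, e1, this.right LR⟩
    have cQ : Q ∈ Lt T x P x := by
      obtain ⟨_, f, e1, e2⟩ := lQ
      have := L1.smul f
      rw [e1, e, e2] at this
      exact ⟨NxQP.m1, f, e1, this.left (hT.poly Q hN.m2.1) LQ⟩
    have := pair_of (hS.two x hxV x hL.e2) (self_lt hPx) cQ NxQP.ne.symm R cR
    rcases this with e | e
    · exact NxPR.ne e.symm
    · rw [e] at NxPR
      exact NxQP.no2 hT hxV NxPR
  obtain ⟨S, NzSP⟩ := nb_ex' b hT hz hN.m1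
  obtain ⟨LS, NwPS⟩ := NzSP.back hT hF hz L2
  apply hT.step hwD NwPS.m2 NwPS.m1 NwPS.ne.symm hz NzSP.m1.2 NzSP.m2.2
  apply key z hz _ _ NzSP
  rintro ⟨_, h2⟩
  exact βz (hS.uq h2 lP)


/-- the two triangle-triangle facts -/
theorem SQ.tt (h : SQ T) (hT : Mono T) {b : Bool} {y : ℂ} (hy : y ∈ Vx T) {X Y : Set ℂ} (hN : Nb b T y X Y)
    (h1 : nc X = 3) (h2 : nc Y = 3) : (∀ V, Nb b T y V X → nc V = 4) ∧ (∀ W, Nb b T y Y W → nc W = 4) := by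
  obtain ⟨t1, t2, s1, t3, s2, C, n1, n2, n3, n4, n5⟩ := h.ex b y hy
  rcases C.all X hN.m1 with rfl | rfl | rfl | rfl | rfl
  · obtain rfl := hN.right hT C.h1
    exact ⟨fun V hV => by rw [hV.left hT C.h5, n5], fun W hW => by rw [hW.right hT C.h2, n3]⟩
  · obtain rfl := hN.right hT C.h2
    omega
  · omega
  · obtain rfl := hN.right hT C.h4
    omega
  · omega

theorem SQ.tt_uq (h : SQ T) (hT : Mono T) {b : Bool} {y : ℂ} (hy : y ∈ Vx T) {X Y X' Y' : Set ℂ} (hN : Nb b T y X Y)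
    (h1 : nc X = 3) (h2 : nc Y = 3) (hN' : Nb b T y X' Y') (h1' : nc X' = 3) (h2' : nc Y' = 3) : X = X' := by
  obtain ⟨t1, t2, s1, t3, s2, C, n1, n2, n3, n4, n5⟩ := h.ex b y hy
  have key : ∀ X Y, Nb b T y X Y → nc X = 3 → nc Y = 3 → X = t1 := by
    intro X Y hN h1 h2
    rcases C.all X hN.m1 with rfl | rfl | rfl | rfl | rfl
    · rfl
    · obtain rfl := hN.right hT C.h2
      omega
    · omega
    · obtain rfl := hN.right hT C.h4
      omega
    · omega
  rw [key _ _ hN h1 h2, key _ _ hN' h1' h2']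

theorem SQ.sts_uq (h : SQ T) (hT : Mono T) {b : Bool} {y : ℂ} (hy : y ∈ Vx T) {A X B A' X' B' : Set ℂ} (h1 : Nb b T y A X)
    (h2 : Nb b T y X B) (nA : nc A = 4) (nX : nc X = 3) (nB : nc B = 4) (h1' : Nb b T y A' X')
    (h2' : Nb b T y X' B') (nA' : nc A' = 4) (nX' : nc X' = 3) (nB' : nc B' = 4) : X = X' := by
  obtain ⟨t1, t2, s1, t3, s2, C, n1, n2, n3, n4, n5⟩ := h.ex b y hy
  have key : ∀ A X B, Nb b T y A X → Nb b T y X B → nc A = 4 → nc X = 3 → nc B = 4 → X = t3 := by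
    intro A X B h1 h2 nA nX nB
    rcases C.all X h2.m1 with rfl | rfl | rfl | rfl | rfl
    · obtain rfl := h2.right hT C.h1
      omega
    · obtain rfl := h1.left hT C.h1
      omega
    · omega
    · rfl
    · omega
  rw [key _ _ _ h1 h2 nA nX nB, key _ _ _ h1' h2' nA' nX' nB']

theorem SQ.sts_prev (h : SQ T) (hT : Mono T) {b : Bool} {y : ℂ} (hy : y ∈ Vx T) {A X B W V : Set ℂ} (h1 : Nb b T y A X)
    (h2 : Nb b T y X B) (nA : nc A = 4) (nX : nc X = 3) (nB : nc B = 4) (h3 : Nb b T y W A) (h4 : Nb b T y V W) :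
    nc W = 3 ∧ nc V = 3 := by
  obtain ⟨t1, t2, s1, t3, s2, C, n1, n2, n3, n4, n5⟩ := h.ex b y hy
  rcases C.all X h2.m1 with rfl | rfl | rfl | rfl | rfl
  · obtain rfl := h2.right hT C.h1
    omega
  · obtain rfl := h1.left hT C.h1
    omega
  · omega
  · obtain rfl := h1.left hT C.h3
    obtain rfl := h3.left hT C.h2
    obtain rfl := h4.left hT C.h1
    exact ⟨n2, n1⟩
  · omega

theorem SQ.n34 (h : SQ T) {y : ℂ} (hy : y ∈ Vx T) {X : Set ℂ} (hX : X ∈ Co T y) : nc X = 3 ∨ nc X = 4 := by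
  obtain ⟨t1, t2, s1, t3, s2, C, n1, n2, n3, n4, n5⟩ := h.ex true y hy
  rcases C.all X hX with rfl | rfl | rfl | rfl | rfl <;> tauto

theorem SQ.no_ss (h : SQ T) (hT : Mono T) {b : Bool} {y : ℂ} (hy : y ∈ Vx T) {X Y : Set ℂ} (hN : Nb b T y X Y)
    (h1 : nc X = 4) : nc Y = 3 := by
  obtain ⟨t1, t2, s1, t3, s2, C, n1, n2, n3, n4, n5⟩ := h.ex b y hy
  rcases C.all X hN.m1 with rfl | rfl | rfl | rfl | rfl
  · omega
  · omega
  · rw [hN.right hT C.h3, n4]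
  · omega
  · rw [hN.right hT C.h5, n1]

theorem SQ.rig_tt (h : SQ T) (hT : Mono T) {b : Bool} {y : ℂ} (hy : y ∈ Vx T) {X Y : Set ℂ} (hN : Nb b T y X Y)
    (h1 : nc X = 3) (h2 : nc Y = 3) : Rig T y X Y := by
  intro ρ hρ m1 m2
  have := h.tt_uq hT hy (hN.smul ρ hρ m1 m2) (by rw [nc_smul, h1]) (by rw [nc_smul, h2]) hN h1 h2
  rw [sec_fix hT hy hN.m1 hρ this, one_smul]

theorem SQ.TT (h : SQ T) (hT : Mono T) {b : Bool} {z x : ℂ} (hz : z ∈ Vx T) {P Q R : Set ℂ} {g : Mo} (hN : Nb b T z P Q)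
    (nP : nc P = 3) (nQ : nc Q = 4) (hL : Lb b P z x) (hx : x ∈ Dg T g) (hR : Nb b T x P R) (nR : nc R = 3) :
    z ∈ Dg T g := by
  have hF := h.nf
  have hP := hT.poly P hN.m1.1
  obtain ⟨w, L1, L2, nwz, nwx, hext⟩ := hL.tri hP nP
  obtain ⟨LQ, NxQP⟩ := hN.across_nf hT hF hz hL
  obtain ⟨LR, NwRP⟩ := hR.across_nf hT hF hx.1 L1
  have hwV : w ∈ Vx T := ⟨P, hN.m1.1, L2.e1⟩
  have hwD : w ∈ Dg T g :=
    hT.step hx hR.m2 hR.m1 hR.ne.symm hwV NwRP.m1.2 NwRP.m2.2 (h.rig_tt hT hwV NwRP nR nP)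
  obtain ⟨S, NzSP⟩ := nb_ex' b hT hz hN.m1
  obtain ⟨LS, NwPS⟩ := NzSP.back hT hF hz L2
  have nS := (h.tt hT hwV NwRP nR nP).2 S NwPS
  apply hT.prop hz (K := {S, P, Q})
  · rintro X (rfl | rfl | rfl)
    exacts [NzSP.m1, hN.m1, hN.m2]
  · rintro X (rfl | rfl | rfl)
    exacts [Dg_known hwD NwPS.m2, Dg_known hx NxQP.m2, Dg_known hx NxQP.m1]
  · exact ⟨P, by simp, hL.e1⟩
  · intro ρ hρ hK
    have m1 := hK S (by simp)
    have m2 := hK P (by simp)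
    have m3 := hK Q (by simp)
    have := h.sts_uq hT hz (NzSP.smul ρ hρ m1 m2) (hN.smul ρ hρ m2 m3) (by rw [nc_smul, nS]) (by rw [nc_smul, nP])
      (by rw [nc_smul, nQ]) NzSP hN nS nP nQ
    rw [sec_fix hT hz hN.m1 hρ this, one_smul]

theorem SQ.TTs (h : SQ T) (hT : Mono T) {b : Bool} {u v : ℂ} {Q A B : Set ℂ} {g : Mo} (hv : v ∈ Dg T g) (h1 : Nb b T v Q A)
    (h2 : Nb b T v A B) (nQ : nc Q = 4) (nA : nc A = 3) (nB : nc B = 4) (hL : Lb b Q u v) :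
    u ∈ Dg T g ∧ ∃ A' B', Nb b T u Q A' ∧ Nb b T u A' B' ∧ nc A' = 3 ∧ nc B' = 4 := by
  have hF := h.nf
  obtain ⟨W, NvW⟩ := nb_ex' b hT hv.1 h1.m1
  obtain ⟨V, NvV⟩ := nb_ex' b hT hv.1 NvW.m1
  obtain ⟨nW, nV⟩ := h.sts_prev hT hv.1 h1 h2 nQ nA nB NvW NvV
  obtain ⟨LW, NuQW⟩ := NvW.back hT hF hv.1 hL
  have hW := hT.poly W NvW.m1.1
  have huV : u ∈ Vx T := ⟨Q, h1.m1.1, hL.e1⟩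
  refine ⟨h.TT hT huV NuQW.not nW nQ (LW.flip hW) hv NvV.not nV, W, ?_⟩
  obtain ⟨B', hB'⟩ := nb_ex b hT huV NuQW.m2
  refine ⟨B', NuQW, hB', nW, ?_⟩
  obtain ⟨m, L1, L2, _, _, hext⟩ := LW.tri hW nW
  obtain ⟨_, NmB⟩ := hB'.across_nf hT hF huV L1
  obtain ⟨_, NmV⟩ := NvV.back hT hF hv.1 L2
  have hmV : m ∈ Vx T := ⟨W, NvW.m1.1, L2.e1⟩
  exact (h.tt hT hmV NmV nW nV).1 B' NmB

theorem caseSQ1 {b : Bool} (hT : Mono T) {z x : ℂ} (hz : z ∈ Vx T) {P Q : Set ℂ} {g : Mo}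
    (hN : Nb b T z P Q) (h : SQ T) (nP : nc P = 3) (nQ : nc Q = 4) (hL : Lb b P z x) (hx : x ∈ Dg T g) : z ∈ Dg T g := by
  have hF := h.nf
  obtain ⟨LQ, NxQP⟩ := hN.across_nf hT hF hz hL
  obtain ⟨R, hR⟩ := nb_ex b hT hx.1 NxQP.m2
  rcases h.n34 hx.1 hR.m2 with nR | nR
  · exact h.TT hT hz hN nP nQ hL hx hR nR
  · obtain ⟨q2, q3, L1, L2, L3, _⟩ := LQ.quad (hT.poly Q hN.m2.1) nQ
    obtain ⟨d3, A3, B3, a1, a2, a3, a4⟩ := h.TTs hT hx NxQP hR nQ nP nR L3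
    obtain ⟨d2, A2, B2, b1, b2, b3, b4⟩ := h.TTs hT d3 a1 a2 nQ a3 a4 L2
    exact (h.TTs hT d2 b1 b2 nQ b3 b4 L1).1

theorem caseSQ {b : Bool} (hT : Mono T) {z x : ℂ} (hz : z ∈ Vx T) {P Q : Set ℂ} {g : Mo}
    (hN : Nb b T z P Q) (h : SQ T) (hnr : ¬ Rig T z P Q) (hL : Lb b P z x) (hx : x ∈ Dg T g) : z ∈ Dg T g := by
  rcases h.n34 hz hN.m1 with nP | nP
  · rcases h.n34 hz hN.m2 with nQ | nQ
    · exact absurd (h.rig_tt hT hz hN nP nQ) hnr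
    · exact caseSQ1 hT hz hN h nP nQ hL hx
  · have nQ := h.no_ss hT hz hN nP
    obtain ⟨LQ, NxQP⟩ := hN.across_nf hT h.nf hz hL
    exact caseSQ1 hT hz hN.not h nQ nP (LQ.flip (hT.poly Q hN.m2.1)) hx


theorem share_dir (hT : Mono T) {z x : ℂ} (hz : z ∈ Vx T) {P Q : Set ℂ} (hP : P ∈ Co T z) (hQ : Q ∈ Co T z)
    (hne : P ≠ Q) (hx : x ≠ z) (h1 : x ∈ P) (h2 : x ∈ Q) :
    ∃ b, Nb b T z P Q ∧ ∃ (r l : ℂ) (t : ℝ), Sb b P z r l ∧ 0 < t ∧ x = z + t * l := by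
  obtain ⟨r, l, h⟩ := hT.sec hz hP
  obtain ⟨r', l', h'⟩ := hT.sec hz hQ
  have hy0 : ‖x - z‖ ≠ 0 := by rw [norm_ne_zero_iff]; exact sub_ne_zero.2 hx
  have hpos : 0 < ‖x - z‖⁻¹ := by positivity
  have hn : ‖((‖x - z‖⁻¹ : ℝ) : ℂ) * (x - z)‖ = 1 := by
    rw [norm_mul, Complex.norm_real, Real.norm_of_nonneg hpos.le, inv_mul_cancel₀ hy0]
  have hxe : x = z + ((‖x - z‖ : ℝ) : ℂ) * (((‖x - z‖⁻¹ : ℝ) : ℂ) * (x - z)) := by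
    rw [← mul_assoc, ← Complex.ofReal_mul, mul_inv_cancel₀ hy0]
    simp
  have hp : 0 < ‖x - z‖ := by positivity
  rcases hT.adj_dir hP hQ hne h h' (Kc_real (Kc_sub h1) hpos) (Kc_real (Kc_sub h2) hpos) hn with ⟨e1, e2⟩ | ⟨e1, e2⟩
  · refine ⟨true, ?_, ?_⟩
    · rw [e1] at e2; subst e2
      exact ⟨hP, hQ, hne, _, _, _, h, h'⟩
    · rw [e1] at hxe
      exact ⟨r, l, _, h, hp, hxe⟩
  · refine ⟨false, ?_, ?_⟩
    · rw [e1] at e2; subst e2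
      exact ⟨hP, hQ, hne, _, _, _, h, h'⟩
    · rw [e1] at hxe
      exact ⟨l, r, _, h, hp, hxe⟩

theorem Sd.smul {X : Set ℂ} {s : ℝ} (h : Sd X s) (g : Mo) : Sd (g • X) s := by
  intro b u v hL
  have := hL.smul g⁻¹
  rw [inv_smul_smul] at this
  have := h b _ _ this
  rwa [Mo.smul_sub', norm_mul, Mo.norm_a, one_mul] at this

/-- a copy of the triangle with a corner here -/
def Ax (Δ : Set ℂ) (y : ℂ) (X : Set ℂ) : Prop := y ∈ extremePoints ℝ X ∧ ∃ g : Mo, g • Δ = X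

theorem Ax.rot {Δ : Set ℂ} {y : ℂ} {X : Set ℂ} (h : Ax Δ y X) {ρ : Mo} (hρ : ρ • y = y) : Ax Δ y (ρ • X) := by
  obtain ⟨h1, g, rfl⟩ := h
  refine ⟨?_, ρ * g, mul_smul _ _ _⟩
  have := (ext_smul_iff ρ _ _).2 h1
  rwa [hρ] at this

theorem Ax.rot' {Δ : Set ℂ} {y : ℂ} {X : Set ℂ} {ρ : Mo} (hρ : ρ • y = y) (h : Ax Δ y (ρ • X)) : Ax Δ y X := by
  have := h.rot (ρ := ρ⁻¹) (by rw [inv_smul_eq_iff, hρ])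
  rwa [inv_smul_smul] at this

theorem Ax.mv {Δ : Set ℂ} {y w : ℂ} {X : Set ℂ} (h : Ax Δ y X) (hw : w ∈ extremePoints ℝ X) : Ax Δ w X := ⟨hw, h.2⟩

theorem Sb.lb {b : Bool} {P : Set ℂ} {z r l : ℂ} (h : Sb b P z r l) (hz : z ∈ extremePoints ℝ P) :
    ∃ t : ℝ, 0 < t ∧ Lb b P z (z + t * l) := by
  obtain ⟨t, ht, h1⟩ := h.el
  exact ⟨t, ht, r, l, t, h, ht, rfl, hz, h1⟩

theorem AA {b : Bool} (hT : Mono T) {Δ : Set ℂ} (hS : S3 T Δ) {y v : ℂ} {P X : Set ℂ} (hN : Nb b T y P X)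
    (hP : Ax Δ y P) (hX : Ax Δ y X) (hL : Lb b P y v) : Lb b X v y ∧ Nb b T v X P := by
  obtain ⟨s, hs⟩ := hS.tr.sd hS.pg
  have sP : Sd P s := by obtain ⟨_, g, rfl⟩ := hP; exact hs.smul g
  have sX : Sd X s := by obtain ⟨_, g, rfl⟩ := hX; exact hs.smul g
  refine hN.across hT hX.1 hL ?_
  obtain ⟨_, _, _, r, l, l', e1, e2⟩ := hN
  obtain ⟨t, ht, h1⟩ := e2.not.lb hX.1
  obtain ⟨r1, l1, t1, e3, ht1, rfl, _, hv⟩ := id hL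
  obtain ⟨-, rfl⟩ := e1.unique e3
  have a1 := sP _ _ _ hL
  have a2 := sX _ _ _ h1
  rw [add_sub_cancel_left, norm_mul, e1.nl, mul_one, Complex.norm_real, Real.norm_of_nonneg ht1.le] at a1
  rw [add_sub_cancel_left, norm_mul, e1.nl, mul_one, Complex.norm_real, Real.norm_of_nonneg ht.le] at a2
  rw [a1, ← a2]
  exact h1.e2

theorem AA' {b : Bool} (hT : Mono T) {Δ : Set ℂ} (hS : S3 T Δ) {y v : ℂ} {P X : Set ℂ} (hN : Nb b T y X P)
    (hP : Ax Δ y P) (hX : Ax Δ y X) (hL : Lb b P v y) : Lb b X y v ∧ Nb b T v P X := by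
  have := AA hT hS hN.not hP hX (hL.flip (hT.poly P hN.m2.1))
  exact ⟨this.1.flip' (hT.poly X hN.m1.1), this.2.not'⟩

theorem T3.ax {b : Bool} {Δ : Set ℂ} {y : ℂ} {t1 t2 t3 : Set ℂ} (h : T3 b T Δ y t1 t2 t3) :
    Ax Δ y t1 ∧ Ax Δ y t2 ∧ Ax Δ y t3 :=
  ⟨(h.iff t1 h.h1.m1).2 (by tauto), (h.iff t2 h.h1.m2).2 (by tauto), (h.iff t3 h.h2.m2).2 (by tauto)⟩

theorem T3.nx {b : Bool} (hT : Mono T) {Δ : Set ℂ} {y : ℂ} (hy : y ∈ Vx T) {t1 t2 t3 : Set ℂ} (h : T3 b T Δ y t1 t2 t3) {X : Set ℂ}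
    (hX : Nb b T y t3 X) : ¬ Ax Δ y X := by
  intro hA
  rcases (h.iff X hX.m2).1 hA with rfl | rfl | rfl
  · exact h.no hX
  · exact h.h2.no2 hT hy hX
  · exact hX.ne rfl

theorem T3.first {b : Bool} (hT : Mono T) {Δ : Set ℂ} {y : ℂ} {t1 t2 t3 : Set ℂ} (h : T3 b T Δ y t1 t2 t3) {S X : Set ℂ}
    (hN : Nb b T y S X) (hX : Ax Δ y X) (hS : ¬ Ax Δ y S) : X = t1 := by
  rcases (h.iff X hN.m2).1 hX with rfl | rfl | rfl
  · rfl
  · rw [hN.left hT h.h1] at hS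
    exact absurd h.ax.1 hS
  · rw [hN.left hT h.h2] at hS
    exact absurd h.ax.2.1 hS

theorem T3.mid {b : Bool} (hT : Mono T) {Δ : Set ℂ} {y : ℂ} (hy : y ∈ Vx T) {t1 t2 t3 : Set ℂ} (h : T3 b T Δ y t1 t2 t3) {X Y Z : Set ℂ}
    (h1 : Nb b T y X Y) (h2 : Nb b T y Y Z) (hX : Ax Δ y X) (hY : Ax Δ y Y) (hZ : Ax Δ y Z) : Y = t2 ∧ Z = t3 := by
  rcases (h.iff X h1.m1).1 hX with rfl | rfl | rfl
  · obtain rfl := h1.right hT h.h1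
    exact ⟨rfl, h2.right hT h.h2⟩
  · obtain rfl := h1.right hT h.h2
    exact absurd hZ (h.nx hT hy h2)
  · exact absurd hY (h.nx hT hy h1)

theorem S3.rig {b : Bool} (hT : Mono T) {Δ : Set ℂ} (hS : S3 T Δ) {y : ℂ} (hy : y ∈ Vx T) {S X : Set ℂ}
    (hN : Nb b T y S X) (hX : Ax Δ y X) (hn : ¬ Ax Δ y S) : Rig T y S X := by
  obtain ⟨t1, t2, t3, h⟩ := hS.ex b y hy
  intro ρ hρ m1 m2
  have e1 := h.first hT hN hX hn
  have e2 := h.first hT (hN.smul ρ hρ m1 m2) (hX.rot hρ) (fun h => hn (Ax.rot' hρ h))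
  rw [← e1] at e2
  rw [sec_fix hT hy hN.m2 hρ e2, one_smul]

theorem rig_flat (hT : Mono T) {y : ℂ} (hy : y ∈ Vx T) {S X : Set ℂ} (hS : S ∈ Co T y)
    (hf : y ∉ extremePoints ℝ S) : Rig T y S X := by
  by_contra hnr
  obtain ⟨ρ, hρ⟩ := not_rig hnr
  exact hf (hρ.ext hT hy hS)

theorem S3.prevflat {b : Bool} (hT : Mono T) {Δ : Set ℂ} (hS : S3 T Δ) {v : ℂ} (hv : v ∈ Vx T) {P : Set ℂ}
    (hP : P ∈ Co T v) (hf : v ∉ extremePoints ℝ P) {F : Set ℂ} (hN : Nb b T v F P) : Ax Δ v F := by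
  classical
  obtain ⟨t1, t2, t3, h⟩ := hS.ex b v hv
  obtain ⟨a1, a2, a3⟩ := h.ax
  have w : ∀ X, Ax Δ v X → Wz v X = 1 / 3 := by
    rintro X ⟨h1, g, rfl⟩
    rw [Wz_ext h1, wt_smul]
    rcases wt_cases hS.pg with ⟨_, e⟩ | ⟨n, _⟩ | ⟨n, _⟩ | ⟨n, _⟩ | e
    · exact e
    · rw [hS.n3] at n; norm_num at n
    · rw [hS.n3] at n; norm_num at n
    · rw [hS.n3] at n; norm_num at n
    · have : wt Δ = 1 / 3 := by unfold wt; rw [hS.n3]; norm_num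
      exact this
  have n13 : t1 ≠ t3 := by rintro rfl; exact h.h1.no2 hT hv h.h2
  have hPn : ∀ X, Ax Δ v X → P ≠ X := by rintro X hX rfl; exact hf hX.1
  have hfull := hT.sum_full hv (S := {P, t1, t2, t3}) (by
      intro X hX
      simp only [Finset.mem_insert, Finset.mem_singleton] at hX
      rcases hX with rfl | rfl | rfl | rfl
      exacts [hP, h.h1.m1, h.h1.m2, h.h2.m2]) (by
      rw [Finset.sum_insert, Finset.sum_insert, Finset.sum_insert, Finset.sum_singleton, w _ a1, w _ a2, w _ a3]
      · have : Wz v P = 1 := by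
          unfold Wz
          rw [if_neg hf]
        rw [this]; norm_num
      · simpa using h.h2.ne
      · simp only [Finset.mem_insert, Finset.mem_singleton, not_or]
        exact ⟨h.h1.ne, n13⟩
      · simp only [Finset.mem_insert, Finset.mem_singleton, not_or]
        exact ⟨hPn _ a1, hPn _ a2, hPn _ a3⟩)
  have := hfull F hN.m1
  simp only [Finset.mem_insert, Finset.mem_singleton] at this
  rcases this with rfl | e | e | e
  · exact absurd rfl hN.ne
  all_goals rw [e]; assumption

theorem S3.FE {b : Bool} (hT : Mono T) {Δ : Set ℂ} (hS : S3 T Δ) {z w : ℂ} (hz : z ∈ Vx T) {P S : Set ℂ} {g : Mo}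
    (hN : Nb b T z S P) (hP : Ax Δ z P) (hn : ¬ Ax Δ z S) (hL : Lb b P w z) (hw : w ∈ Dg T g) : z ∈ Dg T g := by
  have hPp := hT.poly P hN.m2.1
  have hSp := hT.poly S hN.m1.1
  have hr := hS.rig hT hz hN hP hn
  have hPw : P ∈ Co T w := ⟨hN.m2.1, hL.e1.1⟩
  by_cases hwS : w ∈ S
  · exact hT.step hw ⟨hN.m1.1, hwS⟩ hPw hN.ne hz hN.m1.2 hN.m2.2 hr
  obtain ⟨s, hs⟩ := hS.tr.sd hS.pg
  have sP : Sd P s := by obtain ⟨_, g, rfl⟩ := hP; exact hs.smul g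
  obtain ⟨_, _, _, r, l, l', e1, e2⟩ := id hN
  obtain ⟨t, ht, hv⟩ := e1.el
  obtain ⟨r2, l2, t2, e3, ht2, hw2, _, _⟩ := id (hL.flip hPp)
  obtain ⟨-, rfl⟩ := e2.not.unique e3
  have ts : t2 = s := by
    have := sP _ _ _ (hL.flip hPp)
    rwa [hw2, add_sub_cancel_left, norm_mul, e1.nl, mul_one, Complex.norm_real, Real.norm_of_nonneg ht2.le] at this
  have hlt : t < t2 := by
    by_contra! hle
    apply hwS
    rw [hw2]
    exact Kc_small hSp.conv hN.m1.2 ht2.le hle hv.1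
  set v := z + t * l with hvdef
  have hvV : v ∈ Vx T := ⟨S, hN.m1.1, hv⟩
  have hvP : v ∈ P := Kc_small hPp.conv hN.m2.2 ht.le hlt.le (by rw [← hw2]; exact hL.e1.1)
  have hvf : v ∉ extremePoints ℝ P := by
    apply not_ext_of_two e1.l0 (s := t2 - t) (t := t) (by linarith) ht
    · have : v + ((t2 - t : ℝ) : ℂ) * l = w := by rw [hw2, hvdef]; push_cast; ring
      rw [this]; exact hL.e1.1
    · have : v - (t : ℂ) * l = z := by rw [hvdef]; ring
      rw [this]; exact hN.m2.2
  obtain ⟨F, hF⟩ := nb_ex' b hT hvV ⟨hN.m2.1, hvP⟩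
  have hFA := hS.prevflat hT hvV ⟨hN.m2.1, hvP⟩ hvf hF
  have sF : Sd F s := by obtain ⟨_, g, rfl⟩ := hFA; exact hs.smul g
  have hwF : w ∈ F := by
    obtain ⟨_, _, _, r4, l4, l5, f1, f2⟩ := id hF
    obtain ⟨m, f3⟩ := e3.edge hPp hN.m2.2 ht hvP
    obtain ⟨a1, a2⟩ := f2.not.unique f3
    have hm : m = l := by
      have := mt (f3.ext hPp.conv hvP).2 hvf
      push Not at this
      simpa using this
    rw [hm] at a2
    obtain ⟨t4, ht4, f4⟩ := f1.lb hFA.1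
    rw [a2] at f4
    have f5 := sF _ _ _ f4
    rw [add_sub_cancel_left, norm_mul, e1.nl, mul_one, Complex.norm_real, Real.norm_of_nonneg ht4.le] at f5
    have : w = v + ((t2 - t : ℝ) : ℂ) * l := by rw [hw2, hvdef]; push_cast; ring
    rw [this]
    exact Kc_small (hT.poly F hF.m1.1).conv hFA.1.1 (by linarith) (by linarith) f4.e2.1
  have hvD : v ∈ Dg T g := by
    apply hT.step hw hPw ⟨hF.m1.1, hwF⟩ hF.ne.symm hvV hvP hF.m1.2
    exact rig_flat hT hvV hF.m2 hvf
  exact hT.step hvD ⟨hN.m1.1, hv.1⟩ hF.m2 hN.ne hz hN.m1.2 hN.m2.2 hr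

theorem caseS3a {b : Bool} (hT : Mono T) {Δ : Set ℂ} (hS : S3 T Δ) {z x : ℂ} (hz : z ∈ Vx T) {P Q S : Set ℂ} {g : Mo}
    (hN : Nb b T z P Q) (hP : Ax Δ z P) (hQ : Ax Δ z Q) (hSP : Nb b T z S P) (hn : ¬ Ax Δ z S) (hL : Lb b P z x)
    (hx : x ∈ Dg T g) : z ∈ Dg T g := by
  have hPp := hT.poly P hN.m1.1
  have nP : nc P = 3 := by obtain ⟨_, g, rfl⟩ := hP; rw [nc_smul, hS.n3]
  obtain ⟨w, L1, L2, nwz, nwx, hext⟩ := hL.tri hPp nP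
  obtain ⟨LQ, NxQP⟩ := AA hT hS hN hP hQ hL
  have hwV : w ∈ Vx T := ⟨P, hN.m1.1, L2.e1⟩
  refine hS.FE hT hz hSP hP hn L2 ?_
  obtain ⟨R, NwRP⟩ := nb_ex' b hT hwV ⟨hN.m1.1, L2.e1.1⟩
  have hPw := hP.mv L2.e1
  by_cases hR : Ax Δ w R
  swap
  · exact hS.FE hT hwV NwRP hPw hR L1 hx
  obtain ⟨LR, NxPR⟩ := AA' hT hS NwRP hPw hR L1
  have hRp := hT.poly R NwRP.m1.1
  have nR : nc R = 3 := by obtain ⟨_, g, rfl⟩ := hR; rw [nc_smul, hS.n3]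
  obtain ⟨y, M1, M2, _, _, _⟩ := LR.tri hRp nR
  have hyV : y ∈ Vx T := ⟨R, NwRP.m1.1, M1.e2⟩
  obtain ⟨u1, u2, u3, hu⟩ := hS.ex b x hx.1
  obtain ⟨-, eR⟩ := hu.mid hT hx.1 NxQP NxPR (hQ.mv LQ.e1) (hP.mv L1.e1) (hR.mv M1.e1)
  obtain ⟨U, NyUR⟩ := nb_ex' b hT hyV ⟨NwRP.m1.1, M1.e2.1⟩
  have hRy := hR.mv M1.e2
  have hU : ¬ Ax Δ y U := by
    intro hU
    obtain ⟨LU, NxRU⟩ := AA' hT hS NyUR hRy hU M1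
    rw [eR] at NxRU
    exact hu.nx hT hx.1 NxRU (hU.mv LU.e2)
  have hyD := hS.FE hT hyV NyUR hRy hU M1 hx
  obtain ⟨v1, v2, v3, hv⟩ := hS.ex b y hyV
  have eR' := hv.first hT NyUR hRy hU
  have NyRV := hv.h1
  rw [← eR'] at NyRV
  obtain ⟨LV, NwVR⟩ := AA hT hS NyRV hRy hv.ax.2.1 M2
  have hVw := hv.ax.2.1.mv LV.e1
  obtain ⟨w1, w2, w3, hw⟩ := hS.ex b w hwV
  have emid := (hw.mid hT hwV NwVR NwRP hVw hR hPw).1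
  apply hT.prop hwV (K := {v2, R, P})
  · rintro X (rfl | rfl | rfl)
    exacts [NwVR.m1, NwVR.m2, NwRP.m2]
  · rintro X (rfl | rfl | rfl)
    exacts [Dg_known hyD NyRV.m2, Dg_known hyD NyRV.m1, Dg_known hx NxPR.m1]
  · exact ⟨P, by simp, L2.e1⟩
  · intro ρ hρ hK
    have m1 := hK v2 (by simp)
    have m2 := hK R (by simp)
    have m3 := hK P (by simp)
    have := (hw.mid hT hwV (NwVR.smul ρ hρ m1 m2) (NwRP.smul ρ hρ m2 m3) (hVw.rot hρ) (hR.rot hρ) (hPw.rot hρ)).1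
    rw [← emid] at this
    rw [sec_fix hT hwV NwVR.m2 hρ this, one_smul]

theorem caseS3 {b : Bool} (hT : Mono T) {Δ : Set ℂ} (hS : S3 T Δ) {z x : ℂ} (hz : z ∈ Vx T) {P Q : Set ℂ} {g : Mo}
    (hN : Nb b T z P Q) (hP : Ax Δ z P) (hQ : Ax Δ z Q) {r l : ℂ} {t : ℝ} (hs : Sb b P z r l) (ht : 0 < t) (hxe : x = z + t * l)
    (hxP : x ∈ P) (hxQ : x ∈ Q) (hx : x ∈ Dg T g) : z ∈ Dg T g := by
  have hPp := hT.poly P hN.m1.1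
  have hQp := hT.poly Q hN.m2.1
  obtain ⟨t', ht', hL⟩ := hs.lb hP.1
  obtain ⟨LQ, NxQP⟩ := AA hT hS hN hP hQ hL
  have hle := ray_uniq hs.l0 hN.m1.2 ht' hL.e2 (by rw [← hxe]; exact hxP)
  have hxe' : x = z + t' * l := by
    rcases hle.lt_or_eq with hlt | e
    swap
    · rw [hxe, e]
    exfalso
    have key : ∀ X, z ∈ X → z + t' * l ∈ X → x ∉ extremePoints ℝ X := by
      intro X h1 h2
      apply not_ext_of_two hs.l0 (s := t' - t) (t := t) (by linarith) ht
      · have : x + ((t' - t : ℝ) : ℂ) * l = z + t' * l := by rw [hxe]; push_cast; ring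
        rwa [this]
      · have : x - (t : ℂ) * l = z := by rw [hxe]; ring
        rwa [this]
    rcases hT.ext_or hx.1 ⟨hN.m1.1, hxP⟩ ⟨hN.m2.1, hxQ⟩ hN.ne with h | h
    · exact key P hP.1.1 hL.e2.1 h
    · exact key Q hQ.1.1 LQ.e1.1 h
  rw [← hxe'] at hL LQ NxQP
  obtain ⟨t1, t2, t3, h⟩ := hS.ex b z hz
  rcases (h.iff P hN.m1).1 hP with rfl | rfl | rfl
  · obtain ⟨S, hSP⟩ := nb_ex' b hT hz hN.m1
    exact caseS3a hT hS hz hN hP hQ hSP (h.flip.nx hT hz hSP.not) hL hx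
  · have e := hN.right hT h.h2
    obtain ⟨S, hQS⟩ := nb_ex b hT hz hN.m2
    have hQS' := hQS
    rw [e] at hQS'
    exact caseS3a hT hS hz hN.not hQ hP hQS.not (h.nx hT hz hQS') (LQ.flip hQp) hx
  · exact absurd hQ (h.nx hT hz hN)


/-- the corona `6,3,3,3,3` -/
structure D6 (b : Bool) (T : Set (Set ℂ)) (z : ℂ) (h t1 t2 t3 t4 : Set ℂ) : Prop where
  c : C5 b T z h t1 t2 t3 t4
  v : z ∈ Vx T
  n0 : nc h = 6
  n1 : nc t1 = 3
  n2 : nc t2 = 3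
  n3 : nc t3 = 3
  n4 : nc t4 = 3

theorem SS.d6 (hS : SS T) (b : Bool) {z : ℂ} (hz : z ∈ Vx T) : ∃ h t1 t2 t3 t4, D6 b T z h t1 t2 t3 t4 := by
  obtain ⟨h, t1, t2, t3, t4, C, n0, n1, n2, n3, n4⟩ := hS.ex b z hz
  exact ⟨h, t1, t2, t3, t4, C, hz, n0, n1, n2, n3, n4⟩

theorem D6.flip {b : Bool} {z : ℂ} {h t1 t2 t3 t4 : Set ℂ} (H : D6 b T z h t1 t2 t3 t4) :
    D6 (!b) T z h t4 t3 t2 t1 :=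
  ⟨H.c.rot.flip, H.v, H.n0, H.n4, H.n3, H.n2, H.n1⟩

theorem D6.hex {b : Bool} {z : ℂ} {h t1 t2 t3 t4 : Set ℂ} (H : D6 b T z h t1 t2 t3 t4) {X : Set ℂ}
    (hX : X ∈ Co T z) (hn : nc X = 6) : X = h := by
  have := H.n1; have := H.n2; have := H.n3; have := H.n4
  rcases H.c.all X hX with rfl | rfl | rfl | rfl | rfl
  · rfl
  all_goals omega

theorem D6.uniq (hT : Mono T) {b : Bool} {z : ℂ} {h t1 t2 t3 t4 : Set ℂ} (H : D6 b T z h t1 t2 t3 t4)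
    {h' t1' t2' t3' t4' : Set ℂ} (H' : D6 b T z h' t1' t2' t3' t4') :
    h' = h ∧ t1' = t1 ∧ t2' = t2 ∧ t3' = t3 ∧ t4' = t4 := by
  obtain rfl := H.hex H'.c.h1.m1 H'.n0
  obtain rfl := H.c.h1.right hT H'.c.h1
  obtain rfl := H.c.h2.right hT H'.c.h2
  obtain rfl := H.c.h3.right hT H'.c.h3
  obtain rfl := H.c.h4.right hT H'.c.h4
  exact ⟨rfl, rfl, rfl, rfl, rfl⟩

theorem D6.tp {b : Bool} {z y : ℂ} {g : Mo} (hg : g • z = y) (hC : g • Co T z = Co T y) (hy : y ∈ Vx T)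
    {h t1 t2 t3 t4 : Set ℂ} (H : D6 b T z h t1 t2 t3 t4) :
    D6 b T y (g • h) (g • t1) (g • t2) (g • t3) (g • t4) :=
  ⟨H.c.tp hg hC, hy, by rw [nc_smul, H.n0], by rw [nc_smul, H.n1], by rw [nc_smul, H.n2], by rw [nc_smul, H.n3],
    by rw [nc_smul, H.n4]⟩

/-- the tile after the hexagon -/
theorem D6.first (hT : Mono T) (hS : SS T) {b : Bool} {z : ℂ} (hz : z ∈ Vx T) {h t : Set ℂ} (hn : nc h = 6)
    (hN : Nb b T z h t) : ∃ t2 t3 t4, D6 b T z h t t2 t3 t4 := by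
  obtain ⟨h', t1, t2, t3, t4, H⟩ := hS.d6 b hz
  obtain rfl := H.hex hN.m1 hn
  obtain rfl := hN.right hT H.c.h1
  exact ⟨_, _, _, H⟩

theorem D6.last (hT : Mono T) (hS : SS T) {b : Bool} {z : ℂ} (hz : z ∈ Vx T) {h t : Set ℂ} (hn : nc h = 6)
    (hN : Nb b T z t h) : ∃ t1 t2 t3, D6 b T z h t1 t2 t3 t := by
  obtain ⟨h', t1, t2, t3, t4, H⟩ := hS.d6 b hz
  obtain rfl := H.hex hN.m2 hn
  obtain rfl := hN.left hT H.c.h5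
  exact ⟨_, _, _, H⟩

def Chi (b : Bool) (T : Set (Set ℂ)) (z : ℂ) : Prop :=
  ∃ h t1 t2 t3 t4 n1 k u3 u4, D6 b T z h t1 t2 t3 t4 ∧ Lb b t1 z n1 ∧ D6 b T n1 k t2 t1 u3 u4

theorem lb_vx (hT : Mono T) {b : Bool} {z x : ℂ} {P : Set ℂ} (hP : P ∈ Co T z) (hL : Lb b P z x) : x ∈ Vx T :=
  ⟨P, hP.1, hL.e2⟩

theorem Chi.n1 (hT : Mono T) (hS : SS T) {b : Bool} {z x : ℂ} {h t1 t2 t3 t4 : Set ℂ} (hc : Chi b T z)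
    (H : D6 b T z h t1 t2 t3 t4) (hL : Lb b t1 z x) : ∃ k u3 u4, D6 b T x k t2 t1 u3 u4 := by
  obtain ⟨h', t1', t2', t3', t4', n1, k, u3, u4, H', hL', K⟩ := hc
  obtain ⟨rfl, rfl, rfl, rfl, rfl⟩ := H.uniq hT H'
  obtain rfl := hL.right hL'
  exact ⟨_, _, _, K⟩

theorem Chi.to_n1 (hT : Mono T) (hS : SS T) {b : Bool} {z x : ℂ} {h t1 t2 t3 t4 : Set ℂ} (hc : Chi b T z)
    (H : D6 b T z h t1 t2 t3 t4) (hL : Lb b t1 z x) : Chi b T x := by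
  obtain ⟨k, u3, u4, K⟩ := hc.n1 hT hS H hL
  exact ⟨_, _, _, _, _, z, _, _, _, K, (H.c.h2.across_nf hT hS.nf H.v hL).1, H⟩

/-- one of the two -/
theorem chi_or (hT : Mono T) (hS : SS T) {b : Bool} {z w : ℂ} {h t1 t2 t3 t4 : Set ℂ}
    (H : D6 b T z h t1 t2 t3 t4) (hL : Lb b h z w) : Chi b T z ∨ Chi (!b) T w := by
  have hw : w ∈ Vx T := lb_vx hT H.c.h1.m1 hL
  obtain ⟨a1, a2⟩ := H.c.h1.across_nf hT hS.nf H.v hL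
  obtain ⟨s1, s2, s3, W⟩ := D6.last hT hS hw H.n0 a2
  have p1 := hT.poly t1 H.c.h1.m2.1
  obtain ⟨n1, b1, b2, -⟩ := a1.tri p1 H.n1
  have hn1 : n1 ∈ Vx T := lb_vx hT H.c.h1.m2 b1
  have e1 := (H.c.h2.across_nf hT hS.nf H.v b1).2
  have e2 := (W.c.h4.back hT hS.nf hw b2).2
  obtain ⟨k, u1, u2, u3, u4, K⟩ := hS.d6 b hn1
  have := K.n0; have := H.n1; have := H.n2; have := W.n3
  rcases K.c.all t2 e1.m1 with rfl | rfl | rfl | rfl | rfl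
  · omega
  · obtain rfl := e1.right hT K.c.h2
    exact Or.inl ⟨_, _, _, _, _, n1, _, _, _, H, b1, K⟩
  · obtain rfl := e1.right hT K.c.h3
    obtain rfl := e2.right hT K.c.h4
    exact Or.inr ⟨_, _, _, _, _, n1, _, _, _, W.flip, b2.flip p1, K.flip⟩
  · obtain rfl := e1.right hT K.c.h4
    obtain rfl := e2.right hT K.c.h5
    omega
  · obtain rfl := e1.right hT K.c.h5
    omega

/-- the hexagon opposite to the second triangle -/
theorem Chi.opp (hT : Mono T) (hS : SS T) {b : Bool} {z x : ℂ} {h t1 t2 t3 t4 : Set ℂ} (hc : Chi b T z)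
    (H : D6 b T z h t1 t2 t3 t4) (hL : Lb b t2 z x) : ∃ k, nc k = 6 ∧ Nb b T x t2 k := by
  have p2 := hT.poly t2 H.c.h2.m2.1
  obtain ⟨y, b1, b2, -⟩ := hL.tri p2 H.n2
  have hy := (H.c.h2.back hT hS.nf H.v b2).1
  obtain ⟨k, u3, u4, K⟩ := hc.n1 hT hS H hy
  exact ⟨k, K.n0, (K.c.h1.back hT hS.nf K.v b1).2⟩

theorem chi_not (hT : Mono T) (hS : SS T) {b : Bool} {z : ℂ} (h1 : Chi b T z) (h2 : Chi (!b) T z) : False := by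
  have hz : z ∈ Vx T := by obtain ⟨_, _, _, _, _, _, _, _, _, H, _⟩ := h1; exact H.v
  obtain ⟨h, t1, t2, t3, t4, H⟩ := hS.d6 b hz
  have p2 := hT.poly t2 H.c.h2.m2.1
  have p3 := hT.poly t3 H.c.h3.m2.1
  obtain ⟨x, hL⟩ := Lb.ex b p2 (hS.nf z hz t2 H.c.h2.m2)
  obtain ⟨k, hk, hN⟩ := h1.opp hT hS H hL
  obtain ⟨a1, a2⟩ := H.c.h3.across_nf hT hS.nf hz hL
  obtain ⟨k', hk', hN'⟩ := h2.opp hT hS H.flip (a1.flip p3)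
  have hN' := hN'.not'
  have hx : x ∈ Vx T := lb_vx hT H.c.h2.m2 hL
  obtain ⟨r2, r3, r4, K⟩ := D6.first hT hS hx hk' hN'
  obtain rfl := a2.right hT K.c.h2
  obtain rfl := hN.right hT K.c.h3
  have := K.n3
  omega

theorem Chi.vx {b : Bool} {z : ℂ} (h : Chi b T z) : z ∈ Vx T := by
  obtain ⟨_, _, _, _, _, _, _, _, _, H, _⟩ := h; exact H.v

/-- backwards along the hexagon -/
theorem Chi.prev (hT : Mono T) (hS : SS T) {b : Bool} {z y : ℂ} {h : Set ℂ} (hh : h ∈ Co T z) (hn : nc h = 6)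
    (hc : Chi b T z) (hL : Lb b h y z) : Chi b T y := by
  have hy : y ∈ Vx T := ⟨h, hh.1, hL.e1⟩
  obtain ⟨h', t1, t2, t3, t4, H⟩ := hS.d6 b hy
  obtain rfl := H.hex ⟨hh.1, hL.e1.1⟩ hn
  rcases chi_or hT hS H hL with h | h
  · exact h
  · exact (chi_not hT hS hc h).elim

theorem Chi.next (hT : Mono T) (hS : SS T) {b : Bool} {z w : ℂ} {h : Set ℂ} (hh : h ∈ Co T z) (hn : nc h = 6)
    (hc : Chi b T z) (hL : Lb b h z w) : Chi b T w := by
  classical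
  have ph := hT.poly h hh.1
  set S : Set ℂ := {v | v ∈ extremePoints ℝ h ∧ Chi b T v} with hSdef
  have hfin : S.Finite := ph.fin.subset fun v hv => hv.1
  have hp : ∀ v ∈ S, ∃ u, Lb b h u v := fun v hv => Lb.ex' b ph hv.1
  choose! f hf using hp
  have hmaps : ∀ v ∈ S, f v ∈ S := fun v hv =>
    ⟨(hf v hv).e1, hv.2.prev hT hS ⟨hh.1, hv.1.1⟩ hn (hf v hv)⟩
  have hinj : InjOn f S := by
    intro u hu v hv e
    have h1 := hf u hu
    rw [e] at h1
    exact h1.right (hf v hv)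
  have himg : f '' S = S := by
    apply Set.eq_of_subset_of_ncard_le
    · rintro _ ⟨v, hv, rfl⟩; exact hmaps v hv
    · rw [hinj.ncard_image]
    · exact hfin
  have hz : z ∈ S := ⟨hL.e1, hc⟩
  rw [← himg] at hz
  obtain ⟨v, hv, e⟩ := hz
  have := hf v hv
  rw [e] at this
  rw [hL.right this]
  exact hv.2

theorem Chi.nbr (hT : Mono T) (hS : SS T) {b : Bool} {z x : ℂ} {P Q : Set ℂ} (hc : Chi b T z) (hN : Nb b T z P Q)
    (hL : Lb b P z x) : Chi b T x := by
  obtain ⟨h, t1, t2, t3, t4, H⟩ := hS.d6 b hc.vx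
  have hz := hc.vx
  rcases H.c.all P hN.m1 with rfl | rfl | rfl | rfl | rfl
  · exact hc.next hT hS H.c.h1.m1 H.n0 hL
  · exact hc.to_n1 hT hS H hL
  · have p2 := hT.poly P H.c.h2.m2.1
    obtain ⟨y, b1, b2, -⟩ := hL.tri p2 H.n2
    have hy := (H.c.h2.back hT hS.nf hz b2).1
    obtain ⟨k, u3, u4, K⟩ := hc.n1 hT hS H hy
    have hcy := hc.to_n1 hT hS H hy
    exact hcy.next hT hS K.c.h1.m1 K.n0 (K.c.h1.back hT hS.nf K.v b1).1
  · have p4 := hT.poly t4 H.c.h4.m2.1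
    obtain ⟨a1, a2⟩ := H.c.h4.across_nf hT hS.nf hz hL
    obtain ⟨y, b1, b2, -⟩ := a1.tri p4 H.n4
    obtain ⟨d1, d2⟩ := H.c.h5.across_nf hT hS.nf hz b1
    have hcy := hc.prev hT hS H.c.h1.m1 H.n0 d1
    obtain ⟨_, _, _, Y⟩ := D6.first hT hS hcy.vx H.n0 d2
    exact hcy.to_n1 hT hS Y b2
  · exact hc.prev hT hS H.c.h1.m1 H.n0 (H.c.h5.across_nf hT hS.nf hz hL).1

theorem chi_all (hT : Mono T) (hS : SS T) : ∃ b, ∀ z ∈ Vx T, Chi b T z := by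
  obtain ⟨b, x, hx⟩ : ∃ b x, Chi b T x := by
    obtain ⟨z, hz⟩ := hT.vx_ne
    obtain ⟨h, t1, t2, t3, t4, H⟩ := hS.d6 true hz
    obtain ⟨w, hL⟩ := Lb.ex true (hT.poly h H.c.h1.m1.1) (hS.nf z hz h H.c.h1.m1)
    rcases chi_or hT hS H hL with h | h
    · exact ⟨_, _, h⟩
    · exact ⟨_, _, h⟩
  refine ⟨b, ?_⟩
  have := hT.connected (D := {z | Chi b T z}) ⟨x, hx, hx.vx⟩ ?_
  · exact this
  · intro x hx hxv P hP Q hQ hne z hz hzP hzQ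
    have hx : Chi b T x := hx
    show Chi b T z
    by_cases hzx : z = x
    · rw [hzx]; exact hx
    obtain ⟨β, hN, hL⟩ := share_edge hT hxv hP hQ hne hzx hzP hzQ
    have hL := hL (hS.nf x hxv P hP) (hS.nf z hz P ⟨hP.1, hzP⟩)
    by_cases hβ : β = b
    · subst hβ
      exact hx.nbr hT hS hN hL
    · have : β = !b := by cases β <;> cases b <;> simp_all
      subst this
      have h1 := (hN.across_nf hT hS.nf hxv hL).1
      exact hx.nbr hT hS hN.not' (h1.flip' (hT.poly Q hQ.1))

theorem chi_rule (hT : Mono T) (hS : SS T) {b : Bool} (hc : ∀ z ∈ Vx T, Chi b T z) {z x : ℂ} {g : Mo}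
    {h t1 t2 t3 t4 k u3 u4 : Set ℂ} (H : D6 b T z h t1 t2 t3 t4) (hL : Lb b t1 z x)
    (K : D6 b T x k t2 t1 u3 u4) (hx : g • x ∈ Vx T) (hN : Nb b T (g • x) (g • k) (g • t2)) : z ∈ Dg T g := by
  obtain ⟨v2, v3, v4, V⟩ := D6.first hT hS hx (by rw [nc_smul, K.n0]) hN
  have a1 := (H.c.h2.across_nf hT hS.nf H.v hL).1.smul g
  obtain ⟨k', w3, w4, W⟩ := (hc _ hx).n1 hT hS V a1
  obtain ⟨m, hm, hC⟩ := hT.mono z H.v _ W.v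
  obtain ⟨-, -, e, -, -⟩ := W.uniq hT (H.tp hm hC W.v)
  have hfix : g⁻¹ * m = 1 := by
    apply sec_fix hT H.v H.c.h2.m2
    · rw [mul_smul, hm, inv_smul_smul]
    · rw [mul_smul, e, inv_smul_smul]
  have : m = g := by
    have := congrArg (g * ·) hfix
    simpa using this
  subst this
  exact ⟨H.v, W.v, hC⟩

theorem SS.rig (hT : Mono T) (hS : SS T) {b : Bool} {z : ℂ} {h t1 t2 t3 t4 : Set ℂ} (H : D6 b T z h t1 t2 t3 t4)
    (X : Set ℂ) : Rig T z h X := by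
  intro ρ h1 h2 _
  have e := H.hex h2 (by rw [nc_smul, H.n0])
  rw [sec_fix hT H.v H.c.h1.m1 h1 e, one_smul]

theorem caseSS_aux (hT : Mono T) (hS : SS T) {b : Bool} (hc : ∀ z ∈ Vx T, Chi b T z) {z x : ℂ} {g : Mo}
    {P Q : Set ℂ} (hz : z ∈ Vx T) (hN : Nb b T z P Q) (hnr : ¬ Rig T z P Q) (hL : Lb b P z x) (hx : x ∈ Dg T g) :
    z ∈ Dg T g := by
  obtain ⟨h, t1, t2, t3, t4, H⟩ := hS.d6 b hz
  have key : ∀ {w : ℂ} {A B : Set ℂ}, w ∈ Dg T g → Nb b T w A B → Nb b T (g • w) (g • A) (g • B) := by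
    intro w A B hw hN
    exact hN.smul g rfl ⟨Dg_known hw hN.m1, Set.smul_mem_smul_set hN.m1.2⟩
      ⟨Dg_known hw hN.m2, Set.smul_mem_smul_set hN.m2.2⟩
  rcases H.c.all P hN.m1 with rfl | rfl | rfl | rfl | rfl
  · exact (hnr (hS.rig hT H Q)).elim
  · obtain ⟨k, u3, u4, K⟩ := (hc z hz).n1 hT hS H hL
    exact chi_rule hT hS hc H hL K hx.2.1 (key hx K.c.h1)
  · have p2 := hT.poly P H.c.h2.m2.1
    obtain ⟨y, b1, b2, -⟩ := hL.tri p2 H.n2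
    have hy := (H.c.h2.back hT hS.nf hz b2).1
    obtain ⟨k, u3, u4, K⟩ := (hc z hz).n1 hT hS H hy
    have d := key hx (K.c.h1.back hT hS.nf K.v b1).2
    have hgy : g • y ∈ Vx T := ⟨g • P, Dg_known hx (K.c.h1.back hT hS.nf K.v b1).2.m1, (ext_smul_iff _ _ _).2 b2.e1⟩
    exact chi_rule hT hS hc H hy K hgy (d.across_nf hT hS.nf hx.2.1 (b1.smul g)).2
  · have p4 := hT.poly t4 H.c.h4.m2.1
    obtain ⟨a1, a2⟩ := H.c.h4.across_nf hT hS.nf hz hL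
    obtain ⟨y, b1, b2, -⟩ := a1.tri p4 H.n4
    obtain ⟨d1, d2⟩ := H.c.h5.across_nf hT hS.nf hz b1
    have hy : y ∈ Vx T := lb_vx hT H.c.h1.m1 (d1.flip (hT.poly h H.c.h1.m1.1))
    obtain ⟨_, _, _, Y⟩ := D6.first hT hS hy H.n0 d2
    obtain ⟨k, u3, u4, K⟩ := (hc y hy).n1 hT hS Y b2
    have hyD := chi_rule hT hS hc Y b2 K hx.2.1 (key hx K.c.h1)
    exact hT.step hyD d2.m1 d2.m2 d2.ne hz H.c.h1.m1.2 H.c.h4.m2.2 (hS.rig hT H _)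
  · obtain rfl := hN.right hT H.c.h5
    exact (hnr (hS.rig hT H P).symm).elim

theorem caseSS (hT : Mono T) (hS : SS T) {b : Bool} {z x : ℂ} {g : Mo} {P Q : Set ℂ} (hz : z ∈ Vx T)
    (hN : Nb b T z P Q) (hnr : ¬ Rig T z P Q) (hL : Lb b P z x) (hx : x ∈ Dg T g) : z ∈ Dg T g := by
  obtain ⟨β, hc⟩ := chi_all hT hS
  by_cases hβ : b = β
  · subst hβ
    exact caseSS_aux hT hS hc hz hN hnr hL hx
  · have : b = !β := by cases β <;> cases b <;> simp_all
    subst this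
    have h1 := (hN.across_nf hT hS.nf hz hL).1
    exact caseSS_aux hT hS hc hz hN.not' (fun h => hnr h.symm) (h1.flip' (hT.poly Q hN.m2.1)) hx


theorem Mono.main (hT : Mono T) : ∃ g : Mo, g.a ≠ 1 ∧ g • T = T := by
  apply hT.final
  apply hT.allSym
  intro g x hx P hPx Q hQx hne z hz hzx hzP hzQ hnr
  have hP : P ∈ Co T z := ⟨hPx.1, hzP⟩
  have hQ : Q ∈ Co T z := ⟨hQx.1, hzQ⟩
  obtain ⟨b, hN, r, l, t, hs, ht, hxe⟩ := share_dir hT hz hP hQ hne (Ne.symm hzx) hPx.2 hQx.2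
  obtain ⟨b', hN', hL'⟩ := share_edge hT hz hP hQ hne (Ne.symm hzx) hPx.2 hQx.2
  obtain ⟨ρ, h⟩ := not_rig hnr
  have hL : NF T → Lb b' P z x := fun hF => hL' (hF z hz P hP) (hF x hx.1 P hPx)
  have hzPe := h.ext hT hz hP
  rcases classify hT hz h hN' with ⟨h1, h2⟩ | ⟨h1, h2⟩ | h1 | h1 | ⟨h1, h2⟩
  · exact caseN1 hT hz h hN' h1 h2 (hL h1.nf) hx
  · exact caseN1 hT hz h.symm hN'.not h1 h2
      ((hN'.across_nf hT h1.nf hz (hL h1.nf)).1.flip (hT.poly Q hQ.1)) hx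
  · exact caseSQ hT hz hN' h1 hnr (hL h1.nf) hx
  · exact caseSS hT h1 hz hN' hnr (hL h1.nf) hx
  · refine caseS3 hT h1 hz hN ⟨hzPe, 1, one_smul _ _⟩ ⟨Lt_ext hzPe h2, ?_⟩ hs ht hxe hPx.2 hQx.2 hx
    obtain ⟨-, g, e, -⟩ := h2
    exact ⟨g, e⟩

/-- the identification of the plane with the complex numbers -/
def eC : E2 ≃ₗᵢ[ℝ] ℂ := Complex.orthonormalBasisOneI.repr.symm

theorem eC_of (f : E2 ≃ᵃⁱ[ℝ] E2) (hf : OrientationPreserving f) : ∃ g : Mo, ∀ p, eC (f p) = g • eC p := by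
  set F : ℂ ≃ₗᵢ[ℝ] ℂ := (eC.symm.trans f.linearIsometryEquiv).trans eC with hF
  have hdet : LinearMap.det (F.toLinearEquiv : ℂ →ₗ[ℝ] ℂ) = 1 := by
    rw [← hf]
    exact LinearMap.det_conj (f.linearIsometryEquiv.toLinearEquiv : E2 →ₗ[ℝ] E2) eC.toLinearEquiv
  have hfp : ∀ p, eC (f p) = F (eC p) + eC (f 0) := by
    intro p
    have h1 : f p = f.linearIsometryEquiv p + f 0 := by
      have := f.map_vadd 0 p
      simpa using this
    rw [h1, map_add, hF]
    simp
  obtain ⟨a, ha | ha⟩ := linear_isometry_complex F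
  · refine ⟨⟨a, eC (f 0)⟩, fun p => ?_⟩
    rw [hfp, ha, Mo.smul_def, rotation_apply]
  · exfalso
    rw [ha] at hdet
    have : LinearMap.det ((Complex.conjLIE.trans (rotation a)).toLinearEquiv : ℂ →ₗ[ℝ] ℂ) =
        LinearMap.det ((rotation a).toLinearEquiv : ℂ →ₗ[ℝ] ℂ) * LinearMap.det (Complex.conjAe.toLinearMap : ℂ →ₗ[ℝ] ℂ) := by
      rw [← LinearMap.det_comp]; rfl
    rw [this, det_rotation, Complex.det_conjAe] at hdet
    norm_num at hdet

theorem eC_to (g : Mo) : ∃ f : E2 ≃ᵃⁱ[ℝ] E2, OrientationPreserving f ∧ ∀ p, eC (f p) = g • eC p := by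
  refine ⟨(eC.toAffineIsometryEquiv.trans ((rotation g.a).toAffineIsometryEquiv.trans
    (AffineIsometryEquiv.constVAdd ℝ ℂ g.b))).trans eC.symm.toAffineIsometryEquiv, ?_, ?_⟩
  · have h := LinearMap.det_conj ((rotation g.a).toLinearEquiv : ℂ →ₗ[ℝ] ℂ) eC.symm.toLinearEquiv
    rw [det_rotation] at h
    rw [OrientationPreserving, ← h]
    rfl
  · intro p
    simp [Mo.smul_def, add_comm]

theorem eC_image {f : E2 ≃ᵃⁱ[ℝ] E2} {g : Mo} (h : ∀ p, eC (f p) = g • eC p) (P : Set E2) :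
    eC '' (f '' P) = g • (eC '' P) := by
  ext z
  constructor
  · rintro ⟨_, ⟨p, hp, rfl⟩, rfl⟩
    exact ⟨eC p, ⟨p, hp, rfl⟩, (h p).symm⟩
  · rintro ⟨_, ⟨p, hp, rfl⟩, rfl⟩
    exact ⟨_, ⟨p, hp, rfl⟩, h p⟩

theorem eC_ext (P : Set E2) (x : E2) : eC x ∈ extremePoints ℝ (eC '' P) ↔ x ∈ extremePoints ℝ P := by
  have := image_extremePoints (𝕜 := ℝ) eC.toLinearEquiv P
  have h2 : eC '' extremePoints ℝ P = extremePoints ℝ (eC '' P) := this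
  rw [← h2]
  exact eC.injective.mem_set_image

theorem eC_int (P : Set E2) : interior (eC '' P) = eC '' interior P :=
  (eC.toHomeomorph.image_interior P).symm

def TC (T : Set (Set E2)) : Set (Set ℂ) := (fun P => eC '' P) '' T

theorem eC_inj {P Q : Set E2} (h : eC '' P = eC '' Q) : P = Q := eC.injective.image_injective h

theorem TC_co (T : Set (Set E2)) (x : E2) : Co (TC T) (eC x) = (fun P => eC '' P) '' {P | P ∈ T ∧ x ∈ P} := by
  ext X
  constructor
  · rintro ⟨⟨P, hP, rfl⟩, p, hp, e⟩
    obtain rfl := eC.injective e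
    exact ⟨P, ⟨hP, hp⟩, rfl⟩
  · rintro ⟨P, ⟨hP, hp⟩, rfl⟩
    exact ⟨⟨P, hP, rfl⟩, x, hp, rfl⟩

theorem TC_img {f : E2 ≃ᵃⁱ[ℝ] E2} {g : Mo} (h : ∀ p, eC (f p) = g • eC p) (A : Set (Set E2)) :
    (fun P => eC '' P) '' ((fun P => f '' P) '' A) = g • ((fun P => eC '' P) '' A) := by
  ext X
  constructor
  · rintro ⟨_, ⟨P, hP, rfl⟩, rfl⟩
    exact ⟨eC '' P, ⟨P, hP, rfl⟩, (eC_image h P).symm⟩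
  · rintro ⟨_, ⟨P, hP, rfl⟩, rfl⟩
    exact ⟨_, ⟨P, hP, rfl⟩, eC_image h P⟩

theorem TC_vx {T : Set (Set E2)} {z : ℂ} (h : z ∈ Vx (TC T)) : ∃ x, IsVertex T x ∧ eC x = z := by
  obtain ⟨_, ⟨P, hP, rfl⟩, hz⟩ := h
  obtain ⟨x, -, rfl⟩ := hz.1
  exact ⟨x, ⟨P, hP, (eC_ext P x).1 hz⟩, rfl⟩

theorem TC_mono {T : Set (Set E2)} (hT : IsTiling T) (hmc : MonocoronalRM T) : Mono (TC T) where
  poly := by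
    rintro _ ⟨P, hP, rfl⟩
    obtain ⟨h1, h2, h3, h4⟩ := hT.2.1 P hP
    refine ⟨h1.image eC.continuous, h2.linear_image eC.toLinearEquiv.toLinearMap, ?_, ?_⟩
    · show (interior (eC '' P)).Nonempty
      rw [eC_int]; exact h3.image _
    · have : extremePoints ℝ (eC '' P) = eC '' extremePoints ℝ P := (image_extremePoints (𝕜 := ℝ) eC.toLinearEquiv P).symm
      show (extremePoints ℝ (eC '' P)).Finite
      rw [this]; exact h4.image _
  cov := by
    intro z
    obtain ⟨P, hP, h⟩ : eC.symm z ∈ ⋃₀ T := by rw [hT.2.2.1]; trivial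
    exact ⟨eC '' P, ⟨P, hP, rfl⟩, _, h, by simp⟩
  dis := by
    rintro _ ⟨P, hP, rfl⟩ _ ⟨Q, hQ, rfl⟩ z h1 h2
    simp only at h1 h2 ⊢
    rw [eC_int] at h1 h2
    obtain ⟨p, h1, rfl⟩ := h1
    obtain ⟨q, h2, e⟩ := h2
    obtain rfl := eC.injective e
    by_contra hne
    exact Set.disjoint_left.1 (hT.2.2.2 hP hQ (fun e => hne (by rw [e]))) h1 h2
  mono := by
    intro x hx y hy
    obtain ⟨x, hxv, rfl⟩ := TC_vx hx
    obtain ⟨y, hyv, rfl⟩ := TC_vx hy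
    obtain ⟨f, ho, hf, hC⟩ := hmc x y hxv hyv
    obtain ⟨g, hg⟩ := eC_of f ho
    refine ⟨g, by rw [← hg, hf], ?_⟩
    rw [TC_co, TC_co, ← hC, TC_img hg]

theorem TC_sym {f : E2 ≃ᵃⁱ[ℝ] E2} {g : Mo} {T : Set (Set E2)} (hf : ∀ p, eC (f p) = g • eC p)
    (hg : g • TC T = TC T) : IsSymmetry T f := by
  have h1 := TC_img hf T
  have h2 : g • TC T = (fun P => eC '' P) '' T := hg
  rw [TC] at h2
  rw [h2] at h1
  exact (eC.injective.image_injective.image_injective) h1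

end SecAux

/-- Every monocoronal (up to rigid motions) tiling of the plane by convex polygons
has a center of rotational symmetry of order at least 2: its symmetry group contains
a nontrivial orientation-preserving isometry with a fixed point. -/
theorem monocoronalRM_has_rotation (T : Set (Set E2)) (hT : IsTiling T)
    (hmc : MonocoronalRM T) :
    ∃ f : E2 ≃ᵃⁱ[ℝ] E2, IsSymmetry T f ∧ OrientationPreserving f ∧
      f ≠ AffineIsometryEquiv.refl ℝ E2 ∧ ∃ p : E2, f p = p := by
  obtain ⟨g, ha, hg⟩ := (TC_mono hT hmc).main
  obtain ⟨f, ho, hf⟩ := eC_to g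
  have ha' : (1 : ℂ) - g.a ≠ 0 := by
    intro h
    apply ha
    apply Circle.ext
    rw [Circle.coe_one]
    linear_combination -h
  refine ⟨f, ?_, ho, ?_, ?_⟩
  · exact TC_sym hf hg
  · rintro rfl
    have h0 := hf 0
    have h1 := hf (eC.symm 1)
    simp only [AffineIsometryEquiv.coe_refl, id_eq, LinearIsometryEquiv.apply_symm_apply, map_zero, Mo.smul_def,
      mul_zero, zero_add, mul_one] at h0 h1
    apply ha'
    linear_combination h1 - h0
  · refine ⟨eC.symm (g.b / (1 - g.a)), ?_⟩
    apply eC.injective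
    rw [hf, LinearIsometryEquiv.apply_symm_apply, Mo.smul_def]
    field_simp
    ring
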